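/- Let A(t), B(t) ∈ ℤ[t] be such that Δ(t) = −16(4A(t)³ + 27B(t)²) is not the zero polynomial and j(t) = −6912·A(t)³/(4A(t)³ + 27B(t)²) is non-constant, and let a be a nonzero integer. Fix ε > 0. Then there is a constant C > 0 (depending only on A, B, a, ε) such that for all real x ≥ 2 and all T ≥ x^{3/4+ε}, (1/#F(T))·Σ_{τ ∈ F(T), Δ(τ) ≠ 0} Π_{E(τ)}(a, x) ≤ C·x^{3/4}. -/

import Mathlib

/-- The Farey pairs of order `T`: coprime pairs `(α, β)` of positive integers
with `α, β ≤ T`; the pair `(α, β)` represents the Farey fraction `α/β ∈ F(T)`. -/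
noncomputable def fareyPairs (T : ℝ) : Finset (ℕ × ℕ) :=
  (Finset.Icc 1 ⌊T⌋₊ ×ˢ Finset.Icc 1 ⌊T⌋₊).filter fun ab => Nat.Coprime ab.1 ab.2

/-- The Farey fraction `α/β ∈ ℚ` associated to a pair `(α, β)`. -/
def fareyFrac (ab : ℕ × ℕ) : ℚ := (ab.1 : ℚ) / (ab.2 : ℚ)

/-- Evaluation of an integer polynomial at a rational point. -/
def evalQ (A : Polynomial ℤ) (τ : ℚ) : ℚ := Polynomial.eval₂ (Int.castRingHom ℚ) τ A

/-- The discriminant `Δ(τ) = −16(4A(τ)³ + 27B(τ)²)` of the specialized curve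
`E(τ) : Y² = X³ + A(τ)X + B(τ)`. -/
def discQ (A B : Polynomial ℤ) (τ : ℚ) : ℚ :=
  -16 * (4 * evalQ A τ ^ 3 + 27 * evalQ B τ ^ 2)

/-- The reduction of a rational number modulo `p` (for `p` not dividing the
denominator this is the usual reduction). -/
def ratRed (p : ℕ) (q : ℚ) : ZMod p := (q.num : ZMod p) * ((q.den : ZMod p))⁻¹

/-- The curve `E(τ) : Y² = X³ + A(τ)X + B(τ)` has good reduction at `p` (for this
model): `p` divides neither the denominators of `A(τ)`, `B(τ)` nor the
discriminant `Δ(τ)`, i.e. `p ∤ N(τ)`. -/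
def goodRed (A B : Polynomial ℤ) (τ : ℚ) (p : ℕ) : Prop :=
  ¬ (p : ℤ) ∣ (evalQ A τ).den ∧ ¬ (p : ℤ) ∣ (evalQ B τ).den ∧
    ratRed p (discQ A B τ) ≠ 0

/-- The number of affine points `(x, y) ∈ 𝔽_p²` on `y² = x³ + a·x + b`. -/
def affinePoints (p : ℕ) (a b : ZMod p) : ℕ :=
  ((Finset.range p ×ˢ Finset.range p).filter fun xy =>
    (xy.2 : ZMod p) ^ 2 = (xy.1 : ZMod p) ^ 3 + a * (xy.1 : ZMod p) + b).card

/-- The Frobenius trace `a_p(τ) = p + 1 − #E_p(τ)(𝔽_p)` of the reduction mod `p`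
of the curve `E(τ) : Y² = X³ + A(τ)X + B(τ)` (the projective point count is the
affine count plus one, for the point at infinity). -/
def apFrob (A B : Polynomial ℤ) (τ : ℚ) (p : ℕ) : ℤ :=
  (p : ℤ) - affinePoints p (ratRed p (evalQ A τ)) (ratRed p (evalQ B τ))

open Classical in
/-- `Π_{E(τ)}(a, x)`: the number of primes `p ≤ x` of good reduction for `E(τ)`
with `a_p(τ) = a`. -/
noncomputable def PiTrace (A B : Polynomial ℤ) (τ : ℚ) (a : ℤ) (x : ℝ) : ℕ :=
  ((Finset.range (⌊x⌋₊ + 1)).filter fun p =>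
    p.Prime ∧ goodRed A B τ p ∧ apFrob A B τ p = a).card

/-- The `j`-invariant `j(t) = −6912·A(t)³/(4A(t)³ + 27B(t)²)` is a non-constant
rational function: for no constant `c ∈ ℚ` does `−6912·A(t)³ = c·(4A(t)³ + 27B(t)²)`
hold identically. -/
def jNonconstant (A B : Polynomial ℤ) : Prop :=
  ∀ c : ℚ, (-6912 : Polynomial ℚ) * (A.map (Int.castRingHom ℚ)) ^ 3 ≠
    Polynomial.C c *
      (4 * (A.map (Int.castRingHom ℚ)) ^ 3 + 27 * (B.map (Int.castRingHom ℚ)) ^ 2)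

namespace HasseJet

open MvPolynomial

/-- The coefficient ring `F[Q, R]`. -/
abbrev Base (F : Type*) [Field F] := MvPolynomial (Fin 2) F

/-- Polynomials over `F[Q, R]` in the variables `X_m = (m, false)`, `Y_m = (m, true)`. -/
abbrev Jet (F : Type*) [Field F] (ι : Type*) := MvPolynomial (ι × Bool) (Base F)

section Sl2

variable (A : Type*) [CommRing A] (ι : Type*)

/-- The raising operator `X_m ↦ Y_m`, `Y_m ↦ 0`. -/
noncomputable def raise : Derivation A (MvPolynomial (ι × Bool) A) (MvPolynomial (ι × Bool) A) :=
  mkDerivation A fun i => if i.2 then 0 else X (i.1, true)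

/-- The lowering operator `Y_m ↦ X_m`, `X_m ↦ 0`. -/
noncomputable def lower : Derivation A (MvPolynomial (ι × Bool) A) (MvPolynomial (ι × Bool) A) :=
  mkDerivation A fun i => if i.2 then X (i.1, false) else 0

@[simp] lemma raise_X (m : ι) (b : Bool) :
    raise A ι (X (m, b)) = if b then 0 else X (m, true) := by
  simp [raise, mkDerivation_X]

@[simp] lemma lower_X (m : ι) (b : Bool) :
    lower A ι (X (m, b)) = if b then X (m, false) else 0 := by
  simp [lower, mkDerivation_X]

variable {ι}

/-- The weights `-1` for `X_m` and `1` for `Y_m`. -/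
def xwt (i : ι × Bool) : ℤ := if i.2 then 1 else -1

@[simp] lemma xwt_mk (m : ι) (b : Bool) : xwt (m, b) = if b then 1 else -1 := rfl

end Sl2

section General

variable {A σ : Type*} [CommRing A]

/-- A derivation that shifts the weights of the variables by `k` shifts all weights by `k`. -/
lemma IsWeightedHomogeneous.mkDerivation {w : σ → ℤ} {v : σ → MvPolynomial σ A} {k : ℤ}
    (hv : ∀ i, IsWeightedHomogeneous w (v i) (w i + k)) {P : MvPolynomial σ A} {n : ℤ}
    (hP : IsWeightedHomogeneous w P n) :
    IsWeightedHomogeneous w (MvPolynomial.mkDerivation A v P) (n + k) := by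
  classical
  rw [P.as_sum, map_sum]
  refine IsWeightedHomogeneous.sum _ _ _ fun s hs => ?_
  rw [mkDerivation_monomial]
  have hs' : Finsupp.weight w s = n := hP (mem_support_iff.mp hs)
  rw [← mem_weightedHomogeneousSubmodule]
  refine Submodule.smul_mem _ _ (Submodule.sum_mem _ fun i hi => ?_)
  simp only [mem_weightedHomogeneousSubmodule, smul_eq_mul]
  have h1 : IsWeightedHomogeneous w (monomial (s - Finsupp.single i 1) ((s i : ℕ) : A))
      (n - w i) := by
    refine isWeightedHomogeneous_monomial _ _ _ ?_
    have h2 : s - Finsupp.single i 1 + Finsupp.single i 1 = s := by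
      refine tsub_add_cancel_of_le ?_
      rw [Finsupp.single_le_iff]
      exact Nat.one_le_iff_ne_zero.mpr (Finsupp.mem_support_iff.mp hi)
    have h3 := congrArg (Finsupp.weight w) h2
    rw [map_add, hs', Finsupp.weight_single] at h3
    simp at h3
    linarith
  have := h1.mul (hv i)
  convert this using 1
  ring

/-- A linear map shifting weights by `k` commutes with taking homogeneous components. -/
lemma component_shift {w : σ → ℤ} {k : ℤ} (D : MvPolynomial σ A →+ MvPolynomial σ A)
    (hD : ∀ (P : MvPolynomial σ A) (n : ℤ), IsWeightedHomogeneous w P n →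
      IsWeightedHomogeneous w (D P) (n + k)) (P : MvPolynomial σ A) (n : ℤ) :
    weightedHomogeneousComponent w (n + k) (D P) =
      D (weightedHomogeneousComponent w n P) := by
  classical
  have key : ∀ s a, weightedHomogeneousComponent w (n + k) (D (monomial s a)) =
      D (weightedHomogeneousComponent w n (monomial s a)) := by
    intro s a
    have hm : IsWeightedHomogeneous w (monomial s a : MvPolynomial σ A) (Finsupp.weight w s) :=
      isWeightedHomogeneous_monomial _ _ _ rfl
    by_cases h : Finsupp.weight w s = n
    · subst h
      rw [hm.weightedHomogeneousComponent_same, (hD _ _ hm).weightedHomogeneousComponent_same]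
    · rw [hm.weightedHomogeneousComponent_ne _ (Ne.symm h),
        (hD _ _ hm).weightedHomogeneousComponent_ne _ (by intro h'; apply h; linarith), map_zero]
  rw [P.as_sum]
  simp only [map_sum, key]

lemma totalDegree_mkDerivation_le {v : σ → MvPolynomial σ A} (hv : ∀ i, (v i).totalDegree ≤ 1)
    (P : MvPolynomial σ A) : (mkDerivation A v P).totalDegree ≤ P.totalDegree := by
  classical
  conv_lhs => rw [P.as_sum, map_sum]
  refine totalDegree_finsetSum_le fun s hs => ?_
  rw [mkDerivation_monomial]
  refine (totalDegree_smul_le _ _).trans (totalDegree_finsetSum_le fun i hi => ?_)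
  simp only [smul_eq_mul]
  refine (totalDegree_mul _ _).trans ?_
  have h2 : s - Finsupp.single i 1 + Finsupp.single i 1 = s := by
    refine tsub_add_cancel_of_le ?_
    rw [Finsupp.single_le_iff]
    exact Nat.one_le_iff_ne_zero.mpr (Finsupp.mem_support_iff.mp hi)
  have h3 := congrArg Finsupp.degree h2
  rw [map_add, Finsupp.degree_single] at h3
  have h4 := totalDegree_monomial_le (s - Finsupp.single i 1) ((s i : ℕ) : A)
  have h5 := le_totalDegree hs
  have h6 := hv i
  change totalDegree _ ≤ Finsupp.degree _ at h4
  change Finsupp.degree _ ≤ _ at h5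
  change Finsupp.degree _ + 1 = Finsupp.degree _ at h3
  omega

/-- Homogeneous components are dominated by the total degree. -/
lemma totalDegree_component_le {w : σ → ℤ} (P : MvPolynomial σ A) (n : ℤ) :
    (weightedHomogeneousComponent w n P).totalDegree ≤ P.totalDegree := by
  classical
  refine totalDegree_le_of_support_subset fun s hs => ?_
  rw [mem_support_iff, coeff_weightedHomogeneousComponent] at hs
  rw [mem_support_iff]
  exact fun h => hs (by simp [h])

/-- Euler's identity with integer weights. -/
lemma euler_identity {w : σ → ℤ} {P : MvPolynomial σ A} {n : ℤ}
    (hP : IsWeightedHomogeneous w P n) :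
    mkDerivation A (fun i => (w i : MvPolynomial σ A) * X i) P = n • P := by
  classical
  rw [P.as_sum, map_sum, Finset.smul_sum]
  refine Finset.sum_congr rfl fun s hs => ?_
  have hs' : Finsupp.weight w s = n := hP (mem_support_iff.mp hs)
  rw [mkDerivation_monomial, ← hs', Finsupp.weight_apply]
  simp only [Finsupp.sum, Finset.sum_smul, Finset.smul_sum]
  refine Finset.sum_congr rfl fun i hi => ?_
  have h2 : s - Finsupp.single i 1 + Finsupp.single i 1 = s := by
    refine tsub_add_cancel_of_le ?_
    rw [Finsupp.single_le_iff]
    exact Nat.one_le_iff_ne_zero.mpr (Finsupp.mem_support_iff.mp hi)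
  have h3 : (monomial (s - Finsupp.single i 1) ((s i : ℕ) : A)) * X i = (s i) • monomial s 1 := by
    rw [X, monomial_mul, h2, mul_one, ← map_nsmul, nsmul_one]
  simp only [smul_eq_mul]
  rw [mul_left_comm, h3]
  have h4 : monomial s (coeff s P) = coeff s P • (monomial s 1 : MvPolynomial σ A) := by
    rw [smul_monomial, smul_eq_mul, mul_one]
  rw [h4]
  simp only [nsmul_eq_mul, zsmul_eq_mul, smul_eq_C_mul]
  push_cast
  ring

lemma weight_ge_neg_totalDegree {w : σ → ℤ} (hw : ∀ i, -1 ≤ w i) {P : MvPolynomial σ A}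
    {n : ℤ} (hP : IsWeightedHomogeneous w P n) (h0 : P ≠ 0) : -(P.totalDegree : ℤ) ≤ n := by
  obtain ⟨s, hs⟩ := ne_zero_iff.mp h0
  have h1 : Finsupp.weight w s = n := hP hs
  have h2 := le_totalDegree (mem_support_iff.mpr hs)
  rw [← h1, Finsupp.weight_apply, Finsupp.sum]
  have h3 : -((s.sum fun _ e => e : ℕ) : ℤ) ≤ ∑ i ∈ s.support, s i • w i := by
    rw [Finsupp.sum, Nat.cast_sum, ← Finset.sum_neg_distrib]
    refine Finset.sum_le_sum fun i _ => ?_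
    rw [nsmul_eq_mul]
    have := hw i
    have h5 : (0 : ℤ) ≤ s i := Int.natCast_nonneg _
    nlinarith
  have h4 : ((s.sum fun _ e => e : ℕ) : ℤ) ≤ P.totalDegree := by exact_mod_cast h2
  linarith

end General

section Sl2Rep

variable {A ι : Type*} [CommRing A]

lemma raise_shift {P : MvPolynomial (ι × Bool) A} {n : ℤ} (hP : IsWeightedHomogeneous xwt P n) :
    IsWeightedHomogeneous xwt (raise A ι P) (n + 2) := by
  refine IsWeightedHomogeneous.mkDerivation (fun i => ?_) hP
  rcases i with ⟨m, _ | _⟩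
  · simpa using isWeightedHomogeneous_X A xwt (m, true)
  · simpa using isWeightedHomogeneous_zero A xwt _

lemma lower_shift {P : MvPolynomial (ι × Bool) A} {n : ℤ} (hP : IsWeightedHomogeneous xwt P n) :
    IsWeightedHomogeneous xwt (lower A ι P) (n + -2) := by
  refine IsWeightedHomogeneous.mkDerivation (fun i => ?_) hP
  rcases i with ⟨m, _ | _⟩
  · simpa using isWeightedHomogeneous_zero A xwt _
  · simpa using isWeightedHomogeneous_X A xwt (m, false)

lemma raise_lower {P : MvPolynomial (ι × Bool) A} {n : ℤ} (hP : IsWeightedHomogeneous xwt P n) :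
    raise A ι (lower A ι P) = lower A ι (raise A ι P) + n • P := by
  have h : ⁅raise A ι, lower A ι⁆ =
      mkDerivation A (fun i => (xwt i : MvPolynomial (ι × Bool) A) * X i) := by
    refine derivation_ext fun i => ?_
    rcases i with ⟨m, _ | _⟩ <;> simp [Derivation.commutator_apply, mkDerivation_X]
  have h2 := congrArg (fun D => D P) h
  simp only [Derivation.commutator_apply] at h2
  rw [euler_identity hP] at h2
  rw [← h2]
  ring

/-- A highest weight vector of negative weight and small degree vanishes. -/
lemma eq_zero_of_raise_eq_zero [IsDomain A] {p : ℕ} [CharP A p]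
    {P : MvPolynomial (ι × Bool) A} {n : ℤ} (hP : IsWeightedHomogeneous xwt P n) (hn : n < 0)
    (hdeg : 2 * P.totalDegree < p) (he : raise A ι P = 0) : P = 0 := by
  have hhom : ∀ k : ℕ, IsWeightedHomogeneous xwt ((lower A ι)^[k] P) (n - 2 * k) := by
    intro k
    induction k with
    | zero => simpa using hP
    | succ k ih =>
      rw [Function.iterate_succ_apply']
      convert lower_shift ih using 1
      push_cast
      ring
  have hcomm : ∀ k : ℕ, raise A ι ((lower A ι)^[k + 1] P) =
      (((k : ℤ) + 1) * (n - k)) • (lower A ι)^[k] P := by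
    intro k
    induction k with
    | zero => simpa [he] using raise_lower hP
    | succ k ih =>
      rw [Function.iterate_succ_apply', raise_lower (hhom (k + 1)), ih, map_zsmul,
        ← Function.iterate_succ_apply' (lower A ι) k P, ← add_smul]
      congr 1
      push_cast
      ring
  have hD : ∀ k : ℕ, ((lower A ι)^[k] P).totalDegree ≤ P.totalDegree := by
    intro k
    induction k with
    | zero => simp
    | succ k ih =>
      rw [Function.iterate_succ_apply']
      refine (totalDegree_mkDerivation_le (fun i => ?_) _).trans ih
      split_ifs
      · exact (totalDegree_monomial_le _ _).trans (by simp)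
      · simp
  by_contra h0
  have hge : -(P.totalDegree : ℤ) ≤ n :=
    weight_ge_neg_totalDegree (fun i => by rcases i with ⟨m, _ | _⟩ <;> simp) hP h0
  have hne : ∀ k : ℕ, k ≤ P.totalDegree + 1 → (lower A ι)^[k] P ≠ 0 := by
    intro k
    induction k with
    | zero => intro _; simpa using h0
    | succ k ih =>
      intro hk h
      have h1 := hcomm k
      rw [h, map_zero, zsmul_eq_mul] at h1
      rcases mul_eq_zero.mp h1.symm with h2 | h2
      · have h3 : (((k + 1 : ℤ) * (n - k) : ℤ) : A) = 0 := by
          refine C_injective (ι × Bool) A ?_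
          rw [map_zero, ← h2, map_intCast]
        rw [Int.cast_mul, mul_eq_zero, CharP.intCast_eq_zero_iff A p,
          CharP.intCast_eq_zero_iff A p] at h3
        rcases h3 with h3 | h3
        · have := Int.le_of_dvd (by positivity) h3
          omega
        · have := Int.le_of_dvd (by omega) (dvd_neg.mpr h3)
          omega
      · exact ih (by omega) h2
  have h1 := weight_ge_neg_totalDegree
    (fun i => by rcases i with ⟨m, _ | _⟩ <;> simp) (hhom _) (hne (P.totalDegree + 1) le_rfl)
  have h2 := hD (P.totalDegree + 1)
  push_cast at h1
  omega

end Sl2Rep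

end HasseJet

namespace HasseJet

open MvPolynomial

section Jets

variable (F : Type*) [Field F] {ι σ : Type*}

/-- Weights of `Q` and `R`. -/
def wtS : Fin 2 → ℤ := ![4, 6]

/-- The derivation `Q ↦ -4R`, `R ↦ -6Q²`. -/
noncomputable def dBase : Derivation F (Base F) (Base F) :=
  mkDerivation F ![-(C 4 * X 1), -(C 6 * X 0 ^ 2)]

variable (σ) in
/-- The derivation of `F[Q, R][σ]` applying `dBase` to all coefficients. -/
noncomputable def coefDer :
    Derivation F (MvPolynomial σ (Base F)) (MvPolynomial σ (Base F)) :=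
  Derivation.mk'
    ((sumAlgEquiv F σ (Fin 2)).toLinearMap ∘ₗ
      ((mkDerivation F (Sum.elim (fun _ => 0) fun j => rename Sum.inr (dBase F (X j))) :
        Derivation F (MvPolynomial (σ ⊕ Fin 2) F) (MvPolynomial (σ ⊕ Fin 2) F)) :
        MvPolynomial (σ ⊕ Fin 2) F →ₗ[F] MvPolynomial (σ ⊕ Fin 2) F) ∘ₗ
      (sumAlgEquiv F σ (Fin 2)).symm.toLinearMap) fun a b => by
    simp [Derivation.leibniz]

variable {F}

lemma coefDer_apply (P : MvPolynomial σ (Base F)) : coefDer F σ P =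
    sumAlgEquiv F σ (Fin 2) (mkDerivation F
      (Sum.elim (fun _ => 0) fun j => rename Sum.inr (dBase F (X j)))
      ((sumAlgEquiv F σ (Fin 2)).symm P)) := rfl

@[simp] lemma coefDer_X (i : σ) : coefDer F σ (X i) = 0 := by
  rw [coefDer_apply, sumAlgEquiv_symm_X, mkDerivation_X, Sum.elim_inl, map_zero]

@[simp] lemma coefDer_C (c : Base F) : coefDer F σ (C c) = C (dBase F c) := by
  induction c using MvPolynomial.induction_on with
  | C a =>
    rw [show (C (C a) : MvPolynomial σ (Base F)) = algebraMap F _ a from rfl,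
      Derivation.map_algebraMap, derivation_C, map_zero]
  | add p q hp hq => simp only [map_add, hp, hq]
  | mul_X p j hp =>
    have hX : coefDer F σ (C (X j)) = C (dBase F (X j)) := by
      rw [coefDer_apply, sumAlgEquiv_symm_C_X, mkDerivation_X, Sum.elim_inr]
      exact AlgHom.congr_fun (sumAlgEquiv_comp_rename_inr (R := F) (S₁ := σ) (S₂ := Fin 2))
        (dBase F (X j))
    rw [C_mul, Derivation.leibniz, Derivation.leibniz, hp, hX]
    simp [smul_eq_mul]

lemma coeff_coefDer (P : MvPolynomial σ (Base F)) (s : σ →₀ ℕ) :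
    coeff s (coefDer F σ P) = dBase F (coeff s P) := by
  classical
  induction P using MvPolynomial.induction_on generalizing s with
  | C a => rw [coefDer_C, coeff_C, coeff_C]; split_ifs <;> simp
  | add p q hp hq => simp only [map_add, coeff_add, hp, hq]
  | mul_X p j hp =>
    rw [Derivation.leibniz, coefDer_X, smul_zero, zero_add, smul_eq_mul, mul_comm,
      coeff_mul_X', coeff_mul_X']
    split_ifs
    · exact hp _
    · simp

variable (F ι) in
/-- The derivation `Q ↦ -4R`, `R ↦ -6Q²`, `X_m ↦ Y_m`, `Y_m ↦ -Q X_m`. -/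
noncomputable def jetDer : Derivation F (Jet F ι) (Jet F ι) :=
  Derivation.mk'
    { toFun := fun P => coefDer F (ι × Bool) P + raise (Base F) ι P -
        C (X 0) * lower (Base F) ι P
      map_add' := fun a b => by simp only [map_add]; ring
      map_smul' := fun c a => by
        simp only [Derivation.map_smul, Derivation.map_smul_of_tower, RingHom.id_apply,
          smul_sub, smul_add, mul_smul_comm] }
    fun a b => by
      simp only [LinearMap.coe_mk, AddHom.coe_mk, Derivation.leibniz, smul_eq_mul]
      ring

lemma jetDer_apply (P : Jet F ι) : jetDer F ι P =
    coefDer F (ι × Bool) P + raise (Base F) ι P - C (X 0) * lower (Base F) ι P := rfl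

@[simp] lemma jetDer_C (c : Base F) : jetDer F ι (C c) = C (dBase F c) := by
  rw [jetDer_apply, coefDer_C, derivation_C, derivation_C]; simp

@[simp] lemma jetDer_X (m : ι) (b : Bool) : jetDer F ι (X (m, b)) =
    if b then -(C (X 0) * X (m, false)) else X (m, true) := by
  rw [jetDer_apply, coefDer_X, raise_X, lower_X]; cases b <;> simp

/-- Every monomial of `P` has total weight `W`. -/
def Iso (P : Jet F ι) (W : ℤ) : Prop :=
  ∀ s, IsWeightedHomogeneous wtS (coeff s P) (W - Finsupp.weight xwt s)

namespace Iso

variable {P P' : Jet F ι} {W W' : ℤ}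

lemma zero (W : ℤ) : Iso (0 : Jet F ι) W := fun s => by
  rw [coeff_zero]; exact isWeightedHomogeneous_zero _ _ _

lemma add (h : Iso P W) (h' : Iso P' W) : Iso (P + P') W := fun s => by
  rw [coeff_add]; exact (h s).add (h' s)

lemma neg (h : Iso P W) : Iso (-P) W := fun s => by
  rw [coeff_neg]; exact (h s).neg

lemma mul (h : Iso P W) (h' : Iso P' W') : Iso (P * P') (W + W') := fun s => by
  classical
  rw [coeff_mul]
  refine IsWeightedHomogeneous.sum _ _ _ fun x hx => ?_
  convert (h x.1).mul (h' x.2) using 1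
  rw [← Finset.HasAntidiagonal.mem_antidiagonal.mp hx, map_add]
  ring

lemma sum {κ : Type*} (t : Finset κ) (f : κ → Jet F ι) (h : ∀ i ∈ t, Iso (f i) W) :
    Iso (∑ i ∈ t, f i) W := fun s => by
  rw [coeff_sum]; exact IsWeightedHomogeneous.sum _ _ _ fun i hi => h i hi s

lemma C_base {c : Base F} (h : IsWeightedHomogeneous wtS c W) : Iso (C c : Jet F ι) W := fun s => by
  classical
  rw [coeff_C]
  split_ifs with hs
  · subst hs; simpa using h
  · exact isWeightedHomogeneous_zero _ _ _

lemma X_var (i : ι × Bool) : Iso (X i : Jet F ι) (xwt i) := fun s => by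
  classical
  rw [coeff_X]
  split_ifs with hs
  · subst hs
    simpa [Finsupp.weight_single] using isWeightedHomogeneous_one F wtS
  · exact isWeightedHomogeneous_zero _ _ _

lemma one : Iso (1 : Jet F ι) 0 := by
  rw [← map_one C]; exact C_base (isWeightedHomogeneous_one F wtS)

lemma pow (h : Iso P W) (n : ℕ) : Iso (P ^ n) (n * W) := by
  induction n with
  | zero => simpa using one
  | succ n ih => rw [pow_succ]; convert ih.mul h using 1; push_cast; ring

lemma prod {κ : Type*} (t : Finset κ) (f : κ → Jet F ι) (w : κ → ℤ) (h : ∀ i ∈ t, Iso (f i) (w i)) :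
    Iso (∏ i ∈ t, f i) (∑ i ∈ t, w i) := by
  classical
  induction t using Finset.induction_on with
  | empty => simpa using one
  | insert a t ha ih =>
    rw [Finset.prod_insert ha, Finset.sum_insert ha]
    exact (h a (Finset.mem_insert_self _ _)).mul
      (ih fun i hi => h i (Finset.mem_insert_of_mem hi))

lemma rename {κ : Type*} (f : ι → κ) (hf : Function.Injective f) (h : Iso P W) :
    Iso (MvPolynomial.rename (Prod.map f id) P : Jet F κ) W := fun s => by
  classical
  have hf' : Function.Injective (Prod.map f (id : Bool → Bool)) :=
    hf.prodMap Function.injective_id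
  by_cases hs : ∃ u : ι × Bool →₀ ℕ, u.mapDomain (Prod.map f id) = s
  · obtain ⟨u, rfl⟩ := hs
    rw [coeff_rename_mapDomain _ hf']
    convert h u using 2
    rw [Finsupp.weight_apply, Finsupp.weight_apply, Finsupp.sum_mapDomain_index_inj hf']
    rfl
  · rw [coeff_rename_eq_zero _ _ _ fun u hu => absurd ⟨u, hu⟩ hs]
    exact isWeightedHomogeneous_zero _ _ _

/-- Induction over isobaric elements. -/
lemma induct {Pr : Jet F ι → ℤ → Prop} (hP : Iso P W) (hzero : ∀ W, Pr 0 W)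
    (hadd : ∀ P P' W, Pr P W → Pr P' W → Pr (P + P') W)
    (hmul : ∀ P P' W W', Pr P W → Pr P' W' → Pr (P * P') (W + W'))
    (hconst : ∀ a, Pr (C (C a)) 0) (hS : ∀ j, Pr (C (X j)) (wtS j))
    (hX : ∀ i, Pr (X i) (xwt i)) : Pr P W := by
  classical
  have hpow : ∀ P W (n : ℕ), Pr P W → Pr (P ^ n) (n * W) := by
    intro P W n h
    induction n with
    | zero => simpa using hconst 1
    | succ n ih =>
      rw [pow_succ]
      convert hmul _ _ _ _ ih h using 1
      push_cast; ring
  have hq1 : ∀ q : Fin 2 →₀ ℕ, Pr (C (monomial q 1)) (Finsupp.weight wtS q) := by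
    intro q
    induction q using Finsupp.induction_linear with
    | zero => simpa using hconst 1
    | add f g hf hg =>
      have : (monomial (f + g) 1 : Base F) = monomial f 1 * monomial g 1 := by
        rw [monomial_mul, mul_one]
      rw [this, C_mul, map_add]
      exact hmul _ _ _ _ hf hg
    | single j n =>
      rw [← X_pow_eq_monomial, C_pow, Finsupp.weight_single, nsmul_eq_mul]
      exact hpow _ _ _ (hS j)
  have hs1 : ∀ s : ι × Bool →₀ ℕ, Pr (monomial s 1) (Finsupp.weight xwt s) := by
    intro s
    induction s using Finsupp.induction_linear with
    | zero => simpa using hconst 1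
    | add f g hf hg =>
      have : (monomial (f + g) 1 : Jet F ι) = monomial f 1 * monomial g 1 := by
        rw [monomial_mul, mul_one]
      rw [this, map_add]
      exact hmul _ _ _ _ hf hg
    | single j n =>
      rw [← X_pow_eq_monomial, Finsupp.weight_single, nsmul_eq_mul]
      exact hpow _ _ _ (hX j)
  have hsum : ∀ {κ : Type _} (t : Finset κ) (f : κ → Jet F ι) (W : ℤ),
      (∀ i ∈ t, Pr (f i) W) → Pr (∑ i ∈ t, f i) W := by
    intro κ t f W h
    induction t using Finset.induction_on with
    | empty => simpa using hzero W
    | insert a t ha ih =>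
      rw [Finset.sum_insert ha]
      exact hadd _ _ _ (h a (Finset.mem_insert_self _ _))
        (ih fun i hi => h i (Finset.mem_insert_of_mem hi))
  have hsum' : ∀ {κ : Type _} (t : Finset κ) (f : κ → Jet F ι) (W : ℤ),
      (∀ i ∈ t, Pr (f i) W) → Pr (∑ i ∈ t, f i) W := by
    intro κ t f W h
    induction t using Finset.induction_on with
    | empty => simpa using hzero W
    | insert a t ha ih =>
      rw [Finset.sum_insert ha]
      exact hadd _ _ _ (h a (Finset.mem_insert_self _ _))
        (ih fun i hi => h i (Finset.mem_insert_of_mem hi))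
  rw [P.as_sum]
  refine hsum _ _ _ fun s _ => ?_
  have h1 : (monomial s (coeff s P) : Jet F ι) = C (coeff s P) * monomial s 1 := by
    rw [C_mul_monomial, mul_one]
  rw [h1, show W = (W - Finsupp.weight xwt s) + Finsupp.weight xwt s by ring]
  refine hmul _ _ _ _ ?_ (hs1 s)
  rw [(coeff s P).as_sum, map_sum]
  refine hsum' _ _ _ fun q hq => ?_
  have h2 : (C (monomial q (coeff q (coeff s P))) : Jet F ι) =
      C (C (coeff q (coeff s P))) * C (monomial q 1) := by
    rw [← C_mul, C_mul_monomial, mul_one]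
  rw [h2, ← (hP s) (mem_support_iff.mp hq), ← zero_add (Finsupp.weight wtS q)]
  exact hmul _ _ _ _ (hconst _) (hq1 q)

lemma jetDer (hP : Iso P W) : Iso (jetDer F ι P) (W + 2) := by
  have : Iso P W ∧ Iso (HasseJet.jetDer F ι P) (W + 2) := by
    refine hP.induct (Pr := fun P W => Iso P W ∧ Iso (HasseJet.jetDer F ι P) (W + 2)) ?_ ?_ ?_ ?_ ?_ ?_
    · intro W; rw [map_zero]; exact ⟨zero _, zero _⟩
    · rintro P P' W ⟨h1, h2⟩ ⟨h3, h4⟩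
      rw [map_add]; exact ⟨h1.add h3, h2.add h4⟩
    · rintro P P' W W' ⟨h1, h2⟩ ⟨h3, h4⟩
      refine ⟨h1.mul h3, ?_⟩
      rw [Derivation.leibniz, smul_eq_mul, smul_eq_mul]
      refine Iso.add ?_ ?_
      · convert h1.mul h4 using 1; ring
      · convert h3.mul h2 using 1; ring
    · intro a
      refine ⟨C_base (isWeightedHomogeneous_C _ _), ?_⟩
      rw [jetDer_C, derivation_C, map_zero]; exact zero _
    · intro j
      refine ⟨C_base (isWeightedHomogeneous_X F wtS j), ?_⟩
      rw [jetDer_C]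
      refine C_base ?_
      fin_cases j
      · simpa [dBase, mkDerivation_X, wtS] using
          ((isWeightedHomogeneous_X F wtS 1).C_mul 4).neg
      · simpa [dBase, mkDerivation_X, wtS] using
          (((isWeightedHomogeneous_X F wtS 0).pow 2).C_mul 6).neg
    · rintro ⟨m, _ | _⟩
      · refine ⟨X_var _, ?_⟩
        simpa using X_var (F := F) (m, true)
      · refine ⟨X_var _, ?_⟩
        simpa [wtS] using
          ((C_base (isWeightedHomogeneous_X F wtS 0)).mul (X_var (F := F) (m, false))).neg
  exact this.2

end Iso

end Jets

end HasseJet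

namespace HasseJet

open MvPolynomial

section Determinants

lemma derivation_prod {K B κ : Type*} [CommRing K] [CommRing B] [Algebra K B] [DecidableEq κ]
    (D : Derivation K B B) (t : Finset κ) (f : κ → B) :
    D (∏ i ∈ t, f i) = ∑ j ∈ t, ∏ i ∈ t, if i = j then D (f i) else f i := by
  induction t using Finset.induction_on with
  | empty => simp
  | insert a t ha ih =>
    rw [Finset.prod_insert ha, D.leibniz, ih, Finset.sum_insert ha, smul_eq_mul, smul_eq_mul,
      Finset.prod_insert ha, if_pos rfl, add_comm, mul_comm (∏ i ∈ t, f i), Finset.mul_sum]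
    congr 1
    · congr 1
      refine Finset.prod_congr rfl fun i hi => ?_
      rw [if_neg (by rintro rfl; exact ha hi)]
    · refine Finset.sum_congr rfl fun j hj => ?_
      rw [Finset.prod_insert ha, if_neg (by rintro rfl; exact ha hj)]

/-- The derivative of a determinant, row by row. -/
lemma derivation_det {K B : Type*} [CommRing K] [CommRing B] [Algebra K B]
    (D : Derivation K B B) {r : ℕ} (M : Matrix (Fin r) (Fin r) B) :
    D M.det = ∑ n, (M.updateRow n fun m => D (M n m)).det := by
  rw [← Matrix.det_transpose]
  simp only [← Matrix.det_transpose (M.updateRow _ _)]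
  simp only [Matrix.det_apply, map_sum]
  rw [Finset.sum_comm]
  refine Finset.sum_congr rfl fun σ _ => ?_
  have hs : ∀ b : B, D (Equiv.Perm.sign σ • b) = Equiv.Perm.sign σ • D b := by
    intro b
    rcases Int.units_eq_one_or (Equiv.Perm.sign σ) with h | h <;> simp [h]
  rw [hs, derivation_prod, Finset.smul_sum]
  refine Finset.sum_congr rfl fun n _ => ?_
  congr 1
  refine Finset.prod_congr rfl fun i _ => ?_
  simp only [Matrix.transpose_apply, Matrix.updateRow_apply]
  split_ifs with h
  · subst h; rfl
  · rfl

lemma exists_det_ne_zero {S κ : Type*} [CommRing S] [IsDomain S] :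
    ∀ (r : ℕ) (v : Fin r → κ → S), LinearIndependent S v →
      ∃ x : Fin r → κ, (Matrix.of fun m n => v n (x m)).det ≠ 0 := by
  intro r
  induction r with
  | zero => intro v _; exact ⟨Fin.elim0, by simp⟩
  | succ r ih =>
    intro v hv
    obtain ⟨x, hx⟩ := ih (fun n => v n.succ) (hv.comp _ (Fin.succ_injective r))
    by_contra! hcon
    let c : Fin (r + 1) → S := fun j =>
      (-1) ^ (j : ℕ) * (Matrix.of fun m n => v (j.succAbove n) (x m)).det
    have hrel : ∑ j, c j • v j = 0 := by
      funext y
      have h := hcon (Fin.cons y x : Fin (r + 1) → κ)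
      rw [Matrix.det_succ_row_zero] at h
      rw [Pi.zero_apply, ← h, Finset.sum_apply]
      refine Finset.sum_congr rfl fun j _ => ?_
      have : (Matrix.of fun m n => v n ((Fin.cons y x : Fin (r + 1) → κ) m)).submatrix
          Fin.succ j.succAbove = Matrix.of fun m n => v (j.succAbove n) (x m) := by
        ext a b; simp
      rw [this]
      simp only [c, Pi.smul_apply, smul_eq_mul, Matrix.of_apply, Fin.cons_zero]
      ring
    have h0 := Fintype.linearIndependent_iff.mp hv c hrel 0
    apply hx
    simpa [c] using h0

end Determinants

section Wronskian

variable {F : Type*} [Field F]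

/-- The copy of a two-variable polynomial in the column `m`. -/
noncomputable def col {ι : Type*} (m : ι) : Jet F Unit →ₐ[Base F] Jet F ι :=
  rename (Prod.map (fun _ => m) id)

lemma col_jetDer {ι : Type*} (m : ι) (P : Jet F Unit) :
    col m (jetDer F Unit P) = jetDer F ι (col m P) := by
  induction P using MvPolynomial.induction_on with
  | C a => simp [col]
  | add p q hp hq => simp only [map_add, hp, hq]
  | mul_X p i hp =>
    have hX : col m (jetDer F Unit (X i)) = jetDer F ι (col m (X i)) := by
      rcases i with ⟨u, _ | _⟩ <;> simp [col]
    rw [Derivation.leibniz, map_mul, Derivation.leibniz, map_add, smul_eq_mul, smul_eq_mul,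
      map_mul, map_mul, hp, hX, smul_eq_mul, smul_eq_mul]

/-- The determinant attached to `r` successive derivatives in `r` columns. -/
noncomputable def wronskian (L : Jet F Unit) (r : ℕ) : Jet F (Fin r) :=
  (Matrix.of fun n m : Fin r => col m ((jetDer F Unit)^[n] L)).det

lemma wronskian_ne_zero (L : Jet F Unit) (r : ℕ)
    (h : LinearIndependent (Base F) fun n : Fin r => (jetDer F Unit)^[n] L) :
    wronskian L r ≠ 0 := by
  let ev : Jet F Unit →ₗ[Base F] ((Unit × Bool → Base F) → Base F) :=
    { toFun := fun P x => eval x P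
      map_add' := fun a b => by funext x; simp
      map_smul' := fun a b => by funext x; simp [smul_eval] }
  have hev : LinearMap.ker ev = ⊥ := by
    rw [LinearMap.ker_eq_bot]
    intro P P' hPP
    exact MvPolynomial.funext fun x => congrFun hPP x
  obtain ⟨x, hx⟩ := exists_det_ne_zero r _ (h.map' ev hev)
  intro h0
  apply hx
  have h1 := congrArg (eval fun i : Fin r × Bool => x i.1 ((), i.2)) h0
  rw [wronskian, RingHom.map_det, map_zero] at h1
  rw [← Matrix.det_transpose, ← h1]
  congr 1
  ext n m
  simp only [Matrix.transpose_apply, Matrix.of_apply, RingHom.mapMatrix_apply, Matrix.map_apply,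
    col, eval_rename, Function.comp_apply]
  rfl

lemma Iso.iterate {P : Jet F Unit} {W : ℤ} (hP : Iso P W) (n : ℕ) :
    Iso ((HasseJet.jetDer F Unit)^[n] P) (W + 2 * n) := by
  induction n with
  | zero => simpa using hP
  | succ n ih =>
    rw [Function.iterate_succ_apply']
    convert ih.jetDer using 1
    push_cast; ring

lemma Iso.col {ι : Type*} {P : Jet F Unit} {W : ℤ} (hP : Iso P W) (m : ι) :
    Iso (HasseJet.col m P) W :=
  hP.rename _ (Function.injective_of_subsingleton _)

lemma Iso.wronskian {L : Jet F Unit} {w : ℤ} (hL : Iso L w) (r : ℕ) :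
    Iso (wronskian L r) (r * w + r * (r - 1)) := by
  have hsum : ∑ n : Fin r, (w + 2 * (n : ℤ)) = r * w + r * (r - 1) := by
    rw [Fin.sum_univ_eq_sum_range (fun n => w + 2 * (n : ℤ)) r]
    clear hL
    induction r with
    | zero => simp
    | succ r ih => rw [Finset.sum_range_succ, ih]; push_cast; ring
  rw [HasseJet.wronskian, ← Matrix.det_transpose, Matrix.det_apply, ← hsum]
  refine Iso.sum _ _ fun σ _ => ?_
  have h1 : Iso (∏ m : Fin r, (HasseJet.col (σ.symm (σ m)) ((HasseJet.jetDer F Unit)^[m] L)))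
      (∑ n : Fin r, (w + 2 * (n : ℤ))) :=
    Iso.prod _ _ _ fun n _ => (hL.iterate n).col _
  have h2 : Iso (∏ m : Fin r, (HasseJet.col (σ m) ((HasseJet.jetDer F Unit)^[m] L)))
      (∑ n : Fin r, (w + 2 * (n : ℤ))) :=
    Iso.prod _ _ _ fun n _ => (hL.iterate n).col _
  rcases Int.units_eq_one_or (Equiv.Perm.sign σ) with h | h
  · simpa [h] using h2
  · simpa [h] using h2.neg

lemma totalDegree_jetDer_le {ι : Type*} (P : Jet F ι) :
    (jetDer F ι P).totalDegree ≤ P.totalDegree := by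
  rw [jetDer_apply]
  refine (totalDegree_sub _ _).trans (max_le ((totalDegree_add _ _).trans (max_le ?_ ?_)) ?_)
  · refine totalDegree_le_of_support_subset fun s hs => ?_
    rw [mem_support_iff, coeff_coefDer] at hs
    rw [mem_support_iff]
    exact fun h => hs (by rw [h, map_zero])
  · refine totalDegree_mkDerivation_le (fun i => ?_) _
    split_ifs
    · simp
    · exact (totalDegree_monomial_le _ _).trans (by simp)
  · rw [← smul_eq_C_mul]
    refine (totalDegree_smul_le _ _).trans (totalDegree_mkDerivation_le (fun i => ?_) _)
    split_ifs
    · exact (totalDegree_monomial_le _ _).trans (by simp)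
    · simp

lemma totalDegree_iterate_le {ι : Type*} (P : Jet F ι) (n : ℕ) :
    ((jetDer F ι)^[n] P).totalDegree ≤ P.totalDegree := by
  induction n with
  | zero => simp
  | succ n ih =>
    rw [Function.iterate_succ_apply']
    exact (totalDegree_jetDer_le _).trans ih

lemma totalDegree_wronskian_le (L : Jet F Unit) (r : ℕ) :
    (wronskian L r).totalDegree ≤ r * L.totalDegree := by
  rw [HasseJet.wronskian, Matrix.det_apply]
  refine totalDegree_finsetSum_le fun σ _ => ?_
  have h2 : (∏ m : Fin r, (col m ((jetDer F Unit)^[σ m] L) : Jet F (Fin r))).totalDegree ≤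
      r * L.totalDegree := by
    refine (totalDegree_finsetProd _ _).trans ?_
    calc _ ≤ ∑ m : Fin r, L.totalDegree := Finset.sum_le_sum fun m _ =>
          (totalDegree_rename_le _ _).trans (totalDegree_iterate_le _ _)
      _ = _ := by simp
  rcases Int.units_eq_one_or (Equiv.Perm.sign σ) with h | h
  · simpa [h] using h2
  · simpa [h, totalDegree_neg] using h2

/-- A linear relation among the first `r + 1` derivatives gives a differential equation
for the determinant. -/
lemma jetDer_wronskian (L : Jet F Unit) (r : ℕ) (c : Fin (r + 1) → Base F) (d : Base F)
    (h : d • (jetDer F Unit)^[r + 1] L = ∑ n : Fin (r + 1), c n • (jetDer F Unit)^[n] L) :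
    C d * jetDer F _ (wronskian L (r + 1)) = C (c (Fin.last r)) * wronskian L (r + 1) := by
  set M : Matrix (Fin (r + 1)) (Fin (r + 1)) (Jet F (Fin (r + 1))) :=
    Matrix.of fun n m => col m ((jetDer F Unit)^[n] L) with hM
  have hrow : ∀ n : Fin (r + 1), (fun m => jetDer F _ (M n m)) =
      fun m => col m ((jetDer F Unit)^[(n : ℕ) + 1] L) := by
    intro n
    funext m
    rw [hM, Matrix.of_apply, ← col_jetDer, Function.iterate_succ_apply']
  rw [show wronskian L (r + 1) = M.det from rfl, derivation_det, Fin.sum_univ_castSucc]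
  rw [Finset.sum_eq_zero, zero_add]
  · rw [hrow, ← Matrix.det_updateRow_smul]
    have : ((C d : Jet F (Fin (r + 1))) • fun m : Fin (r + 1) => col m ((jetDer F Unit)^[((Fin.last r : Fin (r + 1)) : ℕ) + 1] L)) =
        ∑ n, (C (c n) : Jet F (Fin (r + 1))) • M n := by
      funext m
      rw [Finset.sum_apply, Pi.smul_apply, smul_eq_mul, Fin.val_last, ← smul_eq_C_mul, ← map_smul,
        h, map_sum]
      refine Finset.sum_congr rfl fun n _ => ?_
      rw [Pi.smul_apply, smul_eq_mul, ← smul_eq_C_mul, map_smul]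
      rfl
    rw [this, Matrix.det_updateRow_sum, smul_eq_mul]
  · intro n _
    rw [hrow]
    refine Matrix.det_zero_of_row_eq (i := n.castSucc) (j := n.succ) ?_ ?_
    · exact (Fin.castSucc_lt_succ).ne
    · rw [Matrix.updateRow_self, Matrix.updateRow_ne (Fin.castSucc_lt_succ).ne']
      funext m
      simp [hM]

end Wronskian

end HasseJet

namespace HasseJet

open MvPolynomial

section Homogeneous

lemma isWeightedHomogeneous_of_mul {K σ : Type*} [CommRing K] [IsDomain K] (w : σ → ℕ)
    {f g : MvPolynomial σ K} {N : ℕ}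
    (h : IsWeightedHomogeneous w (f * g) N) (h0 : f * g ≠ 0) :
    ∃ k, IsWeightedHomogeneous w f k := by
  classical
  let γ : MvPolynomial σ K →+* Polynomial (MvPolynomial σ K) :=
    eval₂Hom (Polynomial.C.comp C) fun i => Polynomial.C (X i) * Polynomial.X ^ w i
  have hmon : ∀ s a, γ (monomial s a) =
      Polynomial.C (monomial s a) * Polynomial.X ^ (Finsupp.weight w s) := by
    intro s a
    rw [coe_eval₂Hom, eval₂_monomial]
    simp only [mul_pow, Finsupp.prod_mul]
    have h1 : (s.prod fun i n => (Polynomial.X ^ w i : Polynomial (MvPolynomial σ K)) ^ n) =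
        Polynomial.X ^ (Finsupp.weight w s) := by
      rw [Finsupp.weight_apply, Finsupp.prod, Finsupp.sum, ← Finset.prod_pow_eq_pow_sum]
      refine Finset.prod_congr rfl fun i _ => ?_
      rw [← pow_mul, smul_eq_mul, mul_comm]
    have h2 : (monomial s a : MvPolynomial σ K) = C a * s.prod fun i n => X i ^ n := monomial_eq
    rw [h1, ← mul_assoc, h2, Polynomial.C_mul]
    congr 2
    simp only [Finsupp.prod, map_prod, map_pow]
  have hcoeff : ∀ (P : MvPolynomial σ K) (s : σ →₀ ℕ),
      coeff s ((γ P).coeff (Finsupp.weight w s)) = coeff s P := by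
    intro P s
    conv_lhs => rw [P.as_sum]
    conv_rhs => rw [P.as_sum]
    simp only [map_sum, Polynomial.finsetSum_coeff, coeff_sum]
    refine Finset.sum_congr rfl fun u _ => ?_
    rw [hmon, Polynomial.coeff_C_mul_X_pow]
    split_ifs with hu
    · rfl
    · rw [coeff_zero, coeff_monomial, if_neg]
      rintro rfl
      exact hu rfl
  have hinj : ∀ P, P ≠ 0 → γ P ≠ 0 := by
    intro P hP hz
    obtain ⟨s, hs⟩ := ne_zero_iff.mp hP
    apply hs
    rw [← hcoeff, hz]
    simp
  have hfg : γ (f * g) = Polynomial.C (f * g) * Polynomial.X ^ N := by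
    have h1 : ∀ s ∈ (f * g).support, Finsupp.weight w s = N :=
      fun s hs => h (mem_support_iff.mp hs)
    conv_lhs => rw [(f * g).as_sum]
    conv_rhs => rw [(f * g).as_sum]
    rw [map_sum, map_sum, Finset.sum_mul]
    refine Finset.sum_congr rfl fun s hs => ?_
    rw [hmon, h1 s hs]
  have hf0 := hinj f (left_ne_zero_of_mul h0)
  have hg0 := hinj g (right_ne_zero_of_mul h0)
  have hd := congrArg Polynomial.natDegree hfg
  have ht := congrArg Polynomial.natTrailingDegree hfg
  rw [map_mul, Polynomial.natDegree_mul hf0 hg0, Polynomial.natDegree_C_mul_X_pow _ _ h0] at hd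
  rw [map_mul, Polynomial.natTrailingDegree_mul hf0 hg0, Polynomial.C_mul_X_pow_eq_monomial,
    Polynomial.natTrailingDegree_monomial h0] at ht
  have hf1 := Polynomial.natTrailingDegree_le_natDegree (γ f)
  have hg1 := Polynomial.natTrailingDegree_le_natDegree (γ g)
  refine ⟨(γ f).natDegree, fun s hs => ?_⟩
  have hne : (γ f).coeff (Finsupp.weight w s) ≠ 0 := by
    intro hz
    apply hs
    rw [← hcoeff, hz, coeff_zero]
  have h1 := Polynomial.le_natDegree_of_ne_zero hne
  have h2 := Polynomial.natTrailingDegree_le_of_ne_zero hne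
  omega

variable {F : Type*} [Field F]

lemma weight_wtS (s : Fin 2 →₀ ℕ) :
    Finsupp.weight wtS s = ((Finsupp.weight ![4, 6] s : ℕ) : ℤ) := by
  simp [Finsupp.weight_apply, Finsupp.sum_fintype, wtS, Fin.sum_univ_two]

lemma weight_wtS' (s : Fin 2 →₀ ℕ) : Finsupp.weight wtS s = 4 * s 0 + 6 * s 1 := by
  simp [Finsupp.weight_apply, Finsupp.sum_fintype, wtS, Fin.sum_univ_two]
  ring

lemma base_homogeneous_of_mul {f g : Base F} {W : ℤ} (h : IsWeightedHomogeneous wtS (f * g) W)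
    (h0 : f * g ≠ 0) :
    ∃ k, IsWeightedHomogeneous wtS f k ∧ IsWeightedHomogeneous wtS g (W - k) := by
  obtain ⟨s, hs⟩ := ne_zero_iff.mp h0
  have hN : ∃ N : ℕ, W = N := ⟨_, by rw [← h hs, weight_wtS]⟩
  obtain ⟨N, rfl⟩ := hN
  have key : ∀ {f : Base F} {k : ℕ}, IsWeightedHomogeneous wtS f k ↔
      IsWeightedHomogeneous ![4, 6] f k := by
    intro f k
    constructor
    · intro hf s hs
      have := hf hs
      rw [weight_wtS] at this
      exact_mod_cast this
    · intro hf s hs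
      rw [weight_wtS, hf hs]
  obtain ⟨k, hk⟩ := isWeightedHomogeneous_of_mul _ (key.mp h) h0
  obtain ⟨l, hl⟩ := isWeightedHomogeneous_of_mul (f := g) (g := f) ![4, 6]
    (by rw [mul_comm]; exact key.mp h) (by rwa [mul_comm])
  have h1 := (hk.mul hl).inj_right h0 (key.mp h)
  refine ⟨k, key.mpr hk, ?_⟩
  rw [← h1]
  push_cast
  rw [add_sub_cancel_left]
  exact key.mpr hl

/-- The discriminant `Q³ - R²` divides isobaric polynomials vanishing at the cusp `(1, 1)`. -/
lemma disc_dvd_of_eval_eq_zero {c : Base F} {W : ℤ} (h : IsWeightedHomogeneous wtS c W)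
    (h0 : eval (fun _ => (1 : F)) c = 0) : (X 0 ^ 3 - X 1 ^ 2 : Base F) ∣ c := by
  classical
  by_cases hc : c = 0
  · rw [hc]; exact dvd_zero _
  obtain ⟨u, hu⟩ := ne_zero_iff.mp hc
  have hsum : c - C (eval (fun _ => (1 : F)) c) * monomial u 1 =
      ∑ s ∈ c.support, C (coeff s c) * (monomial s 1 - monomial u 1) := by
    simp only [mul_sub, Finset.sum_sub_distrib, C_mul_monomial, mul_one]
    rw [← c.as_sum, ← map_sum]
    congr 3
    rw [eval_eq']
    simp
  rw [h0, C_0, zero_mul, sub_zero] at hsum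
  rw [hsum]
  have hmono : ∀ s : Fin 2 →₀ ℕ, (monomial s 1 : Base F) = X 0 ^ s 0 * X 1 ^ s 1 := by
    intro s
    rw [monomial_eq, C_1, one_mul, Finsupp.prod_fintype _ _ (by simp), Fin.prod_univ_two]
  have main : ∀ a b j : ℕ, (X 0 ^ 3 - X 1 ^ 2 : Base F) ∣
      X 0 ^ (a + 3 * j) * X 1 ^ b - X 0 ^ a * X 1 ^ (b + 2 * j) := by
    intro a b j
    have h1 : (X 0 ^ (a + 3 * j) * X 1 ^ b - X 0 ^ a * X 1 ^ (b + 2 * j) : Base F) =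
        X 0 ^ a * X 1 ^ b * ((X 0 ^ 3) ^ j - (X 1 ^ 2) ^ j) := by ring
    rw [h1]
    exact (sub_dvd_pow_sub_pow _ _ j).mul_left _
  refine Finset.dvd_sum fun s hs => Dvd.dvd.mul_left ?_ _
  have e1 := h (mem_support_iff.mp hs)
  have e2 := h hu
  rw [weight_wtS'] at e1 e2
  rw [hmono, hmono]
  rcases le_total (u 0) (s 0) with hle | hle
  · obtain ⟨j, hj⟩ : ∃ j, s 0 = u 0 + 3 * j := ⟨(s 0 - u 0) / 3, by omega⟩
    have hj' : u 1 = s 1 + 2 * j := by omega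
    rw [hj, hj']
    exact main _ _ _
  · obtain ⟨j, hj⟩ : ∃ j, u 0 = s 0 + 3 * j := ⟨(u 0 - s 0) / 3, by omega⟩
    have hj' : s 1 = u 1 + 2 * j := by omega
    rw [hj, hj', dvd_sub_comm]
    exact main _ _ _

end Homogeneous

section Primitive

variable {F : Type*} [Field F] {ι : Type*}

/-- Every nonzero element is a base element times one without prime factors in the base. -/
lemma exists_primitive_part (ω : Jet F ι) (h : ω ≠ 0) :
    ∃ (g : Base F) (ω' : Jet F ι), ω = C g * ω' ∧
      ∀ π : Base F, Prime π → ¬ C π ∣ ω' := by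
  induction ω using WellFounded.induction
    (IsWellFounded.wf (r := DvdNotUnit (α := Jet F ι))) with
  | _ ω ih =>
    by_cases hp : ∃ π : Base F, Prime π ∧ C π ∣ ω
    · obtain ⟨π, hπ, ω₁, rfl⟩ := hp
      have h1 : ω₁ ≠ 0 := right_ne_zero_of_mul h
      have hπ' : Prime (C π : Jet F ι) := prime_C_iff _ |>.mpr hπ
      obtain ⟨g, ω', hg, hω'⟩ := ih ω₁ ⟨h1, C π, hπ'.not_isUnit, mul_comm _ _⟩ h1
      refine ⟨π * g, ω', ?_, hω'⟩
      rw [C_mul, mul_assoc, ← hg]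
    · push Not at hp
      exact ⟨1, ω, by simp, hp⟩

lemma exists_quotient {ω' D : Jet F ι} (hω' : ∀ π : Base F, Prime π → ¬ C π ∣ ω')
    (d : Base F) (hd : d ≠ 0) (n : Base F) (h : C d * D = C n * ω') :
    ∃ τ : Base F, D = C τ * ω' := by
  induction d using UniqueFactorizationMonoid.induction_on_prime generalizing n with
  | h₁ => exact absurd rfl hd
  | h₂ x hx =>
    obtain ⟨u, rfl⟩ := hx
    refine ⟨(↑u⁻¹ : Base F) * n, ?_⟩
    rw [C_mul, mul_assoc, ← h, ← mul_assoc, ← C_mul, Units.inv_mul, C_1, one_mul]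
  | h₃ a π ha hπ ih =>
    have hπ' : Prime (C π : Jet F ι) := prime_C_iff _ |>.mpr hπ
    have h1 : (C π : Jet F ι) ∣ C n * ω' := ⟨C a * D, by rw [← h, C_mul, mul_assoc]⟩
    have h2 := (hπ'.dvd_or_dvd h1).resolve_right (hω' π hπ)
    have h3 : π ∣ n := by
      rw [C_dvd_iff_dvd_coeff] at h2
      simpa using h2 0
    obtain ⟨m, rfl⟩ := h3
    refine ih ha m ?_
    refine mul_left_cancel₀ hπ'.ne_zero ?_
    rw [← mul_assoc, ← C_mul, h, C_mul, mul_assoc]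

end Primitive

end HasseJet

namespace HasseJet

open MvPolynomial

variable {F : Type*} [Field F] {ι : Type*}

lemma eq_zero_of_component_eq_zero {A σ M : Type*} [CommRing A] [AddCommMonoid M] {w : σ → M}
    {P : MvPolynomial σ A} (h : ∀ n, weightedHomogeneousComponent w n P = 0) : P = 0 := by
  classical
  ext s
  have := congrArg (coeff s) (h (Finsupp.weight w s))
  rwa [coeff_weightedHomogeneousComponent, if_pos rfl] at this

lemma component_eq_zero_of_lt {A : Type*} [CommRing A] {P : MvPolynomial (ι × Bool) A} {n : ℤ}
    (hn : n < -P.totalDegree) : weightedHomogeneousComponent xwt n P = 0 := by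
  classical
  ext s
  rw [coeff_weightedHomogeneousComponent, coeff_zero]
  split_ifs with h
  · by_contra h0
    have h1 := weight_ge_neg_totalDegree (fun i => by rcases i with ⟨m, _ | _⟩ <;> simp)
      (weightedHomogeneousComponent_isWeightedHomogeneous n P) (w := xwt)
      (fun h2 => h0 (by rw [← coeff_zero s, ← h2, coeff_weightedHomogeneousComponent, if_pos h]))
    have h3 := totalDegree_component_le (w := xwt) P n
    omega
  · rfl

/-- The raising operator has no nonzero eigenvalue. -/
lemma eq_zero_of_raise_eq_smul {P : MvPolynomial (ι × Bool) F} {c : F} (hc : c ≠ 0)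
    (h : raise F ι P = c • P) : P = 0 := by
  refine eq_zero_of_component_eq_zero (w := xwt) fun n => ?_
  have key : ∀ (k : ℕ) (n : ℤ), n < -P.totalDegree + 2 * k →
      weightedHomogeneousComponent xwt n P = 0 := by
    intro k
    induction k with
    | zero => intro n hn; exact component_eq_zero_of_lt (by simpa using hn)
    | succ k ih =>
      intro n hn
      have h1 := component_shift (raise F ι).toLinearMap.toAddMonoidHom
        (fun P n hP => raise_shift hP) P (n - 2)
      change weightedHomogeneousComponent xwt (n - 2 + 2) (raise F ι P) =
        raise F ι (weightedHomogeneousComponent xwt (n - 2) P) at h1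
      rw [h, sub_add_cancel] at h1
      rw [ih (n - 2) (by push_cast at hn; linarith), map_zero, map_smul] at h1
      exact (smul_eq_zero.mp h1).resolve_left hc
  refine key (n + P.totalDegree + 1).toNat n ?_
  have := Int.self_le_toNat (n + P.totalDegree + 1)
  have := Int.toNat_of_nonneg (show 0 ≤ max (n + P.totalDegree + 1) 0 from le_max_right _ _)
  omega

/-- Specialization of the coefficients at the cusp `Q = R = 1`. -/
noncomputable def cusp (F ι : Type*) [Field F] : Jet F ι →+* MvPolynomial (ι × Bool) F :=
  MvPolynomial.map (eval fun _ => 1)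

/-- The derivation induced by `jetDer` at the cusp. -/
noncomputable def cuspDer (F ι : Type*) [Field F] :
    Derivation F (MvPolynomial (ι × Bool) F) (MvPolynomial (ι × Bool) F) :=
  mkDerivation F fun i => X (i.1, true) - X (i.1, false)

lemma cusp_jetDer {P : Jet F ι} {W : ℤ} (hP : Iso P W) :
    cusp F ι (jetDer F ι P) = cuspDer F ι (cusp F ι P) - (W : MvPolynomial (ι × Bool) F) * cusp F ι P := by
  refine hP.induct (Pr := fun P W => cusp F ι (jetDer F ι P) =
    cuspDer F ι (cusp F ι P) - (W : MvPolynomial (ι × Bool) F) * cusp F ι P) ?_ ?_ ?_ ?_ ?_ ?_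
  · intro W; simp
  · intro P P' W h h'
    simp only [map_add, h, h']; ring
  · intro P P' W W' h h'
    simp only [Derivation.leibniz, map_add, map_mul, smul_eq_mul, h, h']
    push_cast; ring
  · intro a
    have : jetDer F ι (C (C a)) = 0 := by
      rw [jetDer_C]; simp
    simp [this, cusp, cuspDer]
  · intro j
    rw [jetDer_C]
    fin_cases j <;> simp [cusp, cuspDer, dBase, mkDerivation_X, wtS] <;>
      exact map_ofNat C _
  · rintro ⟨m, b⟩
    rw [jetDer_X]
    cases b <;> simp [cusp, cuspDer, mkDerivation_X, xwt]

lemma eq_zero_of_cuspDer_eq_smul {P : MvPolynomial (ι × Bool) F} {c : F} (hc : c ≠ 0)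
    (h : cuspDer F ι P = c • P) : P = 0 := by
  let φ : MvPolynomial (ι × Bool) F →ₐ[F] MvPolynomial (ι × Bool) F :=
    aeval fun i => if i.2 then X (i.1, true) - X (i.1, false) else X (i.1, false)
  let ψ : MvPolynomial (ι × Bool) F →ₐ[F] MvPolynomial (ι × Bool) F :=
    aeval fun i => if i.2 then X (i.1, true) + X (i.1, false) else X (i.1, false)
  have h1 : ∀ P, φ (ψ P) = P := by
    intro P
    have : φ.comp ψ = AlgHom.id F _ := by
      ext ⟨m, b⟩
      cases b <;> simp [φ, ψ]
    exact congrArg (fun f => f P) this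
  have h2 : ∀ P, ψ (φ P) = P := by
    intro P
    have : ψ.comp φ = AlgHom.id F _ := by
      ext ⟨m, b⟩
      cases b <;> simp [φ, ψ]
    exact congrArg (fun f => f P) this
  have h3 : ∀ P, cuspDer F ι (φ P) = φ (raise F ι P) := by
    intro P
    induction P using MvPolynomial.induction_on with
    | C a => 
      have : φ (C a) = C a := by simp [φ]
      rw [this]; simp [cuspDer, raise]
    | add p q hp hq => simp only [map_add, hp, hq]
    | mul_X p i hp =>
      obtain ⟨m, b⟩ := i
      simp only [map_mul, Derivation.leibniz, map_add, smul_eq_mul, hp]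
      congr 2
      cases b <;> simp [φ, cuspDer, mkDerivation_X]
  have h4 : ψ P = 0 := by
    refine eq_zero_of_raise_eq_smul hc ?_
    rw [← h2 (raise F ι (ψ P)), ← h3, h1, h, map_smul]
  rw [← h1 P, h4, map_zero]

end HasseJet

namespace HasseJet

open MvPolynomial

variable {F : Type*} [Field F] {ι : Type*}

lemma wtS_nonneg (s : Fin 2 →₀ ℕ) : 0 ≤ Finsupp.weight wtS s := by
  rw [weight_wtS']; positivity

lemma base_eq_zero_of_neg {c : Base F} {W : ℤ} (h : IsWeightedHomogeneous wtS c W) (hW : W < 0) :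
    c = 0 := by
  by_contra h0
  obtain ⟨s, hs⟩ := ne_zero_iff.mp h0
  have := h hs
  have := wtS_nonneg s
  omega

lemma base_eq_zero_of_two {c : Base F} (h : IsWeightedHomogeneous wtS c 2) : c = 0 := by
  by_contra h0
  obtain ⟨s, hs⟩ := ne_zero_iff.mp h0
  have := h hs
  rw [weight_wtS'] at this
  omega

lemma base_eq_C_of_zero {c : Base F} (h : IsWeightedHomogeneous wtS c 0) :
    c = C (coeff 0 c) := by
  classical
  ext s
  rw [coeff_C]
  split_ifs with hs
  · rw [hs]
  · by_contra h0
    have := h h0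
    rw [weight_wtS'] at this
    apply hs
    ext i
    fin_cases i <;> simp <;> omega

lemma map_raise {A B : Type*} [CommRing A] [CommRing B] (f : A →+* B)
    (P : MvPolynomial (ι × Bool) A) :
    MvPolynomial.map f (raise A ι P) = raise B ι (MvPolynomial.map f P) := by
  induction P using MvPolynomial.induction_on with
  | C a => simp [raise]
  | add p q hp hq => simp only [map_add, hp, hq]
  | mul_X p i hp =>
    obtain ⟨m, b⟩ := i
    simp only [map_mul, Derivation.leibniz, map_add, smul_eq_mul, hp, map_X]
    cases b <;> simp

lemma map_lower {A B : Type*} [CommRing A] [CommRing B] (f : A →+* B)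
    (P : MvPolynomial (ι × Bool) A) :
    MvPolynomial.map f (lower A ι P) = lower B ι (MvPolynomial.map f P) := by
  induction P using MvPolynomial.induction_on with
  | C a => simp [lower]
  | add p q hp hq => simp only [map_add, hp, hq]
  | mul_X p i hp =>
    obtain ⟨m, b⟩ := i
    simp only [map_mul, Derivation.leibniz, map_add, smul_eq_mul, hp, map_X]
    cases b <;> simp

lemma coefDer_shift {σ : Type*} {w : σ → ℤ} {P : MvPolynomial σ (Base F)} {n : ℤ}
    (hP : IsWeightedHomogeneous w P n) : IsWeightedHomogeneous w (coefDer F σ P) (n + 0) := by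
  intro s hs
  rw [coeff_coefDer] at hs
  rw [add_zero]
  exact hP fun h => hs (by rw [h, map_zero])

lemma totalDegree_lower_le {A : Type*} [CommRing A] (P : MvPolynomial (ι × Bool) A) :
    (lower A ι P).totalDegree ≤ P.totalDegree := by
  refine totalDegree_mkDerivation_le (fun i => ?_) _
  split_ifs
  · exact (totalDegree_monomial_le _ _).trans (by simp)
  · simp

/-- A horizontal isobaric form of weight zero has constant coefficients and is invariant. -/
lemma horizontal_invariant {p : ℕ} [CharP F p] {ω : Jet F ι} (hω : Iso ω 0)
    (h : jetDer F ι ω = 0) (hdeg : 2 * ω.totalDegree < p) :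
    ω = MvPolynomial.map C (cusp F ι ω) ∧ raise F ι (cusp F ι ω) = 0 ∧
      lower F ι (cusp F ι ω) = 0 := by
  classical
  have : CharP (Base F) p := inferInstance
  set P : ℤ → Jet F ι := fun n => weightedHomogeneousComponent xwt n ω with hPdef
  have hPh : ∀ n, IsWeightedHomogeneous xwt (P n) n := fun n =>
    weightedHomogeneousComponent_isWeightedHomogeneous n ω
  have hPdeg : ∀ n, 2 * (P n).totalDegree < p := fun n => by
    have := totalDegree_component_le (w := xwt) ω n
    change (P n).totalDegree ≤ _ at this
    omega
  have hrel : ∀ n, coefDer F (ι × Bool) (P (n + 2)) + raise (Base F) ι (P n) -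
      C (X 0) * lower (Base F) ι (P (n + 4)) = 0 := by
    intro n
    have h1 := component_shift (w := xwt) (coefDer F (ι × Bool)).toLinearMap.toAddMonoidHom
        (fun P n hP => coefDer_shift hP) ω (n + 2)
    have h2 := component_shift (raise (Base F) ι).toLinearMap.toAddMonoidHom
        (fun P n hP => raise_shift hP) ω n
    have h3 := component_shift (lower (Base F) ι).toLinearMap.toAddMonoidHom
        (fun P n hP => lower_shift hP) ω (n + 4)
    change weightedHomogeneousComponent xwt (n + 2 + 0) (coefDer F (ι × Bool) ω) =
      coefDer F (ι × Bool) (P (n + 2)) at h1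
    change weightedHomogeneousComponent xwt (n + 2) (raise (Base F) ι ω) =
      raise (Base F) ι (P n) at h2
    change weightedHomogeneousComponent xwt (n + 4 + -2) (lower (Base F) ι ω) =
      lower (Base F) ι (P (n + 4)) at h3
    rw [add_zero] at h1
    rw [show n + 4 + -2 = n + 2 by ring] at h3
    rw [← h1, ← h2, ← h3, ← map_add, ← smul_eq_C_mul, ← map_smul, ← map_sub, smul_eq_C_mul,
      ← jetDer_apply, h, map_zero]
  have hpos : ∀ n, 0 < n → P n = 0 := by
    intro n hn
    ext1 s
    rw [hPdef]
    simp only [coeff_weightedHomogeneousComponent, coeff_zero]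
    split_ifs with hs
    · exact base_eq_zero_of_neg (hω s) (by omega)
    · rfl
  have hzero : coefDer F (ι × Bool) (P 0) = 0 := by
    ext1 s
    rw [coeff_coefDer, coeff_zero]
    simp only [hPdef, coeff_weightedHomogeneousComponent]
    split_ifs with hs
    · have h1 := hω s
      rw [hs, sub_zero] at h1
      rw [base_eq_C_of_zero h1, derivation_C]
    · simp
  have he0 : raise (Base F) ι (P 0) = 0 := by
    have := hrel 0
    rw [hpos (0 + 2) (by norm_num), hpos (0 + 4) (by norm_num)] at this
    simpa using this
  have hf0 : lower (Base F) ι (P 0) = 0 := by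
    refine eq_zero_of_raise_eq_zero (p := p) (lower_shift (hPh 0)) (by norm_num) ?_ ?_
    · have := totalDegree_lower_le (P 0)
      have := hPdeg 0
      omega
    · rw [raise_lower (hPh 0), he0]
      simp
  have hneg : ∀ k : ℕ, ∀ n : ℤ, -(k : ℤ) ≤ n → (n ≠ 0 → P n = 0) := by
    intro k
    induction k with
    | zero => intro n hn h0; exact hpos n (by push_cast at hn; omega)
    | succ k ih =>
      intro n hn h0
      by_cases hn' : -(k : ℤ) ≤ n
      · exact ih n hn' h0
      · have hS : ∀ m, -(k : ℤ) ≤ m → coefDer F (ι × Bool) (P m) = 0 ∧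
            lower (Base F) ι (P m) = 0 := by
          intro m hm
          by_cases hm0 : m = 0
          · rw [hm0]; exact ⟨hzero, hf0⟩
          · rw [ih m hm hm0]; simp
        have h1 := hrel n
        push_cast at hn
        rw [(hS (n + 2) (by omega)).1, (hS (n + 4) (by omega)).2] at h1
        refine eq_zero_of_raise_eq_zero (p := p) (hPh n) (by omega) (hPdeg n) ?_
        simpa using h1
  have hω0 : ω = P 0 := by
    ext1 s
    by_cases hs : Finsupp.weight xwt s = 0
    · simp [hPdef, coeff_weightedHomogeneousComponent, hs]
    · have h1 := congrArg (coeff s)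
        (hneg (Finsupp.weight xwt s).natAbs (Finsupp.weight xwt s) (by omega) hs)
      simp only [hPdef, coeff_weightedHomogeneousComponent, if_true, coeff_zero] at h1
      simp [hPdef, coeff_weightedHomogeneousComponent, hs, h1]
  refine ⟨?_, ?_, ?_⟩
  · ext1 s
    rw [cusp, coeff_map, coeff_map]
    have h1 := hω s
    by_cases hs : Finsupp.weight xwt s = 0
    · rw [hs, sub_zero] at h1
      rw [base_eq_C_of_zero h1, eval_C]
    · have : coeff s ω = 0 := by
        rw [hω0]
        simp [hPdef, coeff_weightedHomogeneousComponent, hs]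
      simp [this]
  · rw [cusp, ← map_raise, hω0, he0, map_zero]
  · rw [cusp, ← map_lower, hω0, hf0, map_zero]

/-- A semi-invariant isobaric form is, up to a coefficient, an `SL₂`-invariant with constant
coefficients. -/
theorem exists_invariant {p : ℕ} [CharP F p] {ω : Jet F ι} {W : ℤ} (hω : Iso ω W) (h0 : ω ≠ 0)
    {d n : Base F} (hd : d ≠ 0) (h : C d * jetDer F ι ω = C n * ω)
    (hdeg : 2 * ω.totalDegree < p) (hW : W < p) :
    ∃ (g : Base F) (v : MvPolynomial (ι × Bool) F), ω = C g * MvPolynomial.map C v ∧ g ≠ 0 ∧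
      v ≠ 0 ∧ IsWeightedHomogeneous wtS g W ∧ raise F ι v = 0 ∧ lower F ι v = 0 ∧
      v.totalDegree ≤ ω.totalDegree := by
  classical
  obtain ⟨g, ω', rfl, hprim⟩ := exists_primitive_part ω h0
  have hCg : (C g : Jet F ι) ≠ 0 := left_ne_zero_of_mul h0
  have hω' : ω' ≠ 0 := right_ne_zero_of_mul h0
  have hg : g ≠ 0 := fun h => hCg (by rw [h, C_0])
  obtain ⟨τ, hτ⟩ : ∃ τ : Base F, jetDer F ι ω' = C τ * ω' := by
    refine exists_quotient hprim (d * g) (mul_ne_zero hd hg) (n * g - d * dBase F g) ?_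
    rw [Derivation.leibniz, jetDer_C] at h
    simp only [smul_eq_mul] at h
    simp only [C_sub, C_mul]
    linear_combination h
  obtain ⟨s, hs⟩ := ne_zero_iff.mp hω'
  obtain ⟨k, hk, -⟩ := base_homogeneous_of_mul (f := g) (g := coeff s ω')
    (by simpa [coeff_C_mul] using hω s) (mul_ne_zero hg hs)
  have hiso : Iso ω' (W - k) := by
    intro s
    by_cases hs : coeff s ω' = 0
    · rw [hs]; exact isWeightedHomogeneous_zero _ _ _
    obtain ⟨k', hk', h'⟩ := base_homogeneous_of_mul (f := g) (g := coeff s ω')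
      (by simpa [coeff_C_mul] using hω s) (mul_ne_zero hg hs)
    obtain ⟨u, hu⟩ := ne_zero_iff.mp hg
    have : k = k' := (hk hu).symm.trans (hk' hu)
    subst this
    convert h' using 1
    ring
  have hτ0 : τ = 0 := by
    by_contra hτ0
    have h1 := hiso.jetDer s
    rw [hτ, coeff_C_mul] at h1
    obtain ⟨k', hk', h'⟩ := base_homogeneous_of_mul h1 (mul_ne_zero hτ0 hs)
    obtain ⟨u, hu⟩ := ne_zero_iff.mp hs
    have h2 := (hiso s) hu
    have h3 := h' hu
    have : k' = 2 := by linarith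
    exact hτ0 (base_eq_zero_of_two (this ▸ hk'))
  rw [hτ0, C_0, zero_mul] at hτ
  have hk0 : 0 ≤ k := by
    obtain ⟨u, hu⟩ := ne_zero_iff.mp hg
    rw [← hk hu]; exact wtS_nonneg u
  have hdeg' : ω'.totalDegree ≤ (C g * ω').totalDegree := by
    refine totalDegree_le_of_support_subset fun s hs => ?_
    rw [mem_support_iff, coeff_C_mul]
    exact mul_ne_zero hg (mem_support_iff.mp hs)
  have hcusp : cusp F ι ω' ≠ 0 := by
    intro hc
    have hdisc : (X 0 ^ 3 - X 1 ^ 2 : Base F) ≠ 0 := by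
      intro h
      have := congrArg (eval ![0, 1]) h
      simp at this
    have hunit : ¬ IsUnit (X 0 ^ 3 - X 1 ^ 2 : Base F) := by
      intro h
      have := h.map (eval (fun _ => (1 : F)))
      simp at this
    obtain ⟨π, hπ, hdvd⟩ := WfDvdMonoid.exists_irreducible_factor hunit hdisc
    refine hprim π hπ.prime ?_
    rw [C_dvd_iff_dvd_coeff]
    intro s
    refine hdvd.trans (disc_dvd_of_eval_eq_zero (hiso s) ?_)
    have := congrArg (coeff s) hc
    rwa [cusp, coeff_map, coeff_zero] at this
  have hWk : W - k = 0 := by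
    have h1 := cusp_jetDer hiso
    rw [hτ, map_zero] at h1
    have h2 : ((W - k : ℤ) : F) = 0 := by
      by_contra hne
      refine hcusp (eq_zero_of_cuspDer_eq_smul hne ?_)
      rw [smul_eq_C_mul, map_intCast]
      linear_combination -h1
    rw [CharP.intCast_eq_zero_iff F p] at h2
    have h3 : -(ω'.totalDegree : ℤ) ≤ W - k := by
      have h4 : Finsupp.weight xwt s + (W - k - Finsupp.weight xwt s) = W - k := by ring
      obtain ⟨u, hu⟩ := ne_zero_iff.mp hs
      have h5 := (hiso s) hu
      have h6 := wtS_nonneg u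
      have h7 := weight_ge_neg_totalDegree (w := xwt)
        (fun i => by rcases i with ⟨m, _ | _⟩ <;> simp)
        (isWeightedHomogeneous_monomial xwt s (coeff s ω') rfl)
        (monomial_eq_zero.not.mpr hs)
      have h8 : (monomial s (coeff s ω')).totalDegree ≤ ω'.totalDegree :=
        (totalDegree_monomial_le _ _).trans (le_totalDegree (mem_support_iff.mpr hs))
      omega
    refine Int.eq_zero_of_abs_lt_dvd h2 ?_
    rw [abs_lt]
    constructor <;> omega
  rw [hWk] at hiso
  obtain ⟨h1, h2, h3⟩ := horizontal_invariant (p := p) hiso hτ (by omega)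
  refine ⟨g, cusp F ι ω', congrArg (C g * ·) h1, hg, hcusp, ?_, h2, h3, ?_⟩
  · rw [show W = k by omega]
    exact hk
  · refine le_trans ?_ hdeg'
    rw [cusp]
    exact Finset.sup_mono (support_map_subset (eval fun _ : Fin 2 => (1 : F)) ω')

end HasseJet

namespace HasseJet

open MvPolynomial

variable {F : Type*} [Field F] {ι : Type*}

lemma totalDegree_aeval_le {A σ τ : Type*} [CommRing A] {f : σ → MvPolynomial τ A}
    (hf : ∀ i, (f i).totalDegree ≤ 1) (P : MvPolynomial σ A) :
    (aeval f P).totalDegree ≤ P.totalDegree := by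
  classical
  conv_lhs => rw [P.as_sum, map_sum]
  refine totalDegree_finsetSum_le fun s hs => ?_
  rw [aeval_monomial]
  refine (totalDegree_mul _ _).trans ?_
  rw [algebraMap_eq, totalDegree_C, zero_add]
  refine (totalDegree_finsetProd _ _).trans (le_trans ?_ (le_totalDegree hs))
  exact Finset.sum_le_sum fun i _ => (totalDegree_pow _ _).trans (by nlinarith [hf i])

lemma bracket_raise_lower (A : Type*) [CommRing A] :
    ⁅raise A ι, lower A ι⁆ = mkDerivation A fun i => (xwt i : MvPolynomial (ι × Bool) A) * X i := by
  refine derivation_ext fun i => ?_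
  obtain ⟨m, b⟩ := i
  rw [Derivation.commutator_apply, mkDerivation_X]
  cases b <;> simp

/-- Conjugating a derivation by an algebra endomorphism given on the variables by `f`. -/
lemma mkDerivation_aeval {σ : Type*} {f : σ → MvPolynomial σ F}
    (D D' : Derivation F (MvPolynomial σ F) (MvPolynomial σ F))
    (h : ∀ i, D' (f i) = aeval f (D (X i))) (P : MvPolynomial σ F) :
    D' (aeval f P) = aeval f (D P) := by
  induction P using MvPolynomial.induction_on with
  | C a => simp
  | add p q hp hq => simp only [map_add, hp, hq]
  | mul_X p i hp =>
    simp only [map_mul, Derivation.leibniz, map_add, smul_eq_mul, hp, aeval_X, h]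

lemma pderiv_shift {A σ : Type*} [CommRing A] {w : σ → ℤ} {i : σ} (hi : w i = 1)
    {P : MvPolynomial σ A} {n : ℤ} (hP : IsWeightedHomogeneous w P n) :
    IsWeightedHomogeneous w (pderiv i P) (n + -1) := by
  classical
  refine IsWeightedHomogeneous.mkDerivation (fun j => ?_) hP
  by_cases h : j = i
  · subst h
    rw [Pi.single_eq_same, hi]
    exact isWeightedHomogeneous_one A w
  · rw [Pi.single_eq_of_ne h]
    exact isWeightedHomogeneous_zero _ _ _

/-- An `SL₂`-invariant vanishing when one column is specialized to a nonzero vector vanishes. -/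
theorem eq_zero_of_invariant [DecidableEq ι] {p : ℕ} [CharP F p] {v : MvPolynomial (ι × Bool) F}
    (he : raise F ι v = 0) (hf : lower F ι v = 0) (hdeg : v.totalDegree < p) (m₀ : ι) {a b : F}
    (ha : a ≠ 0) (hv : aeval (fun i : ι × Bool => if i.1 = m₀ then
      (C (if i.2 then b else a) : MvPolynomial (ι × Bool) F) else X i) v = 0) : v = 0 := by
  have hh : mkDerivation F (fun i => (xwt i : MvPolynomial (ι × Bool) F) * X i) v = 0 := by
    rw [← bracket_raise_lower, Derivation.commutator_apply, he, hf, map_zero, map_zero, sub_zero]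
  let c : ι × Bool → F := fun i => if i.1 = m₀ then (if i.2 then b else a) else 0
  let f : ι × Bool → MvPolynomial (ι × Bool) F := fun i => X i + C (c i)
  set u := aeval f v with hu
  have hc : ∀ i, c i = if i.1 = m₀ then (if i.2 then b else a) else 0 := fun i => rfl
  let Δ : Derivation F (MvPolynomial (ι × Bool) F) (MvPolynomial (ι × Bool) F) :=
    mkDerivation F (fun i => (xwt i : MvPolynomial (ι × Bool) F) * X i)
  have hlow : lower F ι u + a • pderiv (m₀, true) u = 0 := by
    have h1 := mkDerivation_aeval (f := f) (lower F ι) (lower F ι + a • pderiv (m₀, true)) (by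
      rintro ⟨m, β⟩
      by_cases hm : m = m₀
      · subst hm
        cases β <;> simp [f, hc, lower, mkDerivation_X, pderiv_X, smul_eq_C_mul]
      · cases β <;> simp [f, hc, lower, mkDerivation_X, hm, pderiv_X]) v
    rw [hf, map_zero] at h1
    exact h1
  have hΔ : Δ u - a • pderiv (m₀, false) u + b • pderiv (m₀, true) u = 0 := by
    have h1 := mkDerivation_aeval (f := f) Δ (Δ - a • pderiv (m₀, false) + b • pderiv (m₀, true)) (by
      rintro ⟨m, β⟩
      by_cases hm : m = m₀
      · subst hm
        cases β <;> simp [f, hc, Δ, mkDerivation_X, pderiv_X, smul_eq_C_mul]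
        ring
      · cases β <;> simp [f, hc, Δ, mkDerivation_X, hm, pderiv_X]) v
    rw [hh, map_zero] at h1
    exact h1
  let μ : ι × Bool → ℤ := fun i => if i.1 = m₀ then 1 else 0
  have hμ0 : ∀ i, 0 ≤ μ i := fun i => by simp only [μ]; split_ifs <;> simp
  have hwμ : ∀ s : ι × Bool →₀ ℕ, 0 ≤ Finsupp.weight μ s := fun s => by
    rw [Finsupp.weight_apply]
    exact Finset.sum_nonneg fun i _ => nsmul_nonneg (hμ0 i) _
  have hwμ' : ∀ s : ι × Bool →₀ ℕ, Finsupp.weight μ s ≤ (s.sum fun _ e => e : ℕ) := fun s => by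
    rw [Finsupp.weight_apply, Finsupp.sum, Finsupp.sum, Nat.cast_sum]
    refine Finset.sum_le_sum fun i _ => ?_
    simp only [μ]; split_ifs <;> simp
  set U : ℤ → MvPolynomial (ι × Bool) F := fun n => weightedHomogeneousComponent μ n u with hU
  have hUh : ∀ n, IsWeightedHomogeneous μ (U n) n := fun n =>
    weightedHomogeneousComponent_isWeightedHomogeneous n u
  have shift_pd : ∀ β n, weightedHomogeneousComponent μ n (pderiv (m₀, β) u) =
      pderiv (m₀, β) (U (n + 1)) := by
    intro β n
    have := component_shift (w := μ) (k := -1) (pderiv (m₀, β) :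
      Derivation F (MvPolynomial (ι × Bool) F) _).toLinearMap.toAddMonoidHom
      (fun P n hP => pderiv_shift (by simp [μ]) hP) u (n + 1)
    rw [show n + 1 + -1 = n by ring] at this
    exact this
  have shift_lower : ∀ n, weightedHomogeneousComponent μ n (lower F ι u) = lower F ι (U n) := by
    intro n
    have := component_shift (w := μ) (k := 0) (lower F ι).toLinearMap.toAddMonoidHom
      (fun P n hP => IsWeightedHomogeneous.mkDerivation (fun i => by
        split_ifs with h
        · rw [add_zero]
          exact isWeightedHomogeneous_X F μ (i.1, false)
        · exact isWeightedHomogeneous_zero _ _ _) hP) u n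
    rw [add_zero] at this
    exact this
  have shift_Δ : ∀ n, weightedHomogeneousComponent μ n (Δ u) = Δ (U n) := by
    intro n
    have := component_shift (w := μ) (k := 0) Δ.toLinearMap.toAddMonoidHom
      (fun P n hP => IsWeightedHomogeneous.mkDerivation (fun i => by
        have := (isWeightedHomogeneous_C (R := F) μ (xwt i : F)).mul (isWeightedHomogeneous_X F μ i)
        rw [zero_add] at this
        simpa using this) hP) u n
    rw [add_zero] at this
    exact this
  have hU0 : U 0 = 0 := by
    let z : ι × Bool → MvPolynomial (ι × Bool) F := fun i => if i.1 = m₀ then 0 else X i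
    have h1 : aeval z u = 0 := by
      rw [hu, ← AlgHom.comp_apply, ← hv]
      congr 1
      ext i
      simp only [AlgHom.comp_apply, aeval_X, f, map_add, z, hc]
      split_ifs <;> simp
    have h2 : ∀ P : MvPolynomial (ι × Bool) F, aeval z P = weightedHomogeneousComponent μ 0 P := by
      intro P
      conv_lhs => rw [P.as_sum]
      conv_rhs => rw [P.as_sum]
      rw [map_sum, map_sum]
      refine Finset.sum_congr rfl fun s _ => ?_
      have hm : IsWeightedHomogeneous μ (monomial s (coeff s P)) (Finsupp.weight μ s) :=
        isWeightedHomogeneous_monomial _ _ _ rfl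
      by_cases hs : Finsupp.weight μ s = 0
      · rw [← hs, hm.weightedHomogeneousComponent_same, aeval_monomial, algebraMap_eq,
          monomial_eq]
        congr 1
        refine Finsupp.prod_congr fun i hi => ?_
        simp only [z]
        rw [if_neg]
        intro him
        rw [Finsupp.weight_apply, Finsupp.sum, Finset.sum_eq_zero_iff_of_nonneg
          (fun i _ => nsmul_nonneg (hμ0 i) _)] at hs
        have := hs i hi
        simp only [μ, him, if_true, nsmul_eq_mul, mul_one, Nat.cast_eq_zero] at this
        exact Finsupp.mem_support_iff.mp hi this
      · rw [hm.weightedHomogeneousComponent_ne _ (Ne.symm hs), aeval_monomial]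
        obtain ⟨i, hi, him⟩ : ∃ i ∈ s.support, i.1 = m₀ := by
          by_contra hcon
          push Not at hcon
          apply hs
          rw [Finsupp.weight_apply, Finsupp.sum]
          exact Finset.sum_eq_zero fun i hi => by simp [μ, hcon i hi]
        have : (s.prod fun i k => z i ^ k) = 0 := by
          refine Finset.prod_eq_zero hi ?_
          simp only [z, him, if_true]
          exact zero_pow (Finsupp.mem_support_iff.mp hi)
        rw [this, mul_zero]
    rw [hU]; exact (h2 u).symm.trans h1
  have hudeg : u.totalDegree ≤ v.totalDegree := totalDegree_aeval_le (fun i => by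
    refine (totalDegree_add _ _).trans (max_le ?_ ?_)
    · simp
    · simp) v
  have hUk : ∀ k : ℕ, U k = 0 := by
    intro k
    induction k with
    | zero => exact hU0
    | succ k ih =>
      have h1 : pderiv (m₀, true) (U (k + 1)) = 0 := by
        have := congrArg (weightedHomogeneousComponent μ (k : ℤ)) hlow
        rw [map_add, map_smul, shift_lower, shift_pd, ih, map_zero, map_zero, zero_add] at this
        exact (smul_eq_zero.mp this).resolve_left ha
      have h2 : pderiv (m₀, false) (U (k + 1)) = 0 := by
        have := congrArg (weightedHomogeneousComponent μ (k : ℤ)) hΔ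
        rw [map_add, map_sub, map_smul, map_smul, shift_Δ, shift_pd, shift_pd, ih, h1, map_zero,
          map_zero, smul_zero, zero_sub, add_zero, neg_eq_zero] at this
        exact (smul_eq_zero.mp this).resolve_left ha
      have h3 := euler_identity (hUh (k + 1))
      have h4 : mkDerivation F (fun i => (μ i : MvPolynomial (ι × Bool) F) * X i) =
          (X (m₀, true) : MvPolynomial (ι × Bool) F) • pderiv (m₀, true) +
            (X (m₀, false) : MvPolynomial (ι × Bool) F) • pderiv (m₀, false) := by
        refine derivation_ext fun i => ?_
        obtain ⟨m, β⟩ := i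
        by_cases hm : m = m₀
        · subst hm
          cases β <;> simp [mkDerivation_X, μ, pderiv_X]
        · cases β <;> simp [mkDerivation_X, μ, pderiv_X, hm]
      rw [h4] at h3
      simp only [Derivation.add_apply, Derivation.smul_apply, h1, h2, smul_zero, add_zero,
        zsmul_eq_mul] at h3
      rcases mul_eq_zero.mp h3.symm with h5 | h5
      · rw [← map_intCast (C : F →+* MvPolynomial (ι × Bool) F), map_eq_zero_iff _ (C_injective _ _),
          CharP.intCast_eq_zero_iff F p] at h5
        have h6 := Int.le_of_dvd (by positivity) h5
        push_cast
        ext s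
        rw [hU, coeff_zero]
        simp only [coeff_weightedHomogeneousComponent]
        split_ifs with hs
        · by_contra h0
          have h7 := le_totalDegree (mem_support_iff.mpr h0)
          have h8 := hwμ' s
          have h9 : ((s.sum fun _ e => e : ℕ) : ℤ) < p := by exact_mod_cast (h7.trans hudeg).trans_lt hdeg
          omega
        · rfl
      · push_cast; exact h5
  have hu0 : u = 0 := by
    refine eq_zero_of_component_eq_zero (w := μ) fun n => ?_
    rcases le_or_gt 0 n with hn | hn
    · obtain ⟨k, rfl⟩ := Int.eq_ofNat_of_zero_le hn
      exact hUk k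
    · ext s
      rw [coeff_weightedHomogeneousComponent, if_neg, coeff_zero]
      have := hwμ s
      omega
  have h1 : aeval (fun i => X i - C (c i)) u = v := by
    rw [hu, ← AlgHom.comp_apply]
    conv_rhs => rw [← AlgHom.id_apply (R := F) v]
    congr 1
    ext1 i
    simp [f]
  rw [← h1, hu0, map_zero]

end HasseJet

namespace HasseJet

open MvPolynomial

variable {F : Type*} [Field F] {ι : Type*}

/-- Restriction of `F[Q, R]` to the diagonal `Q = R = t`. -/
noncomputable def diag (F : Type*) [Field F] : Base F →+* Polynomial F :=
  eval₂Hom Polynomial.C fun _ => Polynomial.X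

@[simp] lemma diag_C (a : F) : diag F (C a) = Polynomial.C a := by simp [diag]

@[simp] lemma diag_X (i : Fin 2) : diag F (X i) = Polynomial.X := by simp [diag]

/-- The pullback of forms along `t ↦ (t, t, h t, k t)`. -/
noncomputable def pull (h k : Polynomial F) : Jet F Unit →+* Polynomial F :=
  eval₂Hom (diag F) fun i => if i.2 then k else h

/-- The first-order system satisfied by the Hasse polynomial and its companion. -/
structure HasseSystem (h k : Polynomial F) : Prop where
  left : 12 * Polynomial.X * (Polynomial.X - 1) * Polynomial.derivative h =
    -(3 * Polynomial.X - 2) * h + k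
  right : 12 * Polynomial.X * (Polynomial.X - 1) * Polynomial.derivative k =
    (3 * Polynomial.X - 2) * k - Polynomial.X * h

lemma HasseSystem.pull_jetDer {h k : Polynomial F} (hs : HasseSystem h k) {P : Jet F Unit} {W : ℤ}
    (hP : Iso P W) : 12 * Polynomial.X * (Polynomial.X - 1) * Polynomial.derivative (pull h k P) =
      (3 * Polynomial.X - 2) * (W : Polynomial F) * pull h k P + pull h k (jetDer F Unit P) := by
  refine hP.induct (Pr := fun P W =>
    12 * Polynomial.X * (Polynomial.X - 1) * Polynomial.derivative (pull h k P) =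
      (3 * Polynomial.X - 2) * (W : Polynomial F) * pull h k P + pull h k (jetDer F Unit P))
    ?_ ?_ ?_ ?_ ?_ ?_
  · intro W; simp
  · intro P P' W h h'
    simp only [map_add, mul_add, h, h']; ring
  · intro P P' W W' h h'
    simp only [Derivation.leibniz, map_add, map_mul, smul_eq_mul, Polynomial.derivative_mul]
    push_cast
    linear_combination (pull _ _ P') * h + (pull _ _ P) * h'
  · intro a
    have : jetDer F Unit (C (C a)) = 0 := by
      rw [jetDer_C]; simp
    simp [this, pull]
  · intro j
    rw [jetDer_C]
    have h4 : (Polynomial.C (4 : F)) = 4 := map_ofNat _ _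
    have h6 : (Polynomial.C (6 : F)) = 6 := map_ofNat _ _
    fin_cases j <;> simp [pull, dBase, mkDerivation_X, wtS, h4, h6] <;> ring
  · rintro ⟨m, b⟩
    rw [jetDer_X]
    have h1 := hs.left
    have h2 := hs.right
    cases b
    · simp [pull, xwt]; linear_combination h1
    · simp [pull, xwt]; linear_combination h2

lemma HasseSystem.pow_dvd_pull_iterate {h k : Polynomial F} (hs : HasseSystem h k) {L : Jet F Unit}
    {w : ℤ} (hL : Iso L w) {t₀ : F} {N : ℕ}
    (hdvd : (Polynomial.X - Polynomial.C t₀) ^ N ∣ pull h k L) (n : ℕ) :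
    (Polynomial.X - Polynomial.C t₀) ^ (N - n) ∣ pull h k ((jetDer F Unit)^[n] L) := by
  induction n with
  | zero => simpa using hdvd
  | succ n ih =>
    rw [Function.iterate_succ_apply']
    have h1 := hs.pull_jetDer (hL.iterate n)
    rw [← sub_eq_iff_eq_add'] at h1
    rw [← h1, ← Nat.sub_sub]
    refine dvd_sub (Dvd.dvd.mul_left ?_ _) (Dvd.dvd.mul_left ((pow_dvd_pow _ (Nat.sub_le _ _)).trans ih) _)
    exact Polynomial.pow_sub_one_dvd_derivative_of_pow_dvd ih

lemma diag_ne_zero_and_natDegree_le {g : Base F} {W : ℤ} (hg : IsWeightedHomogeneous wtS g W)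
    (h0 : g ≠ 0) : diag F g ≠ 0 ∧ 4 * ((diag F g).natDegree : ℤ) ≤ W := by
  classical
  have hsum : diag F g = ∑ s ∈ g.support, Polynomial.monomial (s 0 + s 1) (coeff s g) := by
    conv_lhs => rw [g.as_sum, map_sum]
    refine Finset.sum_congr rfl fun s _ => ?_
    rw [diag, coe_eval₂Hom, eval₂_monomial, Finsupp.prod_fintype _ _ (by simp),
      ← Polynomial.C_mul_X_pow_eq_monomial]
    simp [pow_add]
  have hw : ∀ s ∈ g.support, (4 * s 0 + 6 * s 1 : ℤ) = W := fun s hs => by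
    rw [← weight_wtS']; exact hg (mem_support_iff.mp hs)
  refine ⟨fun hz => ?_, ?_⟩
  · obtain ⟨u, hu⟩ := ne_zero_iff.mp h0
    have h1 := congrArg (fun f => Polynomial.coeff f (u 0 + u 1)) hsum
    simp only [hz, Polynomial.coeff_zero, Polynomial.finsetSum_coeff] at h1
    rw [Finset.sum_eq_single u] at h1
    · rw [Polynomial.coeff_monomial, if_pos rfl] at h1
      exact hu h1.symm
    · intro s hs hsu
      rw [Polynomial.coeff_monomial, if_neg]
      intro h2
      have h3 := hw s hs
      have h4 := hw u (mem_support_iff.mpr hu)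
      apply hsu
      ext i
      fin_cases i <;> simp <;> omega
    · intro h; exact absurd (mem_support_iff.mpr hu) h
  · obtain ⟨u, hu⟩ := ne_zero_iff.mp h0
    have hu' := hw u (mem_support_iff.mpr hu)
    obtain ⟨N, rfl⟩ : ∃ N : ℕ, W = N := ⟨W.toNat, by omega⟩
    have : (diag F g).natDegree ≤ N / 4 := by
      rw [hsum]
      refine Polynomial.natDegree_sum_le_of_forall_le _ _ fun s hs => ?_
      refine (Polynomial.natDegree_monomial_le _).trans ?_
      have := hw s hs
      omega
    omega

lemma dvd_det_of_dvd_col {R : Type*} [CommRing R] {r : ℕ} (M : Matrix (Fin r) (Fin r) R) (j : Fin r)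
    {a : R} (h : ∀ i, a ∣ M i j) : a ∣ M.det := by
  rw [Matrix.det_apply]
  refine Finset.dvd_sum fun σ _ => ?_
  rw [Units.smul_def, zsmul_eq_mul]
  exact Dvd.dvd.mul_left ((h (σ j)).trans
    (Finset.dvd_prod_of_mem (fun i => M (σ i) i) (Finset.mem_univ j))) _

/-- A bounded number of polynomials of bounded degree can be independent. -/
lemma card_le_of_linearIndependent {δ r : ℕ} {v : Fin r → Jet F Unit}
    (hv : LinearIndependent (Base F) v) (hd : ∀ i, (v i).totalDegree ≤ δ) :
    r ≤ (δ + 1) ^ 2 := by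
  let φ : Jet F Unit →ₗ[Base F] (Fin (δ + 1) × Fin (δ + 1) → Base F) :=
    LinearMap.pi fun ij => lcoeff (Base F)
      (Finsupp.single ((), false) (ij.1 : ℕ) + Finsupp.single ((), true) (ij.2 : ℕ))
  have h1 : LinearIndependent (Base F) (φ ∘ v) := by
    refine hv.map ?_
    rw [Submodule.disjoint_def]
    intro P hP hker
    have hP' : P ∈ restrictTotalDegree (Unit × Bool) (Base F) δ := by
      refine Submodule.span_le.mpr ?_ hP
      rintro _ ⟨i, rfl⟩
      exact (mem_restrictTotalDegree _ _ _).mpr (hd i)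
    rw [mem_restrictTotalDegree] at hP'
    ext1 s
    by_contra hs
    have h2 := (le_totalDegree (mem_support_iff.mpr hs)).trans hP'
    rw [Finsupp.sum_fintype _ _ (by simp), Fintype.sum_prod_type] at h2
    simp only [Fintype.sum_bool, Finset.univ_unique, Finset.sum_singleton] at h2
    change s ((), true) + s ((), false) ≤ δ at h2
    have h3 := congrFun (LinearMap.mem_ker.mp hker)
      (⟨s ((), false), by omega⟩, ⟨s ((), true), by omega⟩)
    apply hs
    rw [coeff_zero]
    refine Eq.trans ?_ h3
    simp only [φ, LinearMap.pi_apply, lcoeff_apply]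
    congr 1
    ext ⟨⟨⟩, b⟩
    cases b <;> simp
  have h2 := h1.fintype_card_le_finrank
  simpa [sq] using h2

end HasseJet

namespace HasseJet

open MvPolynomial

variable {F : Type*} [Field F] {ι : Type*}

/-- A minimal linear relation between iterates. -/
lemma exists_minimal_relation {A M : Type*} [CommRing A] [IsDomain A] [AddCommGroup M] [Module A M]
    [Module.IsTorsionFree A M] (v : ℕ → M) (h0 : v 0 ≠ 0) {N : ℕ}
    (hN : ∀ r, LinearIndependent A (fun n : Fin r => v n) → r ≤ N) :
    ∃ (r : ℕ) (d : A) (c : Fin (r + 1) → A), r + 1 ≤ N ∧ d ≠ 0 ∧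
      LinearIndependent A (fun n : Fin (r + 1) => v n) ∧
      d • v (r + 1) = ∑ n : Fin (r + 1), c n • v n := by
  classical
  have hex : ∃ r, ¬ LinearIndependent A (fun n : Fin r => v n) :=
    ⟨N + 1, fun h => absurd (hN _ h) (by omega)⟩
  obtain ⟨r, hr, hmin⟩ : ∃ r, ¬ LinearIndependent A (fun n : Fin (r + 2) => v n) ∧
      LinearIndependent A (fun n : Fin (r + 1) => v n) := by
    have h1 := Nat.find_spec hex
    have h2 := fun m => Nat.find_min hex (m := m)
    match hk : Nat.find hex with
    | 0 =>
      rw [hk] at h1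
      exact absurd linearIndependent_empty_type h1
    | 1 =>
      rw [hk] at h1
      exact absurd (LinearIndependent.of_subsingleton (0 : Fin 1) (by simpa using h0)) h1
    | r + 2 =>
      rw [hk] at h1 h2
      exact ⟨r, h1, not_not.mp (h2 (r + 1) (by omega))⟩
  rw [Fintype.linearIndependent_iff] at hr
  push Not at hr
  obtain ⟨c, hc, i, hi⟩ := hr
  rw [Fin.sum_univ_castSucc] at hc
  have hd : c (Fin.last _) ≠ 0 := by
    intro hd
    rw [hd, zero_smul, add_zero] at hc
    have h1 := Fintype.linearIndependent_iff.mp hmin (fun n => c n.castSucc) (by simpa using hc)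
    refine hi (Fin.lastCases hd (fun j => h1 j) i)
  refine ⟨r, c (Fin.last _), fun n => -c n.castSucc, hN _ hmin, hd, hmin, ?_⟩
  simp only [neg_smul, Finset.sum_neg_distrib]
  rw [eq_neg_iff_add_eq_zero, add_comm]
  simpa using hc

/-- Restriction of the coefficients to the diagonal and of the column `m₀` to `(h, k)`. -/
noncomputable def frame (h k : Polynomial F) [DecidableEq ι] (m₀ : ι) :
    Jet F ι →+* MvPolynomial (ι × Bool) (Polynomial F) :=
  eval₂Hom (C.comp (diag F)) fun i => if i.1 = m₀ then C (if i.2 then k else h) else X i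

lemma frame_col (h k : Polynomial F) [DecidableEq ι] (m₀ : ι) (P : Jet F Unit) :
    frame h k m₀ (col m₀ P) = C (pull h k P) := by
  have : (frame h k m₀).comp (col m₀ : Jet F Unit →ₐ[Base F] Jet F ι).toRingHom =
      C.comp (pull h k) := by
    refine MvPolynomial.ringHom_ext (fun a => ?_) fun i => ?_
    · simp [frame, col, pull]
    · simp [frame, col, pull]
  exact congrArg (fun f => f P) this

lemma frame_eval (h k : Polynomial F) [DecidableEq ι] (m₀ : ι) (t₀ : F)
    (v : MvPolynomial (ι × Bool) F) :
    MvPolynomial.map (Polynomial.evalRingHom t₀) (frame h k m₀ (MvPolynomial.map C v)) =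
      aeval (fun i : ι × Bool => if i.1 = m₀ then
        (C (if i.2 then k.eval t₀ else h.eval t₀) : MvPolynomial (ι × Bool) F) else X i) v := by
  have : ((MvPolynomial.map (Polynomial.evalRingHom t₀)).comp
      ((frame h k m₀).comp (MvPolynomial.map C))) =
      (aeval (fun i : ι × Bool => if i.1 = m₀ then
        (C (if i.2 then k.eval t₀ else h.eval t₀) : MvPolynomial (ι × Bool) F)
          else X i)).toRingHom := by
    refine MvPolynomial.ringHom_ext (fun a => ?_) fun i => ?_
    · simp [frame]
    · obtain ⟨m, b⟩ := i
      by_cases hm : m = m₀ <;> cases b <;> simp [frame, hm]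
  exact congrArg (fun f => f v) this

/-- A nonzero isobaric form of low weight and degree cannot vanish to order `p` along a solution
of the Hasse system. -/
theorem HasseSystem.not_pow_dvd_pull {p : ℕ} [CharP F p] {h k : Polynomial F}
    (hs : HasseSystem h k) {L : Jet F Unit} {w δ : ℕ} (hL : Iso L w) (hδ : L.totalDegree ≤ δ)
    (h0 : L ≠ 0) (hp : 4 * ((δ + 1) ^ 2 * (w + (δ + 1) ^ 2 + δ) + 1) ≤ p) {t₀ : F}
    (ht : h.eval t₀ ≠ 0) : ¬ (Polynomial.X - Polynomial.C t₀) ^ p ∣ pull h k L := by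
  classical
  intro hdvd
  set ℓ := (δ + 1) ^ 2 with hℓ
  obtain ⟨r, d, c, hrℓ, hd, hind, hrel⟩ := exists_minimal_relation (A := Base F)
    (fun n => (jetDer F Unit)^[n] L) (by simpa using h0) (N := ℓ) (fun r hr =>
      card_le_of_linearIndependent hr fun i => (totalDegree_iterate_le _ _).trans hδ)
  have hω0 := wronskian_ne_zero L (r + 1) hind
  have hωiso := hL.wronskian (r + 1)
  have hωdeg := totalDegree_wronskian_le L (r + 1)
  set ω := wronskian L (r + 1) with hω
  have hωdeg' : ω.totalDegree ≤ ℓ * δ := hωdeg.trans (Nat.mul_le_mul hrℓ hδ)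
  have hW : (((r + 1 : ℕ) : ℤ) * w + ((r + 1 : ℕ) : ℤ) * (((r + 1 : ℕ) : ℤ) - 1)) ≤
      (ℓ * (w + ℓ) : ℕ) := by
    have h1 : (r + 1) * w + (r + 1) * r ≤ ℓ * (w + ℓ) := by
      rw [← mul_add]; exact Nat.mul_le_mul hrℓ (by omega)
    calc _ = (((r + 1) * w + (r + 1) * r : ℕ) : ℤ) := by push_cast; ring
      _ ≤ _ := by exact_mod_cast h1
  have hp1 : 4 * (ℓ * (w + ℓ)) + 4 * (ℓ * δ) + 4 ≤ p := by
    calc _ = 4 * (ℓ * (w + ℓ + δ) + 1) := by ring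
      _ ≤ p := hp
  obtain ⟨g, v, hgv, hg0, hv0, hgh, hve, hvf, hvd⟩ := exists_invariant (p := p) hωiso hω0 hd
    (jetDer_wronskian L r c d hrel) (by omega) (by omega)
  obtain ⟨hdg, hdgn⟩ := diag_ne_zero_and_natDegree_le hgh hg0
  let Θ := frame h k (0 : Fin (r + 1))
  have hΘcol : ∀ P, Θ (col 0 P) = C (pull h k P) := frame_col h k 0
  set π : Polynomial F := Polynomial.X - Polynomial.C t₀ with hπ
  have hπp : Prime π := Polynomial.prime_X_sub_C t₀
  have hdvdω : C π ^ (p - r) ∣ Θ ω := by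
    rw [hω, wronskian, RingHom.map_det]
    refine dvd_det_of_dvd_col _ 0 fun n => ?_
    change _ ∣ Θ (col 0 ((jetDer F Unit)^[n] L))
    rw [hΘcol, ← C_pow]
    refine map_dvd C ((pow_dvd_pow π ?_).trans (hs.pow_dvd_pull_iterate hL hdvd n))
    have := n.is_lt
    omega
  have hdvdv : C π ∣ Θ (MvPolynomial.map C v) := by
    by_contra hnd
    rw [hgv, map_mul] at hdvdω
    have h1 := Prime.pow_dvd_of_dvd_mul_right ((MvPolynomial.prime_C_iff _).mpr hπp) _ hnd hdvdω
    have h2 : Θ (C g) = C (diag F g) := by simp [Θ, frame]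
    rw [h2, ← C_pow, C_dvd_iff_dvd_coeff] at h1
    have h3 := h1 0
    rw [coeff_zero_C] at h3
    have h4 := Polynomial.natDegree_le_of_dvd h3 hdg
    rw [hπ, Polynomial.natDegree_pow, Polynomial.natDegree_X_sub_C, mul_one] at h4
    have h5 : ℓ ≤ ℓ * (w + ℓ) := Nat.le_mul_of_pos_right _ (by rw [hℓ]; positivity)
    omega
  refine hv0 (eq_zero_of_invariant (p := p) hve hvf (by omega) (0 : Fin (r + 1)) ht
    (b := k.eval t₀) ?_)
  have h1 : MvPolynomial.map (Polynomial.evalRingHom t₀) (Θ (MvPolynomial.map C v)) = 0 := by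
    have h2 := map_dvd (MvPolynomial.map (Polynomial.evalRingHom t₀)) hdvdv
    rw [map_C] at h2
    have h3 : Polynomial.evalRingHom t₀ π = 0 := by simp [hπ]
    rw [h3, C_0, zero_dvd_iff] at h2
    exact h2
  rw [← h1, frame_eval]

end HasseJet

namespace HasseJet

open MvPolynomial

variable {F : Type*} [Field F]

/-- Specialization of a form to the diagonal with `X = c`, as a polynomial in `Y` over `F[t]`. -/
noncomputable def spec (c : F) : Jet F Unit →+* Polynomial (Polynomial F) :=
  eval₂Hom (Polynomial.C.comp (diag F)) fun i =>
    if i.2 then Polynomial.X else Polynomial.C (Polynomial.C c)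

lemma eval_spec {h k : Polynomial F} {c t : F} (ht : h.eval t = c) (P : Jet F Unit) :
    ((spec c P).eval (Polynomial.C (k.eval t))).eval t = (pull h k P).eval t := by
  have : (Polynomial.evalRingHom t).comp ((Polynomial.evalRingHom (Polynomial.C (k.eval t))).comp
      (spec c)) = (Polynomial.evalRingHom t).comp (pull h k) := by
    refine MvPolynomial.ringHom_ext (fun a => ?_) fun i => ?_
    · simp [spec, pull]
    · obtain ⟨m, b⟩ := i
      cases b <;> simp [spec, pull, ht]
  exact congrArg (fun f => f P) this

lemma spec_smul (c a : F) (P : Jet F Unit) :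
    spec c (a • P) = Polynomial.C (Polynomial.C a) * spec c P := by
  rw [Algebra.smul_def, map_mul]
  congr 1
  change spec c (C (C a)) = _
  simp [spec]

lemma spec_eq_sum (c : F) (P : Jet F Unit) : spec c P = ∑ s ∈ P.support,
    Polynomial.monomial (s ((), true)) (diag F (coeff s P) * Polynomial.C (c ^ s ((), false))) := by
  conv_lhs => rw [P.as_sum, map_sum]
  refine Finset.sum_congr rfl fun s _ => ?_
  rw [spec, coe_eval₂Hom, eval₂_monomial, Finsupp.prod_fintype _ _ (by simp),
    Fintype.prod_prod_type, ← Polynomial.C_mul_X_pow_eq_monomial]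
  simp only [Fintype.prod_bool, Finset.univ_unique, Finset.prod_singleton]
  rw [if_pos trivial, if_neg Bool.false_ne_true, RingHom.comp_apply, Polynomial.C_mul, Polynomial.C_pow, Polynomial.C_pow]
  change _ * (_ ^ s ((), true) * _ ^ s ((), false)) = _
  ring

lemma spec_coeff_eq_zero (c : F) {P : Jet F Unit} {y : ℕ} (hy : P.totalDegree < y) :
    (spec c P).coeff y = 0 := by
  rw [spec_eq_sum, Polynomial.finsetSum_coeff]
  refine Finset.sum_eq_zero fun s hs => ?_
  rw [Polynomial.coeff_monomial, if_neg]
  have h1 := le_totalDegree hs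
  rw [Finsupp.sum_fintype _ _ (by simp), Fintype.sum_prod_type] at h1
  simp only [Fintype.sum_bool, Finset.univ_unique, Finset.sum_singleton] at h1
  change s ((), true) + s ((), false) ≤ _ at h1
  omega

lemma natDegree_spec_coeff_le (c : F) {P : Jet F Unit} {W : ℤ} (hP : Iso P W) {E : ℕ}
    (hE : W + P.totalDegree ≤ 4 * E) (y : ℕ) : ((spec c P).coeff y).natDegree ≤ E := by
  rw [spec_eq_sum, Polynomial.finsetSum_coeff]
  refine Polynomial.natDegree_sum_le_of_forall_le _ _ fun s hs => ?_
  rw [Polynomial.coeff_monomial]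
  split_ifs with h
  · refine Polynomial.natDegree_mul_le.trans ?_
    rw [Polynomial.natDegree_C, add_zero]
    have h1 := (diag_ne_zero_and_natDegree_le (hP s) (mem_support_iff.mp hs)).2
    have h2 := weight_ge_neg_totalDegree (w := xwt)
        (fun i => by rcases i with ⟨m, _ | _⟩ <;> simp)
        (isWeightedHomogeneous_monomial xwt s (coeff s P) rfl)
        (monomial_eq_zero.not.mpr (mem_support_iff.mp hs))
    have h3 : (monomial s (coeff s P)).totalDegree ≤ P.totalDegree :=
      (totalDegree_monomial_le _ _).trans (le_totalDegree hs)
    omega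
  · simp

/-- The monomial `Q^{3i} R^{2(ν+j-k-i)} X^{12j} Y^{12k}` of weight `12ν`. -/
noncomputable def mon (F : Type*) [Field F] (ν i j k : ℕ) : Jet F Unit :=
  C (X 0 ^ (3 * i) * X 1 ^ (2 * (ν + j - k - i))) * X ((), false) ^ (12 * j) *
    X ((), true) ^ (12 * k)

lemma mon_iso {ν i j k : ℕ} (h : i + k ≤ ν + j) : Iso (mon F ν i j k) (12 * ν : ℕ) := by
  have h1 : IsWeightedHomogeneous wtS (X 0 ^ (3 * i) * X 1 ^ (2 * (ν + j - k - i)) : Base F)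
      ((3 * i : ℕ) • wtS 0 + (2 * (ν + j - k - i) : ℕ) • wtS 1) :=
    ((isWeightedHomogeneous_X F wtS 0).pow _).mul ((isWeightedHomogeneous_X F wtS 1).pow _)
  have h2 := (((Iso.C_base (ι := Unit) h1).mul ((Iso.X_var ((), false)).pow (12 * j))).mul
    ((Iso.X_var ((), true)).pow (12 * k)))
  have w0 : wtS 0 = 4 := rfl
  have w1 : wtS 1 = 6 := rfl
  have x0 : xwt (((), false) : Unit × Bool) = -1 := rfl
  have x1 : xwt (((), true) : Unit × Bool) = 1 := rfl
  obtain ⟨d, hd⟩ : ∃ d, ν + j - k - i = d := ⟨_, rfl⟩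
  have h3 : (ν + j : ℤ) = i + k + d := by omega
  have h4 : (3 * i) • wtS 0 + (2 * (ν + j - k - i)) • wtS 1 + ((12 * j : ℕ) : ℤ) *
      xwt (((), false) : Unit × Bool) + ((12 * k : ℕ) : ℤ) * xwt (((), true) : Unit × Bool) =
      (12 * ν : ℕ) := by
    rw [w0, w1, x0, x1, hd, nsmul_eq_mul, nsmul_eq_mul]
    push_cast
    linarith
  rw [h4] at h2
  exact h2

lemma mon_eq (ν i j k : ℕ) : mon F ν i j k =
    monomial (Finsupp.single ((), false) (12 * j) + Finsupp.single ((), true) (12 * k))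
      (monomial (Finsupp.single 0 (3 * i) + Finsupp.single 1 (2 * (ν + j - k - i))) 1) := by
  rw [mon, X_pow_eq_monomial, X_pow_eq_monomial, X_pow_eq_monomial, X_pow_eq_monomial,
    monomial_mul, mul_one, C_mul_monomial, monomial_mul, mul_one, mul_one]

lemma totalDegree_mon_le (ν i j k : ℕ) : (mon F ν i j k).totalDegree ≤ 12 * j + 12 * k := by
  rw [mon_eq]
  refine (totalDegree_monomial_le _ _).trans ?_
  rw [Finsupp.sum_add_index' (by simp) (by simp), Finsupp.sum_single_index rfl,
    Finsupp.sum_single_index rfl, id, id]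

lemma natDegree_pull_mon_le {h k : Polynomial F} {p : ℕ} (hh : h.natDegree ≤ p)
    (hk : k.natDegree ≤ p) (ν i j l : ℕ) : (pull h k (mon F ν i j l)).natDegree ≤
      3 * i + 2 * (ν + j - l - i) + 12 * j * p + 12 * l * p := by
  have : pull h k (mon F ν i j l) = Polynomial.X ^ (3 * i) * Polynomial.X ^ (2 * (ν + j - l - i)) *
      h ^ (12 * j) * k ^ (12 * l) := by
    simp [mon, pull]
  rw [this]
  refine Polynomial.natDegree_mul_le_of_le (Polynomial.natDegree_mul_le_of_le
    (Polynomial.natDegree_mul_le_of_le ?_ ?_) ?_) ?_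
  · simp
  · simp
  · exact Polynomial.natDegree_pow_le_of_le _ hh
  · exact Polynomial.natDegree_pow_le_of_le _ hk

lemma coeff_coeff_mon (ν i j k i' j' k' : ℕ) :
    coeff (Finsupp.single 0 (3 * i) + Finsupp.single 1 (2 * (ν + j - k - i)))
      (coeff (Finsupp.single ((), false) (12 * j) + Finsupp.single ((), true) (12 * k))
        (mon F ν i' j' k')) = if i' = i ∧ j' = j ∧ k' = k then 1 else 0 := by
  classical
  rw [mon_eq, coeff_monomial]
  by_cases h1 : j' = j ∧ k' = k
  · obtain ⟨rfl, rfl⟩ := h1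
    rw [if_pos rfl, coeff_monomial]
    by_cases h2 : i' = i
    · subst h2; simp
    · rw [if_neg, if_neg (fun h => h2 h.1)]
      intro h
      have := DFunLike.congr_fun h 0
      simp at this
      exact h2 this
  · rw [if_neg, coeff_zero, if_neg (fun h => h1 h.2)]
    intro h
    have a1 := DFunLike.congr_fun h ((), false)
    have a2 := DFunLike.congr_fun h ((), true)
    simp at a1 a2
    exact h1 ⟨a1, a2⟩

end HasseJet

namespace HasseJet

open MvPolynomial

variable {F : Type*} [Field F]

/-- The form with coefficients `c` on the monomials `mon F ν i j k`. -/
noncomputable def form (F : Type*) [Field F] (ν D K : ℕ) :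
    (Fin D × Fin K × Fin K → F) →ₗ[F] Jet F Unit :=
  Fintype.linearCombination F fun s : Fin D × Fin K × Fin K => mon F ν s.1 s.2.1 s.2.2

lemma form_apply {ν D K : ℕ} (c : Fin D × Fin K × Fin K → F) :
    form F ν D K c = ∑ s, c s • mon F ν s.1 s.2.1 s.2.2 := rfl

lemma form_iso {ν D K : ℕ} (h : D + K ≤ ν) (c : Fin D × Fin K × Fin K → F) :
    Iso (form F ν D K c) (12 * ν : ℕ) := by
  rw [form_apply]
  refine Iso.sum _ _ fun s _ => ?_
  have h1 : Iso (C (C (c s)) : Jet F Unit) 0 := Iso.C_base (isWeightedHomogeneous_C _ _)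
  have h2 := h1.mul (mon_iso (F := F) (ν := ν) (i := s.1) (j := s.2.1) (k := s.2.2) (by omega))
  rw [zero_add] at h2
  rwa [Algebra.smul_def]

lemma totalDegree_form_le {ν D K : ℕ} (c : Fin D × Fin K × Fin K → F) :
    (form F ν D K c).totalDegree ≤ 24 * (K - 1) := by
  rw [form_apply]
  refine totalDegree_finsetSum_le fun s _ => ?_
  refine (totalDegree_smul_le _ _).trans ((totalDegree_mon_le _ _ _ _).trans ?_)
  omega

lemma form_injective {ν D K : ℕ} {c : Fin D × Fin K × Fin K → F} (h : form F ν D K c = 0) :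
    c = 0 := by
  classical
  funext s
  have h1 := congrArg (fun P => coeff (Finsupp.single 0 (3 * (s.1 : ℕ)) +
    Finsupp.single 1 (2 * (ν + s.2.1 - s.2.2 - s.1)))
      (coeff (Finsupp.single ((), false) (12 * (s.2.1 : ℕ)) +
        Finsupp.single ((), true) (12 * (s.2.2 : ℕ))) P)) h
  simp only [form_apply, coeff_sum, coeff_zero] at h1
  have h2 : ∀ s' : Fin D × Fin K × Fin K, coeff (Finsupp.single 0 (3 * (s.1 : ℕ)) +
    Finsupp.single 1 (2 * (ν + s.2.1 - s.2.2 - s.1)))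
      (coeff (Finsupp.single ((), false) (12 * (s.2.1 : ℕ)) +
        Finsupp.single ((), true) (12 * (s.2.2 : ℕ))) (c s' • mon F ν s'.1 s'.2.1 s'.2.2)) =
      if s' = s then c s' else 0 := by
    intro s'
    rw [Algebra.smul_def, show (algebraMap F (Jet F Unit)) (c s') = C (C (c s')) from rfl,
      coeff_C_mul, coeff_C_mul, coeff_coeff_mon]
    by_cases hs : s' = s
    · subst hs; simp
    · rw [if_neg, if_neg hs, mul_zero]
      rintro ⟨a, b, d⟩
      exact hs (Prod.ext (Fin.ext a) (Prod.ext (Fin.ext b) (Fin.ext d)))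
  simp only [h2] at h1
  simpa using h1

lemma natDegree_pull_form_le {h k : Polynomial F} {p : ℕ} (hh : h.natDegree ≤ p)
    (hk : k.natDegree ≤ p) {ν D K : ℕ} (hν : D ≤ ν) (c : Fin D × Fin K × Fin K → F) :
    (pull h k (form F ν D K c)).natDegree ≤ 3 * ν + 2 * K + 24 * K * p := by
  rw [form_apply, map_sum]
  refine Polynomial.natDegree_sum_le_of_forall_le _ _ fun s _ => ?_
  rw [Algebra.smul_def, map_mul]
  have : pull h k (algebraMap F (Jet F Unit) (c s)) = Polynomial.C (c s) := by
    change pull h k (C (C (c s))) = _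
    simp [pull]
  rw [this]
  refine (Polynomial.natDegree_C_mul_le _ _).trans
    ((natDegree_pull_mon_le hh hk _ _ _ _).trans ?_)
  have h1 : 12 * (s.2.1 : ℕ) * p ≤ 12 * K * p := by gcongr; omega
  have h2 : 12 * (s.2.2 : ℕ) * p ≤ 12 * K * p := by gcongr; omega
  have h3 := s.1.is_lt
  have h4 := s.2.1.is_lt
  have h5 : 24 * K * p = 12 * K * p + 12 * K * p := by ring
  omega

/-- The family of `n`-th derivatives of a combination of forms, specialized at `X = c`. -/
noncomputable def auxSpec (ν D K : ℕ) (t₀ c : F) (n : ℕ) (a : Fin K → Fin D × Fin K × Fin K → F) :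
    Polynomial (Polynomial F) :=
  ∑ l : Fin K, Polynomial.C ((Polynomial.X - Polynomial.C t₀) ^ (l : ℕ)) *
    spec c ((jetDer F Unit)^[n] (form F ν D K (a l)))

lemma auxSpec_add (ν D K : ℕ) (t₀ c : F) (n : ℕ) (a b : Fin K → Fin D × Fin K × Fin K → F) :
    auxSpec ν D K t₀ c n (a + b) = auxSpec ν D K t₀ c n a + auxSpec ν D K t₀ c n b := by
  simp only [auxSpec, Pi.add_apply, map_add, iterate_map_add, mul_add, Finset.sum_add_distrib]

lemma iterate_jetDer_smul (n : ℕ) (x : F) (P : Jet F Unit) :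
    (jetDer F Unit)^[n] (x • P) = x • (jetDer F Unit)^[n] P := by
  induction n with
  | zero => rfl
  | succ n ih => rw [Function.iterate_succ_apply', ih, Function.iterate_succ_apply',
      Derivation.map_smul]

lemma auxSpec_smul (ν D K : ℕ) (t₀ c : F) (n : ℕ) (x : F)
    (a : Fin K → Fin D × Fin K × Fin K → F) :
    auxSpec ν D K t₀ c n (x • a) = Polynomial.C (Polynomial.C x) * auxSpec ν D K t₀ c n a := by
  simp only [auxSpec, Pi.smul_apply, map_smul, iterate_jetDer_smul, spec_smul, Finset.mul_sum]
  exact Finset.sum_congr rfl fun l _ => by ring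

lemma auxSpec_coeff_eq_zero {ν D K : ℕ} {t₀ c : F} {n : ℕ} {a : Fin K → Fin D × Fin K × Fin K → F}
    {y : ℕ} (hK : 0 < K) (hy : 24 * K ≤ y) : (auxSpec ν D K t₀ c n a).coeff y = 0 := by
  rw [auxSpec, Polynomial.finsetSum_coeff]
  refine Finset.sum_eq_zero fun l _ => ?_
  rw [Polynomial.coeff_C_mul, spec_coeff_eq_zero, mul_zero]
  have := (totalDegree_iterate_le (form F ν D K (a l)) n).trans (totalDegree_form_le _)
  omega

lemma natDegree_auxSpec_coeff_le {ν D K E : ℕ} {t₀ c : F} {n : ℕ}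
    {a : Fin K → Fin D × Fin K × Fin K → F} (h : D + K ≤ ν) (hE : 12 * ν + 2 * n + 24 * K ≤ 4 * E)
    (y : ℕ) : ((auxSpec ν D K t₀ c n a).coeff y).natDegree ≤ K + E := by
  rw [auxSpec, Polynomial.finsetSum_coeff]
  refine Polynomial.natDegree_sum_le_of_forall_le _ _ fun l _ => ?_
  rw [Polynomial.coeff_C_mul]
  refine Polynomial.natDegree_mul_le_of_le ?_
    (natDegree_spec_coeff_le c ((form_iso h (a l)).iterate n) ?_ y)
  · rw [Polynomial.natDegree_pow, Polynomial.natDegree_X_sub_C]; omega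
  · have := (totalDegree_iterate_le (form F ν D K (a l)) n).trans (totalDegree_form_le _)
    push_cast
    omega

lemma exists_auxSpec_eq_zero {N : ℕ} (hN : 32 ≤ N) (t₀ c : F) :
    ∃ a : Fin (16 * N) → Fin (N ^ 2) × Fin (16 * N) × Fin (16 * N) → F, a ≠ 0 ∧
      ∀ n < N ^ 2, auxSpec (N ^ 2 + 16 * N) (N ^ 2) (16 * N) t₀ c n a = 0 := by
  set ν := N ^ 2 + 16 * N with hν
  set B := 4 * N ^ 2 + 160 * N + 1 with hB
  let φ : (Fin (16 * N) → Fin (N ^ 2) × Fin (16 * N) × Fin (16 * N) → F) →ₗ[F]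
      (Fin (N ^ 2) × Fin (384 * N) × Fin B → F) :=
    { toFun := fun a s => ((auxSpec ν (N ^ 2) (16 * N) t₀ c s.1 a).coeff s.2.1).coeff s.2.2
      map_add' := fun a b => by
        funext s
        simp only [auxSpec_add, Polynomial.coeff_add, Pi.add_apply]
      map_smul' := fun x a => by
        funext s
        simp only [auxSpec_smul, Polynomial.coeff_C_mul, Pi.smul_apply, RingHom.id_apply,
          smul_eq_mul] }
  have hker : LinearMap.ker φ ≠ ⊥ := by
    apply LinearMap.ker_ne_bot_of_finrank_lt
    simp only [Module.finrank_pi_fintype, Module.finrank_self, Fintype.card_prod, Fintype.card_fin,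
      Finset.sum_const, Finset.card_univ, smul_eq_mul, mul_one]
    have h2 : N ^ 2 * (384 * N * B) = N ^ 3 * (1536 * N ^ 2 + 61440 * N + 384) := by
      rw [hB]; ring
    have h3 : 16 * N * (N ^ 2 * (16 * N * (16 * N))) = N ^ 3 * (4096 * N ^ 2) := by ring
    rw [h2, h3]
    have : 0 < N ^ 3 := by positivity
    exact Nat.mul_lt_mul_of_pos_left (by nlinarith) this
  obtain ⟨a, ha, ha0⟩ := Submodule.exists_mem_ne_zero_of_ne_bot hker
  refine ⟨a, ha0, fun n hn => ?_⟩
  ext y b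
  rw [Polynomial.coeff_zero, Polynomial.coeff_zero]
  by_cases hy : y < 384 * N
  · by_cases hb : b < B
    · exact congrFun (LinearMap.mem_ker.mp ha) (⟨n, hn⟩, ⟨y, hy⟩, ⟨b, hb⟩)
    · refine Polynomial.coeff_eq_zero_of_natDegree_lt
        ((natDegree_auxSpec_coeff_le (E := 4 * N ^ 2 + 144 * N) (by omega) ?_ y).trans_lt
          (by omega))
      rw [hν]; omega
  · rw [auxSpec_coeff_eq_zero (by omega) (by omega), Polynomial.coeff_zero]

end HasseJet

namespace HasseJet

open MvPolynomial

variable {F : Type*} [Field F]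

/-- The auxiliary polynomial of Stepanov's method and its companions. -/
noncomputable def auxPoly (h k : Polynomial F) (p ν D K : ℕ) (t₀ : F) (n : ℕ)
    (a : Fin K → Fin D × Fin K × Fin K → F) : Polynomial F :=
  ∑ l : Fin K, (Polynomial.X ^ p - Polynomial.C t₀) ^ (l : ℕ) *
    pull h k ((jetDer F Unit)^[n] (form F ν D K (a l)))

lemma eval_auxPoly {h k : Polynomial F} {p ν D K : ℕ} {t₀ t c : F} {n : ℕ}
    {a : Fin K → Fin D × Fin K × Fin K → F} (ht : h.eval t = c) (htp : t ^ p = t) :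
    (auxPoly h k p ν D K t₀ n a).eval t =
      ((auxSpec ν D K t₀ c n a).eval (Polynomial.C (k.eval t))).eval t := by
  simp only [auxPoly, auxSpec, Polynomial.eval_finsetSum, Polynomial.eval_mul, Polynomial.eval_pow,
    Polynomial.eval_C, Polynomial.eval_sub, Polynomial.eval_X, eval_spec ht, htp]

lemma HasseSystem.derivative_auxPoly {p : ℕ} [CharP F p] {h k : Polynomial F}
    (hs : HasseSystem h k) {ν D K : ℕ} (hν : D + K ≤ ν) (t₀ : F) (n : ℕ)
    (a : Fin K → Fin D × Fin K × Fin K → F) :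
    12 * Polynomial.X * (Polynomial.X - 1) * Polynomial.derivative (auxPoly h k p ν D K t₀ n a) =
      (3 * Polynomial.X - 2) * (((12 * ν : ℕ) + 2 * n : ℤ) : Polynomial F) *
        auxPoly h k p ν D K t₀ n a + auxPoly h k p ν D K t₀ (n + 1) a := by
  simp only [auxPoly, Polynomial.derivative_sum, Finset.mul_sum, ← Finset.sum_add_distrib]
  refine Finset.sum_congr rfl fun l _ => ?_
  have h1 := hs.pull_jetDer ((form_iso hν (a l)).iterate n)
  have h2 : Polynomial.derivative ((Polynomial.X ^ p - Polynomial.C t₀) ^ (l : ℕ) : Polynomial F)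
      = 0 := by
    simp [Polynomial.derivative_pow]
  rw [Polynomial.derivative_mul, h2, Function.iterate_succ_apply']
  linear_combination (Polynomial.X ^ p - Polynomial.C t₀) ^ (l : ℕ) * h1

lemma pow_succ_dvd_of_derivative {p : ℕ} [CharP F p] {f : Polynomial F} {t : F} {j : ℕ}
    (hj : j < p) (h0 : f.eval t = 0) (h1 : (Polynomial.X - Polynomial.C t) ^ j ∣ f)
    (h2 : (Polynomial.X - Polynomial.C t) ^ j ∣ Polynomial.derivative f) :
    (Polynomial.X - Polynomial.C t) ^ (j + 1) ∣ f := by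
  obtain _ | j := j
  · rw [zero_add, pow_one]; exact Polynomial.dvd_iff_isRoot.mpr h0
  · obtain ⟨g, rfl⟩ := h1
    rw [pow_succ _ (j + 1)]
    refine mul_dvd_mul_left _ ?_
    rw [Polynomial.derivative_mul, (dvd_add_left (Dvd.intro _ rfl)),
      Polynomial.derivative_X_sub_C_pow, Nat.add_sub_cancel, pow_succ, mul_right_comm,
      mul_comm _ ((Polynomial.X - Polynomial.C t) ^ j),
      mul_dvd_mul_iff_left (pow_ne_zero _ (Polynomial.X_sub_C_ne_zero t)),
      Polynomial.dvd_iff_isRoot, Polynomial.IsRoot.def, Polynomial.eval_mul,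
      Polynomial.eval_C, mul_eq_zero] at h2
    rw [Polynomial.dvd_iff_isRoot]
    refine h2.resolve_left fun h => ?_
    rw [CharP.cast_eq_zero_iff F p] at h
    exact absurd (Nat.le_of_dvd j.succ_pos h) (by omega)

lemma HasseSystem.pow_dvd_auxPoly {p : ℕ} [CharP F p] (hp : 3 < p) (hpp : p.Prime)
    {h k : Polynomial F}
    (hs : HasseSystem h k) {ν D K : ℕ} (hν : D + K ≤ ν) {t₀ t c : F} {M : ℕ} (hM : M ≤ p)
    {a : Fin K → Fin D × Fin K × Fin K → F} (ha : ∀ n < M, auxSpec ν D K t₀ c n a = 0)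
    (ht : h.eval t = c) (htp : t ^ p = t) (ht0 : t ≠ 0) (ht1 : t ≠ 1) {j n : ℕ}
    (hj : n + j ≤ M) :
    (Polynomial.X - Polynomial.C t) ^ j ∣ auxPoly h k p ν D K t₀ n a := by
  induction j generalizing n with
  | zero => simp
  | succ j ih =>
    refine pow_succ_dvd_of_derivative (p := p) (by omega) ?_ (ih (by omega)) ?_
    · rw [eval_auxPoly ht htp, ha n (by omega)]; simp
    · have h1 : (Polynomial.X - Polynomial.C t) ^ j ∣ 12 * Polynomial.X * (Polynomial.X - 1) *
          Polynomial.derivative (auxPoly h k p ν D K t₀ n a) := by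
        rw [hs.derivative_auxPoly hν]
        exact dvd_add (Dvd.dvd.mul_left (ih (by omega)) _) (ih (by omega))
      refine IsCoprime.dvd_of_dvd_mul_left (IsCoprime.pow_left ?_) h1
      refine ((Polynomial.irreducible_X_sub_C t).coprime_iff_not_dvd).mpr fun h2 => ?_
      rw [Polynomial.dvd_iff_isRoot] at h2
      have h12 : (12 : F) ≠ 0 := by
        have : ((12 : ℕ) : F) ≠ 0 := by
          rw [Ne, CharP.cast_eq_zero_iff F p]
          intro hd
          rw [show 12 = 2 * (2 * 3) from rfl, hpp.dvd_mul, hpp.dvd_mul] at hd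
          rcases hd with hd | hd | hd <;> exact absurd (Nat.le_of_dvd (by omega) hd) (by omega)
        exact_mod_cast this
      have h3 : (12 : F) * t * (t - 1) = 0 := by
        simpa [Polynomial.IsRoot.def] using h2
      simp [h12, ht0, sub_eq_zero, ht1] at h3

lemma HasseSystem.auxPoly_ne_zero {p : ℕ} [Fact p.Prime] {h k : Polynomial (ZMod p)}
    (hs : HasseSystem h k) {ν D K : ℕ} (hν : D + K ≤ ν) {t₀ : ZMod p}
    (ht : h.eval t₀ ≠ 0) {a : Fin K → Fin D × Fin K × Fin K → ZMod p} (ha : a ≠ 0)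
    (hp : 4 * ((24 * (K - 1) + 1) ^ 2 *
      (12 * ν + (24 * (K - 1) + 1) ^ 2 + 24 * (K - 1)) + 1) ≤ p) :
    auxPoly h k p ν D K t₀ 0 a ≠ 0 := by
  classical
  intro h0
  obtain ⟨l, hl⟩ := Function.ne_iff.mp ha
  have hex : ∃ l : ℕ, ∃ hl : l < K, a ⟨l, hl⟩ ≠ 0 := ⟨l, l.is_lt, hl⟩
  obtain ⟨hm, hma⟩ := Nat.find_spec hex
  have hmin := fun j => @Nat.find_min _ _ hex j
  set m := Nat.find hex
  have hfe : (Polynomial.X ^ p - Polynomial.C t₀ : Polynomial (ZMod p)) =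
      (Polynomial.X - Polynomial.C t₀) ^ p := by
    rw [sub_pow_char, ← Polynomial.C_pow, ZMod.pow_card]
  set Z := (Polynomial.X ^ p - Polynomial.C t₀ : Polynomial (ZMod p)) with hZ
  have hZ0 : Z ≠ 0 := by
    rw [hfe]; exact pow_ne_zero _ (Polynomial.X_sub_C_ne_zero _)
  have h1 : Z ^ (m + 1) ∣ Z ^ m * pull h k (form (ZMod p) ν D K (a ⟨m, hm⟩)) := by
    rw [auxPoly, ← Finset.add_sum_erase _ _ (Finset.mem_univ (⟨m, hm⟩ : Fin K))] at h0
    rw [← hZ] at h0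
    rw [Function.iterate_zero, id] at h0
    simp only [id] at h0
    rw [eq_neg_of_add_eq_zero_left h0, dvd_neg]
    refine Finset.dvd_sum fun l hl => ?_
    rw [Finset.mem_erase] at hl
    by_cases hlm : (l : ℕ) < m
    · have : a l = 0 := by
        by_contra hne
        exact hmin l hlm ⟨l.is_lt, hne⟩
      rw [this, map_zero, map_zero, mul_zero]
      exact dvd_zero _
    · refine Dvd.dvd.mul_right (pow_dvd_pow _ ?_) _
      have : (l : ℕ) ≠ m := fun h => hl.1 (Fin.ext h)
      omega
  rw [pow_succ, mul_dvd_mul_iff_left (pow_ne_zero _ hZ0), hfe] at h1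
  exact hs.not_pow_dvd_pull (form_iso hν _) (totalDegree_form_le _)
    (fun h => hma (form_injective h)) hp ht h1

theorem HasseSystem.card_mul_le {p : ℕ} [Fact p.Prime] {h k : Polynomial (ZMod p)}
    (hs : HasseSystem h k) (hh : h.natDegree ≤ p) (hk : k.natDegree ≤ p) {c : ZMod p}
    (hc : c ≠ 0) {N : ℕ} (hN : 32 ≤ N) (hp : 10 ^ 11 * N ^ 4 ≤ p) :
    (Finset.univ.filter fun t => t ≠ 0 ∧ t ≠ 1 ∧ h.eval t = c).card * N ≤ 483 * p := by
  classical
  set S := Finset.univ.filter fun t => t ≠ 0 ∧ t ≠ 1 ∧ h.eval t = c with hS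
  obtain hemp | ⟨t₀, ht₀⟩ := S.eq_empty_or_nonempty
  · rw [hemp]; simp
  have ht₀c : h.eval t₀ = c := (Finset.mem_filter.mp ht₀).2.2.2
  obtain ⟨a, ha, hz⟩ := exists_auxSpec_eq_zero hN t₀ c
  have hNN : 32 * N ≤ N ^ 2 := by nlinarith
  have hNp : N ^ 2 ≤ p := by
    have : N ^ 2 ≤ N ^ 4 := Nat.pow_le_pow_right (by omega) (by omega)
    omega
  have hne := hs.auxPoly_ne_zero (D := N ^ 2) (K := 16 * N) (ν := N ^ 2 + 16 * N) le_rfl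
    (t₀ := t₀) (by rwa [ht₀c]) ha (by
      have e1 : 24 * (16 * N - 1) ≤ 384 * N := by omega
      have e2 : 24 * (16 * N - 1) + 1 ≤ 384 * N := by omega
      refine le_trans ?_ hp
      have e3 : (24 * (16 * N - 1) + 1) ^ 2 ≤ 147456 * N ^ 2 :=
        (Nat.pow_le_pow_left e2 2).trans (by ring_nf; rfl)
      have e4 : 12 * (N ^ 2 + 16 * N) + (24 * (16 * N - 1) + 1) ^ 2 + 24 * (16 * N - 1) ≤
          147490 * N ^ 2 := by omega
      have e5 := Nat.mul_le_mul e3 e4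
      have e6 : 147456 * N ^ 2 * (147490 * N ^ 2) = 21748285440 * N ^ 4 := by ring
      have e7 : 1 ≤ N ^ 4 := Nat.one_le_pow _ _ (by omega)
      omega)
  have hdvd : (∏ t ∈ S, (Polynomial.X - Polynomial.C t) ^ N ^ 2) ∣
      auxPoly h k p (N ^ 2 + 16 * N) (N ^ 2) (16 * N) t₀ 0 a := by
    refine Finset.prod_dvd_of_coprime (fun x _ y _ hxy => ?_) fun t ht => ?_
    · exact IsCoprime.pow (Polynomial.isCoprime_X_sub_C_of_isUnit_sub
        (sub_ne_zero.mpr hxy).isUnit)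
    · obtain ⟨-, h1, h2, h3⟩ := Finset.mem_filter.mp ht
      exact hs.pow_dvd_auxPoly (by nlinarith) Fact.out le_rfl hNp hz h3 (ZMod.pow_card t) h1 h2
        (by omega)
  have hdeg := Polynomial.natDegree_le_of_dvd hdvd hne
  rw [Finset.prod_pow, Polynomial.natDegree_pow, Polynomial.natDegree_prod_of_monic _ _
    fun t _ => Polynomial.monic_X_sub_C t] at hdeg
  simp only [Polynomial.natDegree_X_sub_C, Finset.sum_const, smul_eq_mul, mul_one] at hdeg
  have hup : (auxPoly h k p (N ^ 2 + 16 * N) (N ^ 2) (16 * N) t₀ 0 a).natDegree ≤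
      16 * N * p + (3 * (N ^ 2 + 16 * N) + 2 * (16 * N) + 24 * (16 * N) * p) := by
    refine Polynomial.natDegree_sum_le_of_forall_le _ _ fun l _ => ?_
    refine Polynomial.natDegree_mul_le_of_le ?_ (natDegree_pull_form_le hh hk (by omega) _)
    refine (Polynomial.natDegree_pow_le).trans ?_
    rw [Polynomial.natDegree_X_pow_sub_C]
    exact Nat.mul_le_mul_right _ l.is_lt.le
  have hfin := hdeg.trans hup
  have e1 : N * N ≤ N * p := Nat.mul_le_mul_left _ (by nlinarith)
  have e2 : N * 1 ≤ N * p := Nat.mul_le_mul_left _ (by nlinarith)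
  have : N * (S.card * N) ≤ N * (483 * p) := by nlinarith
  exact Nat.le_of_mul_le_mul_left this (by omega)

theorem HasseSystem.card_pow_four_le {p : ℕ} [Fact p.Prime] {h k : Polynomial (ZMod p)}
    (hs : HasseSystem h k) (hh : h.natDegree ≤ p) (hk : k.natDegree ≤ p) {c : ZMod p}
    (hc : c ≠ 0) :
    (Finset.univ.filter fun t => t ≠ 0 ∧ t ≠ 1 ∧ h.eval t = c).card ^ 4 ≤ 10 ^ 24 * p ^ 3 := by
  classical
  set s := (Finset.univ.filter fun t => t ≠ 0 ∧ t ≠ 1 ∧ h.eval t = c).card with hcard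
  have hsp : s ≤ p := by
    refine (Finset.card_le_univ _).trans ?_
    rw [ZMod.card]
  have hex : ∃ n : ℕ, p < 10 ^ 11 * (n + 1) ^ 4 :=
    ⟨p, by nlinarith [Nat.le_self_pow (show 4 ≠ 0 by omega) (p + 1)]⟩
  set N := Nat.find hex with hN
  have h1 : p < 10 ^ 11 * (N + 1) ^ 4 := Nat.find_spec hex
  by_cases h32 : 32 ≤ N
  · have h2 : 10 ^ 11 * N ^ 4 ≤ p := by
      have := Nat.find_min hex (m := N - 1) (by omega)
      rw [Nat.sub_add_cancel (by omega)] at this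
      exact not_lt.mp this
    have h3 : s * N ≤ 483 * p := hs.card_mul_le hh hk hc h32 h2
    have h4 : p ≤ 16 * 10 ^ 11 * N ^ 4 := by
      have : (N + 1) ^ 4 ≤ (2 * N) ^ 4 := Nat.pow_le_pow_left (by omega) 4
      nlinarith
    have h5 : s ^ 4 * N ^ 4 ≤ 483 ^ 4 * p ^ 4 := by
      rw [← mul_pow, ← mul_pow]; exact Nat.pow_le_pow_left h3 4
    have h6 : s ^ 4 * N ^ 4 ≤ (10 ^ 24 * p ^ 3) * N ^ 4 := by
      calc s ^ 4 * N ^ 4 ≤ 483 ^ 4 * p ^ 4 := h5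
        _ = 483 ^ 4 * p ^ 3 * p := by ring
        _ ≤ 483 ^ 4 * p ^ 3 * (16 * 10 ^ 11 * N ^ 4) := Nat.mul_le_mul_left _ h4
        _ = (483 ^ 4 * 16 * 10 ^ 11) * (p ^ 3 * N ^ 4) := by ring
        _ ≤ 10 ^ 24 * (p ^ 3 * N ^ 4) := Nat.mul_le_mul_right _ (by norm_num)
        _ = _ := by ring
    exact Nat.le_of_mul_le_mul_right h6 (by positivity)
  · have h2 : p ≤ 10 ^ 18 := by
      have : (N + 1) ^ 4 ≤ 32 ^ 4 := Nat.pow_le_pow_left (by omega) 4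
      omega
    calc s ^ 4 ≤ p ^ 4 := Nat.pow_le_pow_left hsp 4
      _ = p * p ^ 3 := by ring
      _ ≤ 10 ^ 24 * p ^ 3 := Nat.mul_le_mul_right _ (by omega)

end HasseJet

namespace HasseJet

open Polynomial

variable {F : Type*} [Field F]

/-- The derivation of `F[t][x]` acting as `d/dt` on coefficients. -/
noncomputable def coeffDer (F : Type*) [Field F] : Derivation F F[X][X] F[X][X] :=
  (((PolynomialModule.equivPolynomialSelf (R := F[X])).toLinearMap).compDer
    (derivative' (R := F)).mapCoeffs)

lemma coeff_coeffDer (G : F[X][X]) (i : ℕ) : (coeffDer F G).coeff i = derivative (G.coeff i) := rfl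

lemma coeffDer_C (g : F[X]) : coeffDer F (C g) = C (derivative g) := by
  ext1 i
  rw [coeff_coeffDer, coeff_C, coeff_C]
  split_ifs <;> simp

lemma coeffDer_X : coeffDer F X = 0 := by
  ext1 i
  rw [coeff_coeffDer, coeff_X]
  split_ifs <;> simp

/-- The generic cubic `x³ - 3 t x + 2 t`. -/
noncomputable def cubic (F : Type*) [Field F] : F[X][X] := X ^ 3 - 3 * C X * X + 2 * C X

lemma coeffDer_cubic : coeffDer F (cubic F) = -3 * X + 2 := by
  have h3 : coeffDer F 3 = 0 := by
    have := (coeffDer F).map_natCast 3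
    exact_mod_cast this
  have h2 : coeffDer F 2 = 0 := by
    have := (coeffDer F).map_natCast 2
    exact_mod_cast this
  simp [cubic, coeffDer_C, coeffDer_X, Derivation.leibniz_pow, h3, h2]
  ring

lemma derivative_cubic : derivative (cubic F) = 3 * X ^ 2 - 3 * C X := by
  simp [cubic]
  norm_num [C_ofNat]

/-- The differential identity behind the first-order system. -/
lemma coeffDer_cubic_pow (m : ℕ) (hm : (2 * m + 1 : F) = 0) :
    12 * C X * (C X - 1) * coeffDer F (cubic F ^ m) =
      (3 * C X - 2) * (-3 * cubic F ^ m - 2 * X * derivative (cubic F ^ m)) -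
        3 * X * cubic F ^ m + (4 * C X - 2 * X ^ 2) * derivative (cubic F ^ m) := by
  obtain _ | m := m
  · simp at hm
  have hm' : (2 * (m + 1 : F[X][X]) + 1) = 0 := by
    have := congrArg (fun x => (C (C x) : F[X][X])) hm
    simpa [C_ofNat] using this
  have h6 : ((m + 1 : ℕ) : F[X][X]) * 6 = -3 := by
    push_cast; linear_combination 3 * hm'
  rw [Derivation.leibniz_pow, derivative_pow, coeffDer_cubic, derivative_cubic]
  simp only [Nat.add_sub_cancel, nsmul_eq_mul, smul_eq_mul, C_eq_natCast]
  rw [pow_succ (cubic F) m]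
  have hc : cubic F = X ^ 3 - 3 * C X * X + 2 * C X := rfl
  generalize hP : cubic F ^ m = P
  rw [hc]
  linear_combination ((3 * C X - 2 + X) * P * (X ^ 3 - 3 * C X * X + 2 * C X)) * h6

/-- The coefficient functional `G ↦ [x^{p-1}] G` kills derivatives. -/
lemma coeff_derivative_eq_zero {p : ℕ} [CharP F p] (hp : 0 < p) (G : F[X][X]) :
    (derivative G).coeff (p - 1) = 0 := by
  rw [coeff_derivative, Nat.cast_sub hp]
  simp [CharP.cast_eq_zero]

/-- The Hasse polynomial `[x^{p-1}] (x³ - 3 t x + 2 t)^{(p-1)/2}`. -/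
noncomputable def hasse (F : Type*) [Field F] (p : ℕ) : F[X] :=
  (cubic F ^ ((p - 1) / 2)).coeff (p - 1)

/-- The companion of the Hasse polynomial. -/
noncomputable def hasse' (F : Type*) [Field F] (p : ℕ) : F[X] :=
  (X * cubic F ^ ((p - 1) / 2)).coeff (p - 1)

lemma hasseSystem {p : ℕ} [CharP F p] (hp : 3 < p) (hodd : p % 2 = 1) :
    HasseSystem (hasse F p) (hasse' F p) := by
  set m := (p - 1) / 2 with hm
  have hpm : p = 2 * m + 1 := by omega
  have h2m : (2 * m + 1 : F) = 0 := by
    have := CharP.cast_eq_zero F p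
    rw [hpm] at this
    exact_mod_cast this
  have h3 : (3 : F) ≠ 0 := by
    have : ((3 : ℕ) : F) ≠ 0 := by
      rw [Ne, CharP.cast_eq_zero_iff F p]
      exact fun hd => absurd (Nat.le_of_dvd (by omega) hd) (by omega)
    exact_mod_cast this
  let Λ : F[X][X] →ₗ[F[X]] F[X] := lcoeff F[X] (p - 1)
  have hΛ : ∀ G, Λ (derivative G) = 0 := fun G => coeff_derivative_eq_zero (by omega) G
  set G := cubic F ^ m with hG
  have hh : hasse F p = Λ G := rfl
  have hk : hasse' F p = Λ (X * G) := rfl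
  have hC : ∀ (g : F[X]) (P : F[X][X]), Λ (C g * P) = g * Λ P := fun g P => by
    rw [← smul_eq_C_mul, map_smul, smul_eq_mul]
  have e1 : Λ (X * derivative G) = -Λ G := by
    have := hΛ (X * G)
    rw [derivative_mul, derivative_X, one_mul, map_add] at this
    linear_combination this
  have e2 : Λ (X ^ 2 * derivative G) = -2 * Λ (X * G) := by
    have := hΛ (X ^ 2 * G)
    rw [derivative_mul, derivative_X_pow, map_add, mul_assoc, hC] at this
    simp at this
    linear_combination this
  have e3 : Λ (X ^ 3 * derivative G) = -3 * Λ (X ^ 2 * G) := by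
    have := hΛ (X ^ 3 * G)
    rw [derivative_mul, derivative_X_pow, map_add, mul_assoc, hC] at this
    simp at this
    linear_combination this
  have e4 : Λ (X ^ 2 * G) = X * Λ G := by
    have := hΛ (cubic F ^ (m + 1))
    rw [derivative_pow, derivative_cubic, Nat.add_sub_cancel, mul_assoc, hC, ← hG] at this
    have hexp : G * (3 * X ^ 2 - 3 * C X) = C 3 * (X ^ 2 * G) - C (3 * X) * G := by
      simp [C_ofNat]; ring
    rw [hexp, map_sub, hC, hC] at this
    have h2m' : (2 * m + 1 : F[X]) = 0 := by
      have := congrArg (C : F → F[X]) h2m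
      simpa [C_ofNat] using this
    have h3' : (3 : F[X]) ≠ 0 := by
      rw [← map_ofNat (C : F →+* F[X]) 3]; exact C_ne_zero.mpr h3
    refine mul_left_cancel₀ h3' ?_
    push_cast at this
    linear_combination 2 * this - (3 * Λ (X ^ 2 * G) - 3 * X * Λ G) * h2m'
  have hode := coeffDer_cubic_pow m h2m
  rw [← hG] at hode
  have hD : ∀ P, Λ (coeffDer F P) = derivative (Λ P) := fun P => coeff_coeffDer P _
  have hT : ∀ P, Λ (12 * C X * (C X - 1) * P) = 12 * X * (X - 1) * Λ P := fun P => by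
    rw [show (12 * C X * (C X - 1) : F[X][X]) = C (12 * X * (X - 1)) by simp [C_ofNat], hC]
  have hXD : coeffDer F (X * G) = X * coeffDer F G := by
    rw [Derivation.leibniz, coeffDer_X]; simp
  constructor
  · rw [hh, hk, ← hD, ← hT, hode]
    have : (3 * C X - 2) * (-3 * G - 2 * X * derivative G) - 3 * X * G +
        (4 * C X - 2 * X ^ 2) * derivative G = C (-3 * (3 * X - 2)) * G +
        C (-2 * (3 * X - 2)) * (X * derivative G) + C (-3) * (X * G) +
        C (4 * X) * derivative G + C (-2) * (X ^ 2 * derivative G) := by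
      simp [C_ofNat]; ring
    rw [this]
    simp only [map_add, hC, e1, e2, hΛ]
    ring
  · rw [hh, hk, ← hD, ← hT, hXD]
    have : 12 * C X * (C X - 1) * (X * coeffDer F G) =
        C (-3 * (3 * X - 2)) * (X * G) +
        C (-2 * (3 * X - 2)) * (X ^ 2 * derivative G) + C (-3) * (X ^ 2 * G) +
        C (4 * X) * (X * derivative G) + C (-2) * (X ^ 3 * derivative G) := by
      simp [C_ofNat]; linear_combination X * hode
    rw [this]
    simp only [map_add, hC, e1, e2, e3, e4]
    ring

lemma natDegree_coeff_cubic_pow_le (m i : ℕ) : ((cubic F ^ m).coeff i).natDegree ≤ m := by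
  induction m generalizing i with
  | zero =>
    rw [pow_zero, coeff_one]
    split_ifs <;> simp
  | succ m ih =>
    rw [pow_succ, coeff_mul]
    refine natDegree_sum_le_of_forall_le _ _ fun x _ => natDegree_mul_le_of_le (ih _) ?_
    have : cubic F = X ^ 3 + C (-3 * X) * X + C (2 * X) := by
      simp [cubic, C_ofNat]; ring
    rw [this, coeff_add, coeff_add, coeff_X_pow, coeff_C_mul, coeff_X, coeff_C]
    refine (natDegree_add_le_of_degree_le (natDegree_add_le_of_degree_le (n := 1) ?_ ?_) ?_)
    · split_ifs <;> simp
    · split_ifs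
      · rw [mul_one]; compute_degree
      · simp
    · split_ifs
      · compute_degree
      · simp

lemma natDegree_hasse_le (p : ℕ) : (hasse F p).natDegree ≤ p :=
  (natDegree_coeff_cubic_pow_le _ _).trans (by omega)

lemma natDegree_hasse'_le (p : ℕ) : (hasse' F p).natDegree ≤ p := by
  rw [hasse']
  obtain h | ⟨j, h⟩ : p - 1 = 0 ∨ ∃ j, p - 1 = j + 1 :=
    (p - 1).eq_zero_or_eq_succ_pred.imp id fun h => ⟨_, h⟩
  · rw [h]; simp
  · conv_lhs => rw [h, coeff_X_mul]
    exact (natDegree_coeff_cubic_pow_le _ _).trans (by omega)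

/-- `∑ g(x) = -[x^{p-1}] g` for polynomials of degree less than `2(p-1)`. -/
lemma sum_eval_eq_neg_coeff {p : ℕ} [Fact p.Prime] (g : (ZMod p)[X])
    (hg : g.natDegree < 2 * (p - 1)) : ∑ x, g.eval x = -g.coeff (p - 1) := by
  have hp := (Fact.out : p.Prime).two_le
  simp only [eval_eq_sum_range' hg]
  rw [Finset.sum_comm]
  simp only [← Finset.mul_sum]
  rw [Finset.sum_eq_single (p - 1)]
  · have h1 : ∑ x : ZMod p, x ^ (p - 1) = -1 := by
      have : ∀ x : ZMod p, x ^ (p - 1) = 1 - if x = 0 then 1 else 0 := fun x => by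
        split_ifs with h
        · rw [h, zero_pow (by omega)]; simp
        · rw [ZMod.pow_card_sub_one_eq_one h]; simp
      simp only [this, Finset.sum_sub_distrib]
      simp
    rw [h1, mul_neg_one]
  · intro i hi hne
    rw [Finset.mem_range] at hi
    obtain h | h := lt_or_gt_of_ne hne
    · rw [FiniteField.sum_pow_lt_card_sub_one, mul_zero]
      rwa [ZMod.card]
    · have : ∀ x : ZMod p, x ^ i = x ^ (i - (p - 1)) := fun x => by
        by_cases hx : x = 0
        · rw [hx, zero_pow (by omega), zero_pow (by omega)]
        · conv_lhs => rw [← Nat.sub_add_cancel h.le, pow_add, ZMod.pow_card_sub_one_eq_one hx,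
            mul_one]
      simp only [this]
      rw [FiniteField.sum_pow_lt_card_sub_one, mul_zero]
      rw [ZMod.card]; omega
  · intro h
    exact absurd (Finset.mem_range.mpr (by omega)) h

lemma eval_hasse {p : ℕ} [Fact p.Prime] (hp : 3 < p) (t : ZMod p) :
    (hasse (ZMod p) p).eval t = -∑ x, (x ^ 3 - 3 * t * x + 2 * t) ^ ((p - 1) / 2) := by
  have h1 : (hasse (ZMod p) p).eval t =
      ((X ^ 3 - C (3 * t) * X + C (2 * t) : (ZMod p)[X]) ^ ((p - 1) / 2)).coeff (p - 1) := by
    rw [hasse, ← coe_evalRingHom, ← coeff_map, Polynomial.map_pow]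
    congr 2
    simp [cubic, C_ofNat]
  have h2 := sum_eval_eq_neg_coeff
    ((X ^ 3 - C (3 * t) * X + C (2 * t) : (ZMod p)[X]) ^ ((p - 1) / 2)) (by
      have h3 : (X ^ 3 - C (3 * t) * X + C (2 * t) : (ZMod p)[X]).natDegree ≤ 3 := by
        compute_degree
      have := natDegree_pow_le_of_le ((p - 1) / 2) h3
      omega)
  rw [h1, ← neg_neg (coeff _ _), ← h2]
  simp

end HasseJet

namespace HasseJet

open Polynomial

lemma card_sqrt {p : ℕ} [Fact p.Prime] (hp : 2 < p) (r : ZMod p) :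
    (((Finset.univ.filter fun y : ZMod p => y ^ 2 = r).card : ℕ) : ZMod p) =
      1 + r ^ ((p - 1) / 2) := by
  have hchar : ringChar (ZMod p) ≠ 2 := by rw [ZMod.ringChar_zmod_n]; omega
  have h1 := quadraticChar_card_sqrts hchar r
  have h2 := quadraticChar_eq_pow_of_char_ne_two' hchar r
  rw [ZMod.card] at h2
  have h3 : (p - 1) / 2 = p / 2 := by
    have := (Fact.out : p.Prime).eq_two_or_odd
    omega
  have h4 : {x : ZMod p | x ^ 2 = r}.toFinset = Finset.univ.filter fun y : ZMod p => y ^ 2 = r := by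
    ext y; simp
  rw [h4] at h1
  have h5 := congrArg (Int.cast : ℤ → ZMod p) h1
  push_cast at h5
  rw [h5, h2, h3, add_comm]

lemma affinePoints_eq {p : ℕ} [Fact p.Prime] (u v : ZMod p) :
    affinePoints p u v = ∑ x : ZMod p,
      (Finset.univ.filter fun y : ZMod p => y ^ 2 = x ^ 3 + u * x + v).card := by
  have hinj : ∀ b b' : ℕ, b < p → b' < p → (b : ZMod p) = b' → b = b' := fun b b' hb hb' h => by
    rw [ZMod.natCast_eq_natCast_iff] at h
    exact Nat.ModEq.eq_of_lt_of_lt h hb hb'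
  rw [← Finset.card_sigma, affinePoints]
  refine Finset.card_bij (fun xy _ => ⟨(xy.1 : ZMod p), (xy.2 : ZMod p)⟩) ?_ ?_ ?_
  · intro xy h
    simp only [Finset.mem_filter] at h
    simpa using h.2
  · rintro ⟨x, y⟩ h ⟨x', y'⟩ h' he
    simp only [Finset.mem_filter, Finset.mem_product, Finset.mem_range] at h h'
    simp only [Sigma.mk.injEq, heq_eq_eq] at he
    exact Prod.ext (hinj _ _ h.1.1 h'.1.1 he.1) (hinj _ _ h.1.2 h'.1.2 he.2)
  · rintro ⟨x, y⟩ h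
    simp only [Finset.mem_sigma, Finset.mem_univ, Finset.mem_filter, true_and] at h
    refine ⟨(x.val, y.val), ?_, ?_⟩
    · simp only [Finset.mem_filter, Finset.mem_product, Finset.mem_range, ZMod.natCast_zmod_val]
      exact ⟨⟨ZMod.val_lt x, ZMod.val_lt y⟩, h⟩
    · simp

lemma trace_eq_neg_sum {p : ℕ} [Fact p.Prime] (hp : 2 < p) (u v : ZMod p) :
    (((p : ℤ) - affinePoints p u v : ℤ) : ZMod p) =
      -∑ x, (x ^ 3 + u * x + v) ^ ((p - 1) / 2) := by
  push_cast
  rw [affinePoints_eq]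
  push_cast
  simp only [card_sqrt hp, Finset.sum_add_distrib]
  simp

lemma natCast_ne_zero_of_prime_lt {p : ℕ} [Fact p.Prime] {n : ℕ} (hn : 0 < n) (h : n < p) :
    (n : ZMod p) ≠ 0 := by
  rw [Ne, ZMod.natCast_eq_zero_iff]
  exact fun hd => absurd (Nat.le_of_dvd hn hd) (by omega)

lemma trace_eq_hasse {p : ℕ} [Fact p.Prime] (hp : 3 < p) {u v : ZMod p} (hu : u ≠ 0) (hv : v ≠ 0)
    {t : ZMod p} (ht : t * (27 * v ^ 2) = -4 * u ^ 3) :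
    (((p : ℤ) - affinePoints p u v : ℤ) : ZMod p) = (hasse (ZMod p) p).eval t ∨
      (((p : ℤ) - affinePoints p u v : ℤ) : ZMod p) = -(hasse (ZMod p) p).eval t := by
  have h2 : (2 : ZMod p) ≠ 0 := by
    exact_mod_cast natCast_ne_zero_of_prime_lt (p := p) (n := 2) (by omega) (by omega)
  have h3 : (3 : ZMod p) ≠ 0 := by
    exact_mod_cast natCast_ne_zero_of_prime_lt (p := p) (n := 3) (by omega) (by omega)
  set s := -(3 * v) / (2 * u) with hs
  have hs0 : s ≠ 0 := by
    rw [hs]; exact div_ne_zero (neg_ne_zero.mpr (mul_ne_zero h3 hv)) (mul_ne_zero h2 hu)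
  have hsu : s * (2 * u) = -(3 * v) := div_mul_cancel₀ _ (mul_ne_zero h2 hu)
  clear_value s
  have e1 : u = -3 * t * s ^ 2 := by
    have : (4 * u ^ 2 * 3) * u = (4 * u ^ 2 * 3) * (-3 * t * s ^ 2) := by
      linear_combination 3 * ht + 9 * t * (s * (2 * u) - 3 * v) * hsu
    exact mul_left_cancel₀ (mul_ne_zero (mul_ne_zero (by
      rw [show (4 : ZMod p) = 2 * 2 by norm_num]; exact mul_ne_zero h2 h2) (pow_ne_zero _ hu)) h3)
      this
  have e2 : v = 2 * t * s ^ 3 := by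
    refine mul_left_cancel₀ h3 ?_
    linear_combination hsu - 2 * s * e1
  have hsum : ∑ x, (x ^ 3 + u * x + v) ^ ((p - 1) / 2) = (s ^ ((p - 1) / 2)) ^ 3 *
      ∑ x, (x ^ 3 - 3 * t * x + 2 * t) ^ ((p - 1) / 2) := by
    rw [Finset.mul_sum, ← Equiv.sum_comp (Equiv.mulLeft₀ s hs0)]
    refine Finset.sum_congr rfl fun x _ => ?_
    rw [← pow_mul, mul_comm _ 3, pow_mul, ← mul_pow]
    congr 1
    rw [Equiv.mulLeft₀_apply]
    linear_combination s * x * e1 + e2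
  have hε : s ^ ((p - 1) / 2) = 1 ∨ s ^ ((p - 1) / 2) = -1 := by
    have hodd := (Fact.out : p.Prime).eq_two_or_odd
    rw [show (p - 1) / 2 = p / 2 by omega]
    exact ZMod.pow_div_two_eq_neg_one_or_one p hs0
  rw [trace_eq_neg_sum (by omega), hsum, eval_hasse hp]
  rcases hε with h | h <;> rw [h]
  · left; ring
  · right; ring

end HasseJet

namespace HasseJet

open Polynomial

/-- Evaluation modulo `p` of an integer polynomial. -/
noncomputable def evalMod (p : ℕ) (A : ℤ[X]) (ρ : ZMod p) : ZMod p := A.eval₂ (Int.castRingHom (ZMod p)) ρ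

lemma evalMod_eq {p : ℕ} (A : ℤ[X]) (ρ : ZMod p) :
    evalMod p A ρ = (A.map (Int.castRingHom (ZMod p))).eval ρ := by
  rw [evalMod, eval_map]

lemma card_evalMod_eq_zero_le {p : ℕ} [Fact p.Prime] {A : ℤ[X]} {i : ℕ}
    (hA : ¬ (p : ℤ) ∣ A.coeff i) :
    (Finset.univ.filter fun ρ : ZMod p => evalMod p A ρ = 0).card ≤ A.natDegree := by
  have h0 : A.map (Int.castRingHom (ZMod p)) ≠ 0 := fun h => hA <| by
    have := congrArg (fun P => P.coeff i) h
    simpa [ZMod.intCast_zmod_eq_zero_iff_dvd] using this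
  refine le_trans (Finset.card_le_card (t := (A.map (Int.castRingHom (ZMod p))).roots.toFinset) ?_)
    ((Multiset.toFinset_card_le _).trans ((card_roots' _).trans natDegree_map_le))
  intro ρ hρ
  rw [Finset.mem_filter, evalMod_eq] at hρ
  rw [Multiset.mem_toFinset, mem_roots h0]
  exact hρ.2

/-- The `(i, j)` minor of the coefficients of `A³` and `B²`. -/
noncomputable def minor (A B : ℤ[X]) (i j : ℕ) : ℤ :=
  (A ^ 3).coeff i * (B ^ 2).coeff j - (A ^ 3).coeff j * (B ^ 2).coeff i

lemma card_fiber_le {p : ℕ} [Fact p.Prime] (hp : 3 < p) {A B : ℤ[X]} {i j : ℕ}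
    (hD : ¬ (p : ℤ) ∣ minor A B i j) (t : ZMod p) :
    (Finset.univ.filter fun ρ : ZMod p =>
      t * (27 * evalMod p B ρ ^ 2) = -4 * evalMod p A ρ ^ 3).card ≤
        3 * A.natDegree + 2 * B.natDegree := by
  set φ := Int.castRingHom (ZMod p)
  set P : (ZMod p)[X] := C (t * 27) * (B ^ 2).map φ + C 4 * (A ^ 3).map φ with hP
  have h0 : P ≠ 0 := fun h => hD <| by
    have hc : ∀ n, t * 27 * (((B ^ 2).coeff n : ℤ) : ZMod p) +
        4 * (((A ^ 3).coeff n : ℤ) : ZMod p) = 0 := fun n => by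
      have := congrArg (fun P => P.coeff n) h
      simpa only [hP, coeff_add, coeff_C_mul, coeff_map, coeff_zero, φ, eq_intCast] using this
    have h2 : (2 : ZMod p) ≠ 0 := by
      exact_mod_cast natCast_ne_zero_of_prime_lt (p := p) (n := 2) (by omega) (by omega)
    have h4 : (4 : ZMod p) ≠ 0 := by
      rw [show (4 : ZMod p) = 2 * 2 by norm_num]; exact mul_ne_zero h2 h2
    rw [← ZMod.intCast_zmod_eq_zero_iff_dvd, minor]
    push_cast
    refine mul_left_cancel₀ h4 ?_
    linear_combination (((B ^ 2).coeff j : ℤ) : ZMod p) * hc i -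
      (((B ^ 2).coeff i : ℤ) : ZMod p) * hc j
  have hdeg : P.natDegree ≤ 3 * A.natDegree + 2 * B.natDegree := by
    refine natDegree_add_le_of_degree_le ?_ ?_
    · refine (natDegree_C_mul_le _ _).trans (natDegree_map_le.trans (natDegree_pow_le.trans ?_))
      omega
    · refine (natDegree_C_mul_le _ _).trans (natDegree_map_le.trans (natDegree_pow_le.trans ?_))
      omega
  refine le_trans (Finset.card_le_card (t := P.roots.toFinset) ?_)
    ((Multiset.toFinset_card_le _).trans ((card_roots' _).trans hdeg))
  intro ρ hρ
  rw [Finset.mem_filter, evalMod_eq, evalMod_eq] at hρ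
  rw [Multiset.mem_toFinset, mem_roots h0, IsRoot.def]
  simp only [hP, eval_add, eval_mul, eval_C, Polynomial.map_pow, eval_pow]
  linear_combination hρ.2

/-- Residues `ρ` modulo `p` for which the reduced curve is nonsingular with trace `a` mod `p`. -/
noncomputable def traceResidues (A B : ℤ[X]) (a : ℤ) (p : ℕ) [NeZero p] : Finset (ZMod p) := by
  classical
  exact Finset.univ.filter fun ρ => 4 * evalMod p A ρ ^ 3 + 27 * evalMod p B ρ ^ 2 ≠ 0 ∧
    (((p : ℤ) - affinePoints p (evalMod p A ρ) (evalMod p B ρ) : ℤ) : ZMod p) = a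

lemma card_le_rpow_of_pow_four_le {s p : ℕ} (h : s ^ 4 ≤ 10 ^ 24 * p ^ 3) :
    (s : ℝ) ≤ 10 ^ 6 * (p : ℝ) ^ ((3 : ℝ) / 4) := by
  have h1 : (s : ℝ) ^ 4 ≤ (10 ^ 6 * (p : ℝ) ^ ((3 : ℝ) / 4)) ^ 4 := by
    rw [mul_pow, ← Real.rpow_natCast ((p : ℝ) ^ ((3 : ℝ) / 4)), ← Real.rpow_mul (by positivity)]
    norm_num
    exact_mod_cast h
  exact le_of_pow_le_pow_left₀ (by norm_num) (by positivity) h1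

lemma card_traceResidues_le {p : ℕ} [Fact p.Prime] (hp : 3 < p) {A B : ℤ[X]} {a : ℤ} {i j : ℕ}
    (ha : ¬ (p : ℤ) ∣ a) (hA : ¬ (p : ℤ) ∣ A.leadingCoeff) (hB : ¬ (p : ℤ) ∣ B.leadingCoeff)
    (hD : ¬ (p : ℤ) ∣ minor A B i j) :
    ((traceResidues A B a p).card : ℝ) ≤
      (10 ^ 7 * (A.natDegree + B.natDegree)) * (p : ℝ) ^ ((3 : ℝ) / 4) := by
  classical
  have h27 : (27 : ZMod p) ≠ 0 := by
    have h3 : (3 : ZMod p) ≠ 0 := by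
      exact_mod_cast natCast_ne_zero_of_prime_lt (p := p) (n := 3) (by omega) (by omega)
    rw [show (27 : ZMod p) = 3 ^ 3 by norm_num]
    exact pow_ne_zero _ h3
  have hneg4 : (4 : ZMod p) ≠ 0 := by
    exact_mod_cast natCast_ne_zero_of_prime_lt (p := p) (n := 4) (by omega) (by
      have : p ≠ 4 := by
        rintro rfl
        exact absurd (Fact.out : Nat.Prime 4) (by norm_num)
      omega)
  have ha0 : (a : ZMod p) ≠ 0 := by rwa [Ne, ZMod.intCast_zmod_eq_zero_iff_dvd]
  have hs : HasseSystem (hasse (ZMod p) p) (hasse' (ZMod p) p) := hasseSystem hp <| by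
    have := (Fact.out : p.Prime).eq_two_or_odd
    omega
  set S := fun c : ZMod p => Finset.univ.filter fun t => t ≠ 0 ∧ t ≠ 1 ∧
    (hasse (ZMod p) p).eval t = c with hS
  have hS' : ∀ c ≠ 0, ((S c).card : ℝ) ≤ 10 ^ 6 * (p : ℝ) ^ ((3 : ℝ) / 4) := fun c hc =>
    card_le_rpow_of_pow_four_le
      (hs.card_pow_four_le (natDegree_hasse_le p) (natDegree_hasse'_le p) hc)
  set fib := fun t : ZMod p => Finset.univ.filter fun ρ : ZMod p =>
      t * (27 * evalMod p B ρ ^ 2) = -4 * evalMod p A ρ ^ 3 with hfib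
  have hsub : traceResidues A B a p ⊆ ((Finset.univ.filter fun ρ => evalMod p A ρ = 0) ∪
      (Finset.univ.filter fun ρ => evalMod p B ρ = 0)) ∪
      (S a ∪ S (-a)).biUnion fib := by
    intro ρ hρ
    rw [traceResidues, Finset.mem_filter] at hρ
    obtain ⟨-, h1, h2⟩ := hρ
    by_cases hu : evalMod p A ρ = 0
    · simp [hu]
    by_cases hv : evalMod p B ρ = 0
    · simp [hv]
    refine Finset.mem_union_right _ (Finset.mem_biUnion.mpr ?_)
    have hden : 27 * evalMod p B ρ ^ 2 ≠ 0 := mul_ne_zero h27 (pow_ne_zero _ hv)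
    set t := -4 * evalMod p A ρ ^ 3 / (27 * evalMod p B ρ ^ 2)
    have ht : t * (27 * evalMod p B ρ ^ 2) = -4 * evalMod p A ρ ^ 3 := div_mul_cancel₀ _ hden
    have ht0 : t ≠ 0 := fun h => by
      rw [h, zero_mul, neg_mul, eq_comm, neg_eq_zero] at ht
      exact mul_ne_zero hneg4 (pow_ne_zero _ hu) ht
    have ht1 : t ≠ 1 := fun h => by
      rw [h] at ht
      exact h1 (by linear_combination ht)
    refine ⟨t, ?_, ?_⟩
    · simp only [hS, Finset.mem_union, Finset.mem_filter, Finset.mem_univ, true_and]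
      rcases trace_eq_hasse hp hu hv ht with h | h
      · exact Or.inl ⟨ht0, ht1, h ▸ h2⟩
      · exact Or.inr ⟨ht0, ht1, by rw [← h2, h, neg_neg]⟩
    · simp only [hfib, Finset.mem_filter, Finset.mem_univ, true_and]
      exact ht
  have hcard := (Finset.card_le_card hsub).trans (Finset.card_union_le _ _)
  have h1 := Finset.card_union_le (Finset.univ.filter fun ρ : ZMod p => evalMod p A ρ = 0)
      (Finset.univ.filter fun ρ => evalMod p B ρ = 0)
  have h2 := card_evalMod_eq_zero_le hA
  have h3 := card_evalMod_eq_zero_le hB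
  have h4 : ((S a ∪ S (-a)).biUnion fib).card ≤
      (S a ∪ S (-a)).card * (3 * A.natDegree + 2 * B.natDegree) :=
    Finset.card_biUnion_le_card_mul _ _ _ fun t _ => card_fiber_le hp hD t
  have h5 := Finset.card_union_le (S a) (S (-a))
  have h6 := hS' a ha0
  have h7 := hS' (-a) (neg_ne_zero.mpr ha0)
  have hp1 : (1 : ℝ) ≤ (p : ℝ) ^ ((3 : ℝ) / 4) :=
    Real.one_le_rpow (by exact_mod_cast (show 1 ≤ p by omega)) (by norm_num)
  have h8 : (traceResidues A B a p).card ≤ A.natDegree + B.natDegree +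
      ((S a).card + (S (-a)).card) * (3 * A.natDegree + 2 * B.natDegree) := by
    have := h4.trans (Nat.mul_le_mul_right _ h5)
    omega
  have h9 : ((traceResidues A B a p).card : ℝ) ≤ A.natDegree + B.natDegree +
      ((S a).card + (S (-a)).card) * (3 * A.natDegree + 2 * B.natDegree) := by exact_mod_cast h8
  set y := (p : ℝ) ^ ((3 : ℝ) / 4)
  have hd : (0 : ℝ) ≤ A.natDegree := Nat.cast_nonneg _
  have he : (0 : ℝ) ≤ B.natDegree := Nat.cast_nonneg _
  have h10 : (((S a).card : ℝ) + (S (-a)).card) * (3 * A.natDegree + 2 * B.natDegree) ≤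
      (2 * 10 ^ 6 * y) * (3 * (A.natDegree + B.natDegree)) := by
    refine mul_le_mul (by linarith) (by linarith) (by positivity) (by positivity)
  nlinarith [mul_le_mul_of_nonneg_left hp1 (add_nonneg hd he)]

end HasseJet

namespace HasseJet

open Polynomial

/-- The numerator `β^deg A · A(α/β)`. -/
noncomputable def homNum (A : ℤ[X]) (α β : ℤ) : ℤ :=
  ∑ i ∈ Finset.range (A.natDegree + 1), A.coeff i * α ^ i * β ^ (A.natDegree - i)

lemma homNum_cast {K : Type*} [Field K] (A : ℤ[X]) (α β : ℤ) (hβ : (β : K) ≠ 0) :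
    (homNum A α β : K) =
      A.eval₂ (Int.castRingHom K) ((α : K) * (β : K)⁻¹) * (β : K) ^ A.natDegree := by
  rw [homNum, eval₂_eq_sum_range, Finset.sum_mul]
  push_cast
  refine Finset.sum_congr rfl fun i hi => ?_
  rw [Finset.mem_range] at hi
  obtain ⟨d, hd⟩ : ∃ d, A.natDegree = i + d := ⟨A.natDegree - i, by omega⟩
  rw [hd, Nat.add_sub_cancel_left, pow_add, mul_pow, eq_intCast, inv_pow]
  field_simp

lemma num_mul_eq {q : ℚ} {b m : ℤ} (h : q * b = m) : q.num * b = m * q.den := by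
  have h1 : (q.den : ℚ) ≠ 0 := by exact_mod_cast q.den_nz
  have h2 : q * q.den = q.num := Rat.mul_den_eq_num q
  have h3 : ((q.num * b : ℤ) : ℚ) = ((m * q.den : ℤ) : ℚ) := by
    push_cast
    rw [← h2]
    linear_combination (q.den : ℚ) * h
  exact_mod_cast h3

lemma evalQ_num_mul {A : ℤ[X]} {α β : ℕ} (hβ : β ≠ 0) :
    (evalQ A (fareyFrac (α, β))).num * (β : ℤ) ^ A.natDegree =
      homNum A α β * (evalQ A (fareyFrac (α, β))).den := by
  apply num_mul_eq
  rw [homNum_cast (K := ℚ) A α β (by exact_mod_cast hβ), evalQ, fareyFrac, div_eq_mul_inv]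
  push_cast
  rfl

lemma dvd_den_of_dvd {A : ℤ[X]} {α β p : ℕ} (hp : p.Prime) (hβ : β ≠ 0) (hc : Nat.Coprime α β)
    (hA : ¬ (p : ℤ) ∣ A.leadingCoeff) (hdeg : A.natDegree ≠ 0) (hpβ : p ∣ β) :
    (p : ℤ) ∣ (evalQ A (fareyFrac (α, β))).den := by
  have hpi : Prime (p : ℤ) := Nat.prime_iff_prime_int.mp hp
  have hpβ' : (p : ℤ) ∣ β := by exact_mod_cast hpβ
  have h1 := evalQ_num_mul (A := A) (α := α) hβ
  have h2 : (p : ℤ) ∣ homNum A α β * (evalQ A (fareyFrac (α, β))).den := by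
    rw [← h1]
    exact ((hpβ'.trans (dvd_pow_self _ hdeg))).mul_left _
  refine (hpi.dvd_or_dvd h2).resolve_left fun h3 => ?_
  rw [homNum, Finset.sum_range_succ, Nat.sub_self, pow_zero, mul_one, dvd_add_right] at h3
  · rcases hpi.dvd_or_dvd h3 with h | h
    · exact hA h
    · have h4 : p ∣ α := by exact_mod_cast hpi.dvd_of_dvd_pow h
      exact hp.one_lt.ne' (Nat.eq_one_of_dvd_coprimes hc h4 hpβ)
  · refine Finset.dvd_sum fun i hi => ?_
    rw [Finset.mem_range] at hi
    exact (hpβ'.trans (dvd_pow_self _ (by omega))).mul_left _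

lemma ratRed_evalQ {A : ℤ[X]} {α β p : ℕ} [Fact p.Prime] (hpβ : ¬ p ∣ β)
    (hd : ¬ (p : ℤ) ∣ (evalQ A (fareyFrac (α, β))).den) :
    ratRed p (evalQ A (fareyFrac (α, β))) = evalMod p A ((α : ZMod p) * (β : ZMod p)⁻¹) := by
  have hβ : β ≠ 0 := by rintro rfl; exact hpβ (dvd_zero p)
  have hβ' : (β : ZMod p) ≠ 0 := by rwa [Ne, ZMod.natCast_eq_zero_iff]
  have hd' : ((evalQ A (fareyFrac (α, β))).den : ZMod p) ≠ 0 := by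
    rw [Ne, ZMod.natCast_eq_zero_iff]; exact_mod_cast hd
  have h1 := congrArg (Int.cast : ℤ → ZMod p) (evalQ_num_mul (A := A) (α := α) hβ)
  push_cast at h1
  rw [homNum_cast (K := ZMod p) A α β (by exact_mod_cast hβ')] at h1
  push_cast at h1
  rw [ratRed, evalMod]
  refine mul_right_cancel₀ (pow_ne_zero A.natDegree hβ') (mul_right_cancel₀ hd' ?_)
  rw [← h1]
  field_simp

lemma disc_ne_zero {A B : ℤ[X]} {τ : ℚ} {p : ℕ} [Fact p.Prime] (h : goodRed A B τ p) :
    4 * ratRed p (evalQ A τ) ^ 3 + 27 * ratRed p (evalQ B τ) ^ 2 ≠ 0 := by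
  obtain ⟨hA, hB, hD⟩ := h
  intro h0
  apply hD
  have hA' : ((evalQ A τ).den : ZMod p) ≠ 0 := by
    rw [Ne, ZMod.natCast_eq_zero_iff]; exact_mod_cast hA
  have hB' : ((evalQ B τ).den : ZMod p) ≠ 0 := by
    rw [Ne, ZMod.natCast_eq_zero_iff]; exact_mod_cast hB
  have h1 : discQ A B τ * (((evalQ A τ).den ^ 3 * (evalQ B τ).den ^ 2 : ℤ)) =
      ((-16 * (4 * (evalQ A τ).num ^ 3 * (evalQ B τ).den ^ 2 +
        27 * (evalQ B τ).num ^ 2 * (evalQ A τ).den ^ 3) : ℤ) : ℚ) := by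
    have hx : evalQ A τ * (evalQ A τ).den = (evalQ A τ).num := Rat.mul_den_eq_num _
    have hy : evalQ B τ * (evalQ B τ).den = (evalQ B τ).num := Rat.mul_den_eq_num _
    push_cast
    rw [← hx, ← hy, discQ]
    ring
  have h2 := congrArg (Int.cast : ℤ → ZMod p) (num_mul_eq h1)
  push_cast at h2
  have h3 : 4 * ((evalQ A τ).num : ZMod p) ^ 3 * (evalQ B τ).den ^ 2 +
      27 * ((evalQ B τ).num : ZMod p) ^ 2 * (evalQ A τ).den ^ 3 = 0 := by
    rw [ratRed, ratRed] at h0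
    field_simp at h0
    linear_combination h0
  rw [h3, mul_zero, zero_mul] at h2
  rw [ratRed]
  rcases mul_eq_zero.mp h2 with h | h
  · rw [h, zero_mul]
  · exact absurd h (mul_ne_zero (pow_ne_zero _ hA') (pow_ne_zero _ hB'))

lemma mem_traceResidues {A B : ℤ[X]} {a : ℤ} {α β p : ℕ} [Fact p.Prime] (hβ : β ≠ 0)
    (hc : Nat.Coprime α β) (hA : ¬ (p : ℤ) ∣ A.leadingCoeff) (hB : ¬ (p : ℤ) ∣ B.leadingCoeff)
    (hdeg : A.natDegree ≠ 0 ∨ B.natDegree ≠ 0) (hg : goodRed A B (fareyFrac (α, β)) p)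
    (ht : apFrob A B (fareyFrac (α, β)) p = a) :
    ¬ p ∣ β ∧ (α : ZMod p) * (β : ZMod p)⁻¹ ∈ traceResidues A B a p := by
  have hpβ : ¬ p ∣ β := fun h => by
    rcases hdeg with hd | hd
    · exact hg.1 (dvd_den_of_dvd Fact.out hβ hc hA hd h)
    · exact hg.2.1 (dvd_den_of_dvd Fact.out hβ hc hB hd h)
  refine ⟨hpβ, ?_⟩
  have h1 := disc_ne_zero hg
  rw [apFrob] at ht
  rw [ratRed_evalQ hpβ hg.1, ratRed_evalQ hpβ hg.2.1] at h1 ht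
  rw [traceResidues, Finset.mem_filter]
  exact ⟨Finset.mem_univ _, h1, by rw [ht]⟩

lemma exists_minor_ne_zero {A B : ℤ[X]} (hΔ : 4 * A ^ 3 + 27 * B ^ 2 ≠ 0) (hj : jNonconstant A B) :
    A ≠ 0 ∧ B ≠ 0 ∧ ∃ i j, minor A B i j ≠ 0 := by
  have hA : A ≠ 0 := by
    rintro rfl
    exact hj 0 (by simp)
  have hB : B ≠ 0 := by
    rintro rfl
    refine hj (-1728) ?_
    have : (C (-1728 : ℚ)) = -1728 := by rw [map_neg, C_ofNat]
    rw [this]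
    simp
    ring
  refine ⟨hA, hB, ?_⟩
  by_contra! hall
  set φ := Int.castRingHom ℚ
  set b := (B ^ 2).leadingCoeff with hb
  set r : ℚ := ((A ^ 3).coeff (B ^ 2).natDegree : ℚ) / b with hr
  have hb0 : (b : ℚ) ≠ 0 := by
    rw [hb]; exact_mod_cast leadingCoeff_ne_zero.mpr (pow_ne_zero _ hB)
  have h1 : (A.map φ) ^ 3 = C r * (B.map φ) ^ 2 := by
    rw [← Polynomial.map_pow, ← Polynomial.map_pow]
    ext n
    rw [coeff_C_mul, coeff_map, coeff_map]
    have h2 : ((minor A B n (B ^ 2).natDegree : ℤ) : ℚ) = 0 := by rw [hall]; simp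
    rw [minor] at h2
    push_cast at h2
    rw [coeff_natDegree, ← hb] at h2
    rw [hr]
    simp only [φ, eq_intCast]
    field_simp
    linear_combination h2
  by_cases h27 : 4 * r + 27 = 0
  · apply hΔ
    apply map_injective φ (RingHom.injective_int φ)
    have h3 : (C (4 * r + 27) : ℚ[X]) = 0 := by rw [h27, C_0]
    simp only [map_add, map_mul, C_ofNat] at h3
    simp only [Polynomial.map_add, Polynomial.map_mul, Polynomial.map_pow, Polynomial.map_ofNat,
      Polynomial.map_zero]
    linear_combination 4 * h1 + (B.map φ) ^ 2 * h3
  · refine hj (-6912 * r / (4 * r + 27)) ?_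
    change (-6912 : ℚ[X]) * (A.map φ) ^ 3 = _ * (4 * (A.map φ) ^ 3 + 27 * (B.map φ) ^ 2)
    rw [h1]
    have h3 : (C (-6912 * r / (4 * r + 27)) * C (4 * r + 27) : ℚ[X]) = C (-6912 * r) := by
      rw [← C_mul, div_mul_cancel₀ _ h27]
    have h4 : (C (-6912 : ℚ)) = -6912 := by rw [map_neg, C_ofNat]
    rw [C_add, C_mul, C_mul (a := -6912), h4, C_ofNat, C_ofNat] at h3
    linear_combination (-(B.map φ) ^ 2) * h3

lemma natDegree_ne_zero_of_minor {A B : ℤ[X]} {i j : ℕ} (h : minor A B i j ≠ 0) :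
    A.natDegree ≠ 0 ∨ B.natDegree ≠ 0 := by
  by_contra! h0
  obtain ⟨hA, hB⟩ := h0
  rw [natDegree_eq_zero] at hA hB
  obtain ⟨x, rfl⟩ := hA
  obtain ⟨y, rfl⟩ := hB
  apply h
  rw [minor, ← C_pow, ← C_pow]
  simp only [coeff_C]
  by_cases hi : i = 0 <;> by_cases hj : j = 0 <;> simp [hi, hj]

end HasseJet

namespace HasseJet

open Polynomial

lemma card_noncoprime_le (N : ℕ) :
    (((Finset.Icc 1 N ×ˢ Finset.Icc 1 N).filter fun ab => ¬ Nat.Coprime ab.1 ab.2).card : ℝ) ≤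
      3 / 4 * (N : ℝ) ^ 2 := by
  have hsub : ((Finset.Icc 1 N ×ˢ Finset.Icc 1 N).filter fun ab => ¬ Nat.Coprime ab.1 ab.2) ⊆
      (Finset.Icc 2 N).biUnion fun d => ((Finset.Ioc 0 N).filter (d ∣ ·)) ×ˢ
        ((Finset.Ioc 0 N).filter (d ∣ ·)) := by
    rintro ⟨a, b⟩ h
    simp only [Finset.mem_filter, Finset.mem_product, Finset.mem_Icc] at h
    obtain ⟨⟨⟨ha, ha'⟩, hb, hb'⟩, hc⟩ := h
    have h0 : 0 < Nat.gcd a b := Nat.gcd_pos_of_pos_left _ ha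
    have h1 : Nat.gcd a b ≤ a := Nat.le_of_dvd ha (Nat.gcd_dvd_left _ _)
    have h2 : Nat.gcd a b ≠ 1 := hc
    simp only [Finset.mem_biUnion, Finset.mem_product, Finset.mem_filter, Finset.mem_Ioc,
      Finset.mem_Icc]
    exact ⟨Nat.gcd a b, by omega, ⟨⟨ha, ha'⟩, Nat.gcd_dvd_left _ _⟩, ⟨hb, hb'⟩,
      Nat.gcd_dvd_right _ _⟩
  have h1 := (Finset.card_le_card hsub).trans Finset.card_biUnion_le
  simp only [Finset.card_product, Nat.Ioc_filter_dvd_card_eq_div] at h1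
  have hsum : ∀ n : ℕ, 2 ≤ n → ∑ d ∈ Finset.Icc 2 n, (1 : ℝ) / (d : ℝ) ^ 2 ≤ 3 / 4 - 1 / n := by
    intro n hn
    induction n, hn using Nat.le_induction with
    | base => norm_num
    | succ n hn ih =>
      rw [Finset.sum_Icc_succ_top (by omega)]
      have hn0 : (0 : ℝ) < n := by exact_mod_cast (by omega : 0 < n)
      have h3 : (1 : ℝ) / ((n + 1 : ℕ) : ℝ) ^ 2 ≤ 1 / n - 1 / ((n + 1 : ℕ) : ℝ) := by
        push_cast
        rw [div_sub_div _ _ hn0.ne' (by positivity), div_le_div_iff₀ (by positivity) (by positivity)]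
        nlinarith
      linarith
  have hsum' : ∑ d ∈ Finset.Icc 2 N, (1 : ℝ) / (d : ℝ) ^ 2 ≤ 3 / 4 := by
    by_cases hN : 2 ≤ N
    · exact (hsum N hN).trans (sub_le_self _ (by positivity))
    · rw [Finset.Icc_eq_empty (by omega)]; norm_num
  calc _ ≤ ((∑ d ∈ Finset.Icc 2 N, N / d * (N / d) : ℕ) : ℝ) := by exact_mod_cast h1
    _ ≤ ∑ d ∈ Finset.Icc 2 N, (N : ℝ) ^ 2 * (1 / (d : ℝ) ^ 2) := by
      push_cast
      refine Finset.sum_le_sum fun d _ => ?_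
      have : ((N / d : ℕ) : ℝ) ≤ N / d := Nat.cast_div_le
      calc ((N / d : ℕ) : ℝ) * ((N / d : ℕ) : ℝ) ≤ (N / d : ℝ) * (N / d) :=
            mul_le_mul this this (by positivity) (by positivity)
        _ = _ := by ring
    _ = (N : ℝ) ^ 2 * ∑ d ∈ Finset.Icc 2 N, (1 : ℝ) / (d : ℝ) ^ 2 := by rw [Finset.mul_sum]
    _ ≤ (N : ℝ) ^ 2 * (3 / 4) := by gcongr
    _ = _ := by ring

lemma sq_le_four_mul_card_fareyPairs (T : ℝ) :
    (⌊T⌋₊ : ℝ) ^ 2 ≤ 4 * (fareyPairs T).card := by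
  have h1 := card_noncoprime_le ⌊T⌋₊
  have h2 := Finset.card_filter_add_card_filter_not (s := Finset.Icc 1 ⌊T⌋₊ ×ˢ Finset.Icc 1 ⌊T⌋₊)
    (fun ab => Nat.Coprime ab.1 ab.2)
  rw [Finset.card_product, Nat.card_Icc, Nat.add_sub_cancel] at h2
  have h3 : ((fareyPairs T).card : ℝ) +
      ((Finset.Icc 1 ⌊T⌋₊ ×ˢ Finset.Icc 1 ⌊T⌋₊).filter fun ab => ¬ Nat.Coprime ab.1 ab.2).card =
        (⌊T⌋₊ : ℝ) * ⌊T⌋₊ := by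
    rw [fareyPairs]; exact_mod_cast h2
  nlinarith

lemma card_le_of_pairwise_dvd {p N : ℕ} (hp : 0 < p) (S : Finset (ℕ × ℕ))
    (hS : ∀ s ∈ S, 1 ≤ s.1 ∧ s.1 ≤ s.2 ∧ s.2 ≤ N ∧ Nat.Coprime s.1 s.2)
    (hd : ∀ s ∈ S, ∀ s' ∈ S, s.1 * s'.2 ≡ s'.1 * s.2 [MOD p]) :
    S.card ≤ N ^ 2 / p + 1 := by
  have hlt : ∀ s ∈ S, ∀ s' ∈ S, s'.1 * s.2 < s.1 * s'.2 →
      s'.1 * N ^ 2 / (s'.2 * p) < s.1 * N ^ 2 / (s.2 * p) := by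
    intro s hs s' hs' h
    obtain ⟨h1, h2, h3, -⟩ := hS s hs
    obtain ⟨h1', h2', h3', -⟩ := hS s' hs'
    have hge : s'.1 * s.2 + p ≤ s.1 * s'.2 := by
      have hdv : p ∣ s.1 * s'.2 - s'.1 * s.2 :=
        (Nat.modEq_iff_dvd' h.le).mp (hd s hs s' hs').symm
      have := Nat.le_of_dvd (by omega) hdv
      omega
    rw [Nat.lt_iff_add_one_le, Nat.le_div_iff_mul_le (Nat.mul_pos (by omega) hp)]
    set k := s'.1 * N ^ 2 / (s'.2 * p)
    have hk : k * (s'.2 * p) ≤ s'.1 * N ^ 2 := Nat.div_mul_le_self _ _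
    refine Nat.le_of_mul_le_mul_right (c := s'.2) ?_ (by omega)
    calc (k + 1) * (s.2 * p) * s'.2 = k * (s'.2 * p) * s.2 + s.2 * s'.2 * p := by ring
      _ ≤ s'.1 * N ^ 2 * s.2 + N * N * p := by gcongr
      _ = (s'.1 * s.2 + p) * N ^ 2 := by ring
      _ ≤ (s.1 * s'.2) * N ^ 2 := Nat.mul_le_mul_right _ hge
      _ = _ := by ring
  rw [← Finset.card_range (N ^ 2 / p + 1)]
  refine Finset.card_le_card_of_injOn (fun s => s.1 * N ^ 2 / (s.2 * p)) ?_ ?_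
  · intro s hs
    obtain ⟨h1, h2, h3, -⟩ := hS s hs
    rw [Finset.coe_range, Set.mem_Iio, Nat.lt_succ_iff]
    change s.1 * N ^ 2 / (s.2 * p) ≤ N ^ 2 / p
    rw [← Nat.div_div_eq_div_mul]
    refine Nat.div_le_div_right (Nat.div_le_of_le_mul ?_)
    exact Nat.mul_le_mul_right _ h2
  · intro s hs s' hs' he
    obtain ⟨h1, h2, h3, hc⟩ := hS s hs
    obtain ⟨h1', h2', h3', hc'⟩ := hS s' hs'
    have heq : s.1 * s'.2 = s'.1 * s.2 := by
      rcases lt_trichotomy (s.1 * s'.2) (s'.1 * s.2) with h | h | h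
      · exact absurd he (hlt s' hs' s hs h).ne
      · exact h
      · exact absurd he (hlt s hs s' hs' h).ne'
    have e1 : s.1 = s'.1 := by
      refine Nat.dvd_antisymm ?_ ?_
      · exact hc.dvd_of_dvd_mul_right (heq ▸ Dvd.intro _ rfl)
      · exact hc'.dvd_of_dvd_mul_right (heq ▸ Dvd.intro _ rfl)
    refine Prod.ext e1 ?_
    rw [e1] at heq
    exact (Nat.eq_of_mul_eq_mul_left (by omega) heq).symm

lemma card_residue_le {p : ℕ} [Fact p.Prime] (T : ℝ) (ρ : ZMod p) :
    ((fareyPairs T).filter fun ab => ¬ p ∣ ab.2 ∧ (ab.1 : ZMod p) * (ab.2 : ZMod p)⁻¹ = ρ).card ≤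
      2 * (⌊T⌋₊ ^ 2 / p + 1) := by
  classical
  have hp : 0 < p := (Fact.out : p.Prime).pos
  set S := (fareyPairs T).filter fun ab => ¬ p ∣ ab.2 ∧ (ab.1 : ZMod p) * (ab.2 : ZMod p)⁻¹ = ρ
    with hS
  have hmem : ∀ s ∈ S, (1 ≤ s.1 ∧ s.1 ≤ ⌊T⌋₊) ∧ (1 ≤ s.2 ∧ s.2 ≤ ⌊T⌋₊) ∧ Nat.Coprime s.1 s.2 ∧
      (s.1 : ZMod p) = ρ * s.2 := by
    intro s hs
    rw [hS, Finset.mem_filter, fareyPairs, Finset.mem_filter, Finset.mem_product, Finset.mem_Icc,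
      Finset.mem_Icc] at hs
    obtain ⟨⟨⟨h1, h2⟩, h3⟩, h4, h5⟩ := hs
    have h6 : (s.2 : ZMod p) ≠ 0 := by rwa [Ne, ZMod.natCast_eq_zero_iff]
    exact ⟨h1, h2, h3, by rw [← h5, inv_mul_cancel_right₀ h6]⟩
  have hmod : ∀ s ∈ S, ∀ s' ∈ S, s.1 * s'.2 ≡ s'.1 * s.2 [MOD p] := by
    intro s hs s' hs'
    rw [← ZMod.natCast_eq_natCast_iff]
    push_cast
    rw [(hmem s hs).2.2.2, (hmem s' hs').2.2.2]
    ring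
  have h1 : (S.filter fun s => s.1 ≤ s.2).card ≤ ⌊T⌋₊ ^ 2 / p + 1 := by
    refine card_le_of_pairwise_dvd hp _ (fun s hs => ?_) fun s hs s' hs' =>
      hmod s (Finset.mem_filter.mp hs).1 s' (Finset.mem_filter.mp hs').1
    rw [Finset.mem_filter] at hs
    have := hmem s hs.1
    exact ⟨this.1.1, hs.2, this.2.1.2, this.2.2.1⟩
  have h2 : (S.filter fun s => ¬ s.1 ≤ s.2).card ≤ ⌊T⌋₊ ^ 2 / p + 1 := by
    rw [← Finset.card_image_of_injective _ Prod.swap_injective]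
    refine card_le_of_pairwise_dvd hp _ (fun s hs => ?_) fun s hs s' hs' => ?_
    · rw [Finset.mem_image] at hs
      obtain ⟨u, hu, rfl⟩ := hs
      rw [Finset.mem_filter] at hu
      have := hmem u hu.1
      exact ⟨this.2.1.1, (not_le.mp hu.2).le, this.1.2, this.2.2.1.symm⟩
    · rw [Finset.mem_image] at hs hs'
      obtain ⟨u, hu, rfl⟩ := hs
      obtain ⟨u', hu', rfl⟩ := hs'
      have := hmod u' (Finset.mem_filter.mp hu').1 u (Finset.mem_filter.mp hu).1
      simpa [mul_comm] using this
  have h3 := Finset.card_filter_add_card_filter_not (s := S) (fun s => s.1 ≤ s.2)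
  omega

lemma sum_rpow_neg_quarter_le (n : ℕ) :
    ∑ q ∈ Finset.range (n + 1), (q : ℝ) ^ (-(1 : ℝ) / 4) ≤ 2 * (n : ℝ) ^ ((3 : ℝ) / 4) := by
  induction n with
  | zero => norm_num
  | succ n ih =>
    rw [Finset.sum_range_succ]
    have hb : (0 : ℝ) < ((n + 1 : ℕ) : ℝ) := by positivity
    have h1 := Real.geom_mean_le_arith_mean2_weighted (w₁ := 3 / 4) (w₂ := 1 / 4) (p₁ := n)
      (p₂ := ((n + 1 : ℕ) : ℝ)) (by norm_num) (by norm_num) (by positivity) hb.le (by norm_num)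
    set b := ((n + 1 : ℕ) : ℝ) with hbdef
    have hbn : b = n + 1 := by rw [hbdef]; push_cast; rfl
    have h2 : b ^ (-(1 : ℝ) / 4) * b ^ ((1 : ℝ) / 4) = 1 := by
      rw [← Real.rpow_add hb]; norm_num
    have h3 : b ^ ((3 : ℝ) / 4) * b ^ ((1 : ℝ) / 4) = b := by
      rw [← Real.rpow_add hb]; norm_num
    have h4 : 0 < b ^ ((1 : ℝ) / 4) := Real.rpow_pos_of_pos hb _
    refine (add_le_add_left ih _).trans ?_
    refine le_of_mul_le_mul_right ?_ h4
    rw [add_mul, h2, mul_assoc, mul_assoc, h3]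
    linarith

end HasseJet

namespace HasseJet

open Polynomial

open Classical in
/-- The number of Farey fractions of order `T` whose specialization has good reduction at `q`
with trace of Frobenius `a`. -/
noncomputable def traceCount (A B : ℤ[X]) (a : ℤ) (T : ℝ) (q : ℕ) : ℕ :=
  ((fareyPairs T).filter fun ab =>
    q.Prime ∧ goodRed A B (fareyFrac ab) q ∧ apFrob A B (fareyFrac ab) q = a).card

lemma sum_piTrace (A B : ℤ[X]) (a : ℤ) (x T : ℝ) :
    ∑ ab ∈ fareyPairs T, PiTrace A B (fareyFrac ab) a x =
      ∑ q ∈ Finset.range (⌊x⌋₊ + 1), traceCount A B a T q := by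
  classical
  simp only [PiTrace, traceCount, Finset.card_filter]
  rw [Finset.sum_comm]

lemma traceCount_le {q : ℕ} [Fact q.Prime] (hq : 3 < q) {A B : ℤ[X]} {a : ℤ} {i j : ℕ}
    (ha : ¬ (q : ℤ) ∣ a) (hA : ¬ (q : ℤ) ∣ A.leadingCoeff) (hB : ¬ (q : ℤ) ∣ B.leadingCoeff)
    (hD : ¬ (q : ℤ) ∣ minor A B i j) (T : ℝ) :
    (traceCount A B a T q : ℝ) ≤ 2 * (10 ^ 7 * (A.natDegree + B.natDegree)) *
      ((q : ℝ) ^ (-(1 : ℝ) / 4) * (⌊T⌋₊ : ℝ) ^ 2 + (q : ℝ) ^ ((3 : ℝ) / 4)) := by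
  classical
  have hdeg := natDegree_ne_zero_of_minor (A := A) (B := B) (i := i) (j := j)
    fun h => hD (h ▸ dvd_zero _)
  have hq0 : (0 : ℝ) < q := by exact_mod_cast (by omega : 0 < q)
  have hcard : traceCount A B a T q ≤
      (traceResidues A B a q).card * (2 * (⌊T⌋₊ ^ 2 / q + 1)) := by
    refine le_trans (Finset.card_le_card (t := (traceResidues A B a q).biUnion fun ρ =>
      (fareyPairs T).filter fun ab =>
        ¬ q ∣ ab.2 ∧ (ab.1 : ZMod q) * (ab.2 : ZMod q)⁻¹ = ρ) ?_)
      (Finset.card_biUnion_le_card_mul _ _ _ fun ρ _ => card_residue_le T ρ)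
    rintro ⟨α, β⟩ hab
    obtain ⟨hF, -, hg, ht⟩ := Finset.mem_filter.mp hab
    have hF' := hF
    simp only [fareyPairs, Finset.mem_filter, Finset.mem_product, Finset.mem_Icc] at hF'
    obtain ⟨h1, h2⟩ := mem_traceResidues (by omega) hF'.2 hA hB hdeg hg ht
    exact Finset.mem_biUnion.mpr ⟨_, h2, Finset.mem_filter.mpr ⟨hF, h1, rfl⟩⟩
  have hdiv : ((⌊T⌋₊ ^ 2 / q : ℕ) : ℝ) ≤ (⌊T⌋₊ : ℝ) ^ 2 / q := by
    exact_mod_cast Nat.cast_div_le (α := ℝ) (m := ⌊T⌋₊ ^ 2) (n := q)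
  have hpow : (q : ℝ) ^ ((3 : ℝ) / 4) / q = (q : ℝ) ^ (-(1 : ℝ) / 4) := by
    rw [← Real.rpow_sub_one hq0.ne']
    norm_num
  calc (traceCount A B a T q : ℝ)
      ≤ (traceResidues A B a q).card * (2 * ((⌊T⌋₊ ^ 2 / q : ℕ) + 1)) := by exact_mod_cast hcard
    _ ≤ ((10 ^ 7 * (A.natDegree + B.natDegree)) * (q : ℝ) ^ ((3 : ℝ) / 4)) *
          (2 * ((⌊T⌋₊ : ℝ) ^ 2 / q + 1)) := by
        gcongr
        exact card_traceResidues_le hq ha hA hB hD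
    _ = _ := by rw [← hpow]; ring

lemma not_dvd_of_natAbs_lt {q : ℕ} {m : ℤ} (h0 : m ≠ 0) (h : m.natAbs < q) : ¬ (q : ℤ) ∣ m := by
  intro hd
  exact absurd (Nat.le_of_dvd (Int.natAbs_pos.mpr h0) (Int.natCast_dvd.mp hd)) (by omega)

lemma exists_traceCount_le (A B : ℤ[X]) (hΔ : 4 * A ^ 3 + 27 * B ^ 2 ≠ 0)
    (hj : jNonconstant A B) (a : ℤ) (ha : a ≠ 0) :
    ∃ p₀ : ℕ, ∃ κ : ℝ, 0 ≤ κ ∧ ∀ (T : ℝ) (q : ℕ), (traceCount A B a T q : ℝ) ≤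
      (if q ≤ p₀ then ((fareyPairs T).card : ℝ) else 0) +
        κ * ((q : ℝ) ^ (-(1 : ℝ) / 4) * (⌊T⌋₊ : ℝ) ^ 2 + (q : ℝ) ^ ((3 : ℝ) / 4)) := by
  classical
  obtain ⟨hA, hB, i, j, hm⟩ := exists_minor_ne_zero hΔ hj
  refine ⟨3 + a.natAbs + A.leadingCoeff.natAbs + B.leadingCoeff.natAbs + (minor A B i j).natAbs,
    2 * (10 ^ 7 * (A.natDegree + B.natDegree)), by positivity, fun T q => ?_⟩
  split_ifs with hq
  · have h : traceCount A B a T q ≤ (fareyPairs T).card := Finset.card_filter_le _ _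
    have h' : (traceCount A B a T q : ℝ) ≤ (fareyPairs T).card := by exact_mod_cast h
    exact h'.trans (le_add_of_nonneg_right (by positivity))
  · rw [zero_add]
    by_cases hp : q.Prime
    · have := Fact.mk hp
      exact traceCount_le (by omega) (not_dvd_of_natAbs_lt ha (by omega))
        (not_dvd_of_natAbs_lt (leadingCoeff_ne_zero.mpr hA) (by omega))
        (not_dvd_of_natAbs_lt (leadingCoeff_ne_zero.mpr hB) (by omega))
        (not_dvd_of_natAbs_lt hm (by omega)) T
    · have : traceCount A B a T q = 0 := by simp [traceCount, hp]
      rw [this, Nat.cast_zero]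
      positivity

lemma sum_traceCount_le {A B : ℤ[X]} {a : ℤ} {p₀ : ℕ} {κ : ℝ} (hκ : 0 ≤ κ) {T : ℝ}
    (h : ∀ q : ℕ, (traceCount A B a T q : ℝ) ≤
      (if q ≤ p₀ then ((fareyPairs T).card : ℝ) else 0) +
        κ * ((q : ℝ) ^ (-(1 : ℝ) / 4) * (⌊T⌋₊ : ℝ) ^ 2 + (q : ℝ) ^ ((3 : ℝ) / 4)))
    {x : ℝ} (hx : 1 ≤ x) :
    ∑ q ∈ Finset.range (⌊x⌋₊ + 1), (traceCount A B a T q : ℝ) ≤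
      (p₀ + 1) * (fareyPairs T).card +
        κ * (2 * x ^ ((3 : ℝ) / 4) * (⌊T⌋₊ : ℝ) ^ 2 + 2 * x * x ^ ((3 : ℝ) / 4)) := by
  have hfl : (⌊x⌋₊ : ℝ) ≤ x := Nat.floor_le (by linarith)
  have h1 : ∑ q ∈ Finset.range (⌊x⌋₊ + 1), (if q ≤ p₀ then ((fareyPairs T).card : ℝ) else 0) ≤
      (p₀ + 1) * (fareyPairs T).card := by
    rw [← Finset.sum_filter, Finset.sum_const, nsmul_eq_mul]
    gcongr
    have : ((Finset.range (⌊x⌋₊ + 1)).filter fun q => q ≤ p₀).card ≤ p₀ + 1 := by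
      rw [← Finset.card_range (p₀ + 1)]
      refine Finset.card_le_card fun q hq => ?_
      have := (Finset.mem_filter.mp hq).2
      exact Finset.mem_range.mpr (by omega)
    exact_mod_cast this
  have h2 : ∑ q ∈ Finset.range (⌊x⌋₊ + 1), (q : ℝ) ^ (-(1 : ℝ) / 4) ≤ 2 * x ^ ((3 : ℝ) / 4) := by
    refine (sum_rpow_neg_quarter_le _).trans ?_
    gcongr
  have h3 : ∑ q ∈ Finset.range (⌊x⌋₊ + 1), (q : ℝ) ^ ((3 : ℝ) / 4) ≤
      2 * x * x ^ ((3 : ℝ) / 4) := by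
    calc ∑ q ∈ Finset.range (⌊x⌋₊ + 1), (q : ℝ) ^ ((3 : ℝ) / 4)
        ≤ ∑ q ∈ Finset.range (⌊x⌋₊ + 1), x ^ ((3 : ℝ) / 4) := by
          refine Finset.sum_le_sum fun q hq => ?_
          have hq' : (q : ℝ) ≤ ⌊x⌋₊ := by
            exact_mod_cast Nat.lt_succ_iff.mp (Finset.mem_range.mp hq)
          gcongr
          exact hq'.trans hfl
      _ = (⌊x⌋₊ + 1) * x ^ ((3 : ℝ) / 4) := by
          rw [Finset.sum_const, Finset.card_range, nsmul_eq_mul]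
          push_cast
          ring
      _ ≤ _ := by gcongr; linarith
  refine (Finset.sum_le_sum fun q _ => h q).trans ?_
  rw [Finset.sum_add_distrib, ← Finset.mul_sum, Finset.sum_add_distrib, ← Finset.sum_mul]
  gcongr

lemma floor_lower_bounds {x T ε : ℝ} (hx : 1 ≤ x) (hε : 0 < ε)
    (hT : x ^ ((3 : ℝ) / 4 + ε) ≤ T) :
    0 < (⌊T⌋₊ : ℝ) ∧ x * x ^ ((3 : ℝ) / 4) ≤ x ^ ((3 : ℝ) / 4) * (4 * (⌊T⌋₊ : ℝ) ^ 2) := by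
  have hX1 : 1 ≤ x ^ ((3 : ℝ) / 4) := Real.one_le_rpow hx (by norm_num)
  have hXT : x ^ ((3 : ℝ) / 4) ≤ T :=
    (Real.rpow_le_rpow_of_exponent_le hx (by linarith)).trans hT
  have hN : 1 ≤ ⌊T⌋₊ := Nat.le_floor (by simpa using hX1.trans hXT)
  have hN' : (1 : ℝ) ≤ ⌊T⌋₊ := by exact_mod_cast hN
  have hlt : T < ⌊T⌋₊ + 1 := Nat.lt_floor_add_one T
  refine ⟨by linarith, ?_⟩
  have hxX : x ≤ (x ^ ((3 : ℝ) / 4)) ^ 2 := by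
    rw [← Real.rpow_natCast, ← Real.rpow_mul (by linarith)]
    calc x = x ^ (1 : ℝ) := (Real.rpow_one x).symm
      _ ≤ _ := Real.rpow_le_rpow_of_exponent_le hx (by norm_num)
  have hX2 : (x ^ ((3 : ℝ) / 4)) ^ 2 ≤ (2 * (⌊T⌋₊ : ℝ)) ^ 2 := by
    gcongr
    linarith
  rw [mul_comm]
  gcongr
  linarith

end HasseJet

/-- Averaged Lang–Trotter bound for `a ≠ 0`: for `x ≥ 2` and `T ≥ x^{3/4+ε}`,
`(1/#F(T))·Σ_{τ ∈ F(T), Δ(τ) ≠ 0} Π_{E(τ)}(a, x) ≤ C·x^{3/4}`. -/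
theorem avg_lang_trotter_trace_normalized (A B : Polynomial ℤ)
    (hΔ : 4 * A ^ 3 + 27 * B ^ 2 ≠ 0) (hj : jNonconstant A B)
    (a : ℤ) (ha : a ≠ 0) (ε : ℝ) (hε : 0 < ε) :
    ∃ C : ℝ, 0 < C ∧ ∀ x T : ℝ, 2 ≤ x → x ^ ((3 : ℝ) / 4 + ε) ≤ T →
      (1 / ((fareyPairs T).card : ℝ)) *
          ∑ ab ∈ fareyPairs T,
            (if discQ A B (fareyFrac ab) ≠ 0 then
              ((PiTrace A B (fareyFrac ab) a x : ℝ)) else 0) ≤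
        C * x ^ ((3 : ℝ) / 4) := by
  obtain ⟨p₀, κ, hκ, hcount⟩ := HasseJet.exists_traceCount_le A B hΔ hj a ha
  refine ⟨p₀ + 1 + 40 * κ, by positivity, fun x T hx hT => ?_⟩
  have hx1 : 1 ≤ x := by linarith
  obtain ⟨hN, hxN⟩ := HasseJet.floor_lower_bounds hx1 hε hT
  have hF4 := HasseJet.sq_le_four_mul_card_fareyPairs T
  have hF : (0 : ℝ) < (fareyPairs T).card := by
    have : (0 : ℝ) < (⌊T⌋₊ : ℝ) ^ 2 := by positivity
    linarith
  have hX1 : 1 ≤ x ^ ((3 : ℝ) / 4) := Real.one_le_rpow hx1 (by norm_num)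
  rw [one_div, inv_mul_le_iff₀ hF]
  calc ∑ ab ∈ fareyPairs T, (if discQ A B (fareyFrac ab) ≠ 0 then
          ((PiTrace A B (fareyFrac ab) a x : ℝ)) else 0)
      ≤ ∑ ab ∈ fareyPairs T, (PiTrace A B (fareyFrac ab) a x : ℝ) := by
        refine Finset.sum_le_sum fun ab _ => ?_
        split_ifs
        · exact le_rfl
        · exact Nat.cast_nonneg _
    _ = ∑ q ∈ Finset.range (⌊x⌋₊ + 1), (HasseJet.traceCount A B a T q : ℝ) := by
        exact_mod_cast HasseJet.sum_piTrace A B a x T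
    _ ≤ (p₀ + 1) * (fareyPairs T).card +
        κ * (2 * x ^ ((3 : ℝ) / 4) * (⌊T⌋₊ : ℝ) ^ 2 + 2 * x * x ^ ((3 : ℝ) / 4)) :=
        HasseJet.sum_traceCount_le hκ (hcount T) hx1
    _ ≤ (p₀ + 1) * ((fareyPairs T).card * x ^ ((3 : ℝ) / 4)) +
        κ * (40 * ((fareyPairs T).card * x ^ ((3 : ℝ) / 4))) := by
        have hX : x ^ ((3 : ℝ) / 4) * (⌊T⌋₊ : ℝ) ^ 2 ≤
            x ^ ((3 : ℝ) / 4) * (4 * (fareyPairs T).card) := by gcongr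
        gcongr
        · exact le_mul_of_one_le_right hF.le hX1
        · linarith
    _ = _ := by ring
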